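/- Let μ be a positive Radon measure on ℝ^d such that every Lipschitz function f : ℝ^d → ℝ is differentiable μ-almost everywhere. Then μ is absolutely continuous with respect to the d-dimensional Lebesgue measure on ℝ^d. -/

import Mathlib

open MeasureTheory Filter Set Metric Real
open scoped RealInnerProductSpace ENNReal Topology

noncomputable section

/-- A map is bi-Lipschitz onto its image on `E`: there is `L ≥ 1` with
`L⁻¹ d(x,y) ≤ d(F x, F y) ≤ L d(x,y)` for all `x, y ∈ E`. -/
def BiLipschitzOn {X Y : Type*} [MetricSpace X] [MetricSpace Y]
    (F : X → Y) (E : Set X) : Prop :=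
  ∃ L : ℝ, 1 ≤ L ∧ ∀ x ∈ E, ∀ y ∈ E,
    L⁻¹ * dist x y ≤ dist (F x) (F y) ∧ dist (F x) (F y) ≤ L * dist x y

/-- `f` is Lipschitz on the set `S` (with some constant). -/
def IsLipschitzOn {X Y : Type*} [MetricSpace X] [MetricSpace Y]
    (f : X → Y) (S : Set X) : Prop :=
  ∃ K : NNReal, LipschitzOnWith K f S

/-- `df` is the (Cheeger/Lipschitz) differential of `f` at `x` with respect to the chart map
`φ`, relative to the ambient set `S`:
`lim_{y → x, y ∈ S} |f y - f x - df ⬝ (φ y - φ x)| / d(y,x) = 0`. -/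
def HasChartDerivAt {X : Type*} [MetricSpace X] (S : Set X) {n : ℕ}
    (φ : X → EuclideanSpace ℝ (Fin n)) (f : X → ℝ) (x : X)
    (df : EuclideanSpace ℝ (Fin n)) : Prop :=
  Tendsto (fun y => |f y - f x - ⟪df, φ y - φ x⟫| / dist y x)
    (𝓝[S \ {x}] x) (𝓝 0)

/-- The data `(U i, φ i)` (with dimensions `n i`) is a Lipschitz-differentiability chart
structure for the metric measure space `(S, d, m)`. -/
structure LDSCharts {X : Type*} [MetricSpace X] [MeasurableSpace X]
    (m : Measure X) (S : Set X) (n : ℕ → ℕ) (U : ℕ → Set X)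
    (φ : ∀ i, X → EuclideanSpace ℝ (Fin (n i))) : Prop where
  subset : ∀ i, U i ⊆ S
  borel : ∀ i, MeasurableSet (U i)
  pos : ∀ i, 0 < m (U i)
  dimpos : ∀ i, 0 < n i
  cover : m (S \ ⋃ i, U i) = 0
  lip : ∀ i, IsLipschitzOn (φ i) (U i)
  diff : ∀ f : X → ℝ, IsLipschitzOn f S → ∀ i,
    ∀ᵐ x ∂(m.restrict (U i)), ∃! df, HasChartDerivAt S (φ i) f x df

/-- `(S, d, m)` is a Lipschitz differentiability space. -/
def IsLDS {X : Type*} [MetricSpace X] [MeasurableSpace X]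
    (m : Measure X) (S : Set X) : Prop :=
  ∃ (n : ℕ → ℕ) (U : ℕ → Set X) (φ : ∀ i, X → EuclideanSpace ℝ (Fin (n i))),
    LDSCharts m S n U φ

/-- `(X, d, m)` is locally bi-Lipschitz embeddable into Euclidean spaces. -/
def LocEuclEmbeddable {X : Type*} [MetricSpace X] [MeasurableSpace X]
    (m : Measure X) : Prop :=
  ∃ (N : ℕ → ℕ) (E : ℕ → Set X) (F : ∀ k, X → EuclideanSpace ℝ (Fin (N k))),
    (∀ k, MeasurableSet (E k)) ∧ m (Set.univ \ ⋃ k, E k) = 0 ∧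
    ∀ k, BiLipschitzOn (F k) (E k)

/-- The closed cone of width `θ` around the linear subspace `V`:
the union of the cones `C(w, θ) = {v | v ⬝ w ≥ cos θ ‖v‖}` over unit vectors `w ∈ V`. -/
def cone {N : ℕ} (V : Submodule ℝ (EuclideanSpace ℝ (Fin N))) (θ : ℝ) :
    Set (EuclideanSpace ℝ (Fin N)) :=
  {v | ∃ w ∈ V, ‖w‖ = 1 ∧ Real.cos θ * ‖v‖ ≤ ⟪w, v⟫}

/-- The (topological) support of a measure: the set of points all of whose open
neighbourhoods have positive measure. -/
def msupport {X : Type*} [TopologicalSpace X] [MeasurableSpace X]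
    (μ : Measure X) : Set X :=
  {x | ∀ U : Set X, IsOpen U → x ∈ U → 0 < μ U}

set_option linter.unusedSectionVars false

namespace CR

/-! ### The Bellman type function -/

/-- The Bellman function. -/
def bW {X : Type*} [NormedAddCommGroup X] (C : ℝ) (x : X) (y : ℝ) : ℝ :=
  1 - (1 / (1 + y)) * (1 / (1 + ‖x‖ ^ 2) ^ 2) + C * (√(1 + ‖x‖ ^ 2) - 1)

lemma bregman_sqrt {r r' n s D : ℝ} (hr : 1 ≤ r) (hr' : 1 ≤ r') (hD : 0 ≤ D)
    (hq : r ^ 2 = 1 + n ^ 2) (hq' : r' ^ 2 = r ^ 2 + 2 * s + D ^ 2) (hs : |s| ≤ n * D)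
    (hrr : r' ≤ r + D) :
    (1 / r ^ 3) * D ^ 2 / 2 - D ^ 3 / 2 ≤ r' - r - s / r := by
  have hr0 : 0 < r := by linarith
  have hr0' : 0 < r' := by linarith
  have h1 : D ^ 2 / (2 * r ^ 2 * r') ≤ r' - r - s / r := by
    have e : r' - r - s / r = (r * r' - (r ^ 2 + s)) / r := by field_simp; ring
    rw [e, div_le_div_iff₀ (by positivity) hr0]
    have hs2 : s ^ 2 ≤ n ^ 2 * D ^ 2 := by
      have := sq_le_sq' (by linarith [abs_le.1 hs]) (abs_le.1 hs).2
      nlinarith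
    -- (r r')² - (r²+s)² ≥ D²
    have hw : D ^ 2 ≤ (r * r') ^ 2 - (r ^ 2 + s) ^ 2 := by
      rw [mul_pow, hq']; nlinarith
    have hle : r ^ 2 + s ≤ r * r' := by
      by_contra hcon
      push Not at hcon
      have : (r * r') ^ 2 < (r ^ 2 + s) ^ 2 := by
        apply pow_lt_pow_left₀ hcon (by positivity) (by norm_num)
      nlinarith [sq_nonneg D]
    have h2 : D ^ 2 ≤ (r * r' - (r ^ 2 + s)) * (2 * (r * r')) := by
      nlinarith
    nlinarith
  have h2 : (1 / r ^ 3) * D ^ 2 / 2 - D ^ 3 / 2 ≤ D ^ 2 / (2 * r ^ 2 * r') := by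
    have h3 : 1 / r ^ 3 - D ≤ 1 / (r ^ 2 * r') := by
      have h4 : 1 / r ^ 3 - 1 / (r ^ 2 * r') = (r' - r) / (r ^ 3 * r') := by field_simp
      have h5 : (r' - r) / (r ^ 3 * r') ≤ D := by
        rw [div_le_iff₀ (by positivity)]
        have : 1 ≤ r ^ 3 * r' := one_le_mul_of_one_le_of_one_le (one_le_pow₀ hr) hr'
        nlinarith
      linarith
    have := mul_le_mul_of_nonneg_left h3 (by positivity : 0 ≤ D ^ 2 / 2)
    calc _ = D ^ 2 / 2 * (1 / r ^ 3 - D) := by ring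
      _ ≤ _ := this
      _ = _ := by field_simp
  linarith

lemma chi_taylor {r r' n n' s D : ℝ} (hr : 1 ≤ r) (hr' : 1 ≤ r') (hD : 0 ≤ D)
    (hq : r ^ 2 = 1 + n ^ 2) (hq2 : r' ^ 2 = 1 + n' ^ 2)
    (hq' : r' ^ 2 = r ^ 2 + 2 * s + D ^ 2) (hdn : |n' - n| ≤ D)
    (hrr : r ≤ r' + D) :
    |1 / (r' ^ 2) ^ 2 - 1 / (r ^ 2) ^ 2 + 4 * s / (r ^ 2) ^ 3| ≤
      18 * (1 / r ^ 3) * D ^ 2 + 8 * D ^ 3 := by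
  have hr0 : 0 < r := by linarith
  have hr0' : 0 < r' := by linarith
  set q := r ^ 2 with hqdef
  set q' := r' ^ 2 with hqdef'
  have hq1 : 1 ≤ q := one_le_pow₀ hr
  have hq1' : 1 ≤ q' := one_le_pow₀ hr'
  have e : 1 / q' ^ 2 - 1 / q ^ 2 + 4 * s / q ^ 3 =
      -2 * D ^ 2 / q ^ 3 + (q' - q) ^ 2 * (2 * q' + q) / (q ^ 3 * q' ^ 2) := by
    have : s = (q' - q - D ^ 2) / 2 := by linarith
    rw [this]; field_simp; ring
  rw [e]
  have m3 : 1 / q ^ 3 ≤ 1 / r ^ 3 := by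
    apply one_div_le_one_div_of_le (by positivity)
    apply pow_le_pow_left₀ hr0.le
    rw [hqdef]; nlinarith
  have hqq : (q' - q) ^ 2 ≤ D ^ 2 * (2 * (q + q')) := by
    have h1 : q' - q = (n' - n) * (n' + n) := by rw [hq2, hq]; ring
    have h2 : (n' - n) ^ 2 ≤ D ^ 2 := by
      have := sq_le_sq' (by linarith [abs_le.1 hdn]) (abs_le.1 hdn).2
      exact this
    have h3 : (n' + n) ^ 2 ≤ 2 * (q + q') := by rw [hq2, hq]; nlinarith [sq_nonneg (n - n')]
    rw [h1, mul_pow]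
    exact mul_le_mul h2 h3 (by positivity) (by positivity)
  have h2 : (q' - q) ^ 2 * (2 * q' + q) / (q ^ 3 * q' ^ 2) ≤
      8 * D ^ 2 * (1 / (q * q' ^ 2) + 1 / q ^ 3) := by
    have e2 : 8 * D ^ 2 * (1 / (q * q' ^ 2) + 1 / q ^ 3) =
       (8 * D ^ 2 * (q ^ 2 + q' ^ 2)) / (q ^ 3 * q' ^ 2) := by field_simp
    rw [e2]
    apply div_le_div_of_nonneg_right _ (by positivity)
    have : (q' - q) ^ 2 * (2 * q' + q) ≤ D ^ 2 * (2 * (q + q')) * (2 * q' + q) :=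
      mul_le_mul_of_nonneg_right hqq (by positivity)
    have h5 : (2 * (q + q')) * (2 * q' + q) ≤ 8 * (q ^ 2 + q' ^ 2) := by
      nlinarith [sq_nonneg (q - q')]
    nlinarith [mul_le_mul_of_nonneg_left h5 (sq_nonneg D)]
  have h3 : 1 / (q * q' ^ 2) ≤ (1 + D) * (1 / r ^ 3) := by
    have : 1 / (q * q' ^ 2) ≤ 1 / (q * r') := by
      apply one_div_le_one_div_of_le (by positivity)
      apply mul_le_mul_of_nonneg_left _ (by positivity)
      rw [hqdef', ← pow_mul]
      exact le_self_pow₀ hr' (by norm_num)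
    refine this.trans ?_
    rw [hqdef, div_le_iff₀ (by positivity)]
    have e3 : (1 + D) * (1 / r ^ 3) * (r ^ 2 * r') = (1 + D) * r' / r := by field_simp
    rw [e3, le_div_iff₀ hr0]
    nlinarith
  have m1 : 1 / r ^ 3 ≤ 1 := by
    rw [div_le_one (by positivity)]; exact one_le_pow₀ hr
  have mp : 0 ≤ 1 / r ^ 3 := by positivity
  have hD3 : 1 / r ^ 3 * D ^ 3 ≤ D ^ 3 := by
    have : 0 ≤ D ^ 3 := by positivity
    nlinarith
  have hp : 0 ≤ (q' - q) ^ 2 * (2 * q' + q) / (q ^ 3 * q' ^ 2) := by positivity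
  have h4 : 2 * D ^ 2 / q ^ 3 ≤ 2 * (1 / r ^ 3) * D ^ 2 := by
    have := mul_le_mul_of_nonneg_left m3 (by positivity : 0 ≤ 2 * D ^ 2)
    calc _ = 2 * D ^ 2 * (1 / q ^ 3) := by ring
      _ ≤ _ := this
      _ = _ := by ring
  have h4p : 0 ≤ 2 * D ^ 2 / q ^ 3 := by positivity
  have h6 : 8 * D ^ 2 * (1 / (q * q' ^ 2) + 1 / q ^ 3) ≤
      16 * (1 / r ^ 3) * D ^ 2 + 8 * D ^ 3 := by
    have := mul_le_mul_of_nonneg_left (add_le_add h3 m3) (by positivity : 0 ≤ 8 * D ^ 2)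
    calc _ ≤ _ := this
      _ = 16 * (1 / r ^ 3) * D ^ 2 + 8 * (1 / r ^ 3 * D ^ 3) := by ring
      _ ≤ _ := by linarith
  have e5 : -2 * D ^ 2 / q ^ 3 = - (2 * D ^ 2 / q ^ 3) := by ring
  have hmD : 0 ≤ (1 / r ^ 3) * D ^ 2 := by positivity
  have hDD : 0 ≤ D ^ 3 := by positivity
  rw [e5, abs_le]
  constructor <;> linarith

set_option maxHeartbeats 1000000 in
/-- Key inequality for the Bellman function. -/
lemma bW_taylor {X : Type*} [NormedAddCommGroup X] [InnerProductSpace ℝ X] (K : ℝ) (hK : 0 ≤ K)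
    (x : X) (y : ℝ) (hy : 0 ≤ y) : ∃ (α β m : ℝ), 0 ≤ m ∧ m ≤ 1 ∧
    ∀ (x' : X) (y' : ℝ), 0 ≤ y' →
      bW (4 * K + 38) x y + (α * ⟪x, x' - x⟫ + β * (y' - y))
        + 2 * m * (K * ‖x' - x‖ ^ 2 - (y' - y) ^ 2) - (27 + 2 * K) * ‖x' - x‖ ^ 3
      ≤ bW (4 * K + 38) x' y' := by
  set r := √(1 + ‖x‖ ^ 2) with hrd
  have hq : r ^ 2 = 1 + ‖x‖ ^ 2 := Real.sq_sqrt (by positivity)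
  have hr : 1 ≤ r := by rw [hrd]; apply Real.one_le_sqrt.2; linarith [sq_nonneg ‖x‖]
  have hr0 : 0 < r := by linarith
  refine ⟨(4 * K + 38) / r + 4 * (1 / (1 + y)) / (r ^ 2) ^ 3,
    (1 / (1 + y)) ^ 2 * (1 / (r ^ 2) ^ 2), 1 / r ^ 3, by positivity, ?_, ?_⟩
  · rw [div_le_one (by positivity)]; exact one_le_pow₀ hr
  intro x' y' hy'
  set r' := √(1 + ‖x'‖ ^ 2) with hrd'
  have hq2 : r' ^ 2 = 1 + ‖x'‖ ^ 2 := Real.sq_sqrt (by positivity)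
  have hr' : 1 ≤ r' := by rw [hrd']; apply Real.one_le_sqrt.2; linarith [sq_nonneg ‖x'‖]
  have hr0' : 0 < r' := by linarith
  set D := ‖x' - x‖ with hDd
  have hD : 0 ≤ D := norm_nonneg _
  set s := ⟪x, x' - x⟫ with hsd
  have hs : |s| ≤ ‖x‖ * D := abs_real_inner_le_norm _ _
  have hn2 : ‖x'‖ ^ 2 = ‖x‖ ^ 2 + 2 * s + D ^ 2 := by
    have := norm_add_sq_real x (x' - x)
    rwa [add_sub_cancel] at this
  have hq' : r' ^ 2 = r ^ 2 + 2 * s + D ^ 2 := by rw [hq2, hq, hn2]; ring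
  have hdn : |‖x'‖ - ‖x‖| ≤ D := abs_norm_sub_norm_le _ _
  have hlip : ∀ a b : ℝ, 0 ≤ a → 0 ≤ b → 0 ≤ D → |a - b| ≤ D → ∀ ra rb : ℝ, 1 ≤ ra → 1 ≤ rb →
      ra ^ 2 = 1 + a ^ 2 → rb ^ 2 = 1 + b ^ 2 → ra ≤ rb + D := by
    intro a b ha hb hD hab ra rb h1 h2 h3 h4
    have hab' := (abs_le.1 hab).2
    have hbr : b ≤ rb := by nlinarith
    by_contra hc
    push Not at hc
    nlinarith
  have hrr : r' ≤ r + D := hlip _ _ (norm_nonneg _) (norm_nonneg _) hD hdn _ _ hr' hr hq2 hq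
  have hrr' : r ≤ r' + D := hlip _ _ (norm_nonneg _) (norm_nonneg _) hD
    (by rw [abs_sub_comm]; exact hdn) _ _ hr hr' hq hq2
  have B := bregman_sqrt hr hr' hD hq hq' hs hrr
  have R1 := chi_taylor hr hr' hD hq hq2 hq' hdn hrr'
  have hW : bW (4 * K + 38) x y = 1 - (1 / (1 + y)) * (1 / (r ^ 2) ^ 2) + (4 * K + 38) * (r - 1) := by
    rw [bW, hq]
  have hW' : bW (4 * K + 38) x' y' =
      1 - (1 / (1 + y')) * (1 / (r' ^ 2) ^ 2) + (4 * K + 38) * (r' - 1) := by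
    rw [bW, hq2]
  rw [hW, hW']
  set ψ := 1 / (1 + y) with hψ
  set ψ' := 1 / (1 + y') with hψ'
  set χ := 1 / (r ^ 2) ^ 2 with hχ
  set χ' := 1 / (r' ^ 2) ^ 2 with hχ'
  set δ := y' - y with hδ
  set m := 1 / r ^ 3 with hm
  have hψ0 : 0 ≤ ψ := by positivity
  have hψ0' : 0 ≤ ψ' := by positivity
  have hψ1 : ψ ≤ 1 := by rw [hψ, div_le_one (by positivity)]; linarith
  have hψ1' : ψ' ≤ 1 := by rw [hψ', div_le_one (by positivity)]; linarith
  have hm0 : 0 ≤ m := by positivity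
  have hχ0 : 0 ≤ χ := by positivity
  have hχm : χ ≤ m := by
    rw [hχ, hm]; apply one_div_le_one_div_of_le (by positivity)
    rw [← pow_mul]; exact pow_le_pow_right₀ hr (by norm_num)
  -- decomposition
  set ℓ := - (4 * s / (r ^ 2) ^ 3) with hℓ
  set R := χ' - χ + 4 * s / (r ^ 2) ^ 3 with hR
  have d1 : ψ' - ψ = - δ * (ψ * ψ') := by
    rw [hψ, hψ', hδ]; field_simp; ring
  have d2 : ψ' - ψ + ψ ^ 2 * δ = δ ^ 2 * (ψ ^ 2 * ψ') := by
    rw [hψ, hψ', hδ]; field_simp; ring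
  have hdec : ψ' * χ' - ψ * χ - (ψ * ℓ - χ * ψ ^ 2 * δ) =
      ψ' * R + (ψ' - ψ + ψ ^ 2 * δ) * χ + (ψ' - ψ) * ℓ := by
    rw [hR, hℓ]; ring
  have t1 : ψ' * R ≤ 18 * m * D ^ 2 + 8 * D ^ 3 := by
    calc ψ' * R ≤ ψ' * |R| := by gcongr; exact le_abs_self _
      _ ≤ 1 * |R| := by gcongr
      _ ≤ _ := by rw [one_mul]; exact R1
  have t2 : (ψ' - ψ + ψ ^ 2 * δ) * χ ≤ m * δ ^ 2 := by
    rw [d2]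
    have : ψ ^ 2 * ψ' ≤ 1 := by
      exact mul_le_one₀ (pow_le_one₀ (n := 2) hψ0 hψ1) hψ0' hψ1'
    have h3 : ψ ^ 2 * ψ' * χ ≤ 1 * m := mul_le_mul this hχm hχ0 (by norm_num)
    calc _ = (ψ ^ 2 * ψ' * χ) * δ ^ 2 := by ring
      _ ≤ (1 * m) * δ ^ 2 := mul_le_mul_of_nonneg_right h3 (sq_nonneg δ)
      _ = _ := by ring
  have hℓb : |ℓ| ≤ 2 * m * D := by
    have h1 : |ℓ| = 4 * |s| / (r ^ 2) ^ 3 := by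
      rw [hℓ, abs_neg, abs_div, abs_mul, abs_of_pos (by norm_num : (0:ℝ) < 4),
        abs_of_pos (by positivity : 0 < (r ^ 2) ^ 3)]
    rw [h1]
    have hxr : 2 * ‖x‖ ≤ r ^ 2 := by rw [hq]; have := two_mul_le_add_sq ‖x‖ 1; linarith
    have h2 : 4 * |s| ≤ 2 * r ^ 2 * D := by
      have := mul_le_mul_of_nonneg_right hxr hD
      linarith
    calc 4 * |s| / (r ^ 2) ^ 3 ≤ 2 * r ^ 2 * D / (r ^ 2) ^ 3 := by gcongr
      _ = 2 * χ * D := by rw [hχ]; field_simp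
      _ ≤ _ := by gcongr
  have t3 : (ψ' - ψ) * ℓ ≤ m * (δ ^ 2 + D ^ 2) := by
    have h1 : |ψ' - ψ| ≤ |δ| := by
      rw [d1, abs_mul, abs_neg, abs_of_nonneg (mul_nonneg hψ0 hψ0')]
      have : ψ * ψ' ≤ 1 := mul_le_one₀ hψ1 hψ0' hψ1'
      exact mul_le_of_le_one_right (abs_nonneg δ) this
    calc (ψ' - ψ) * ℓ ≤ |ψ' - ψ| * |ℓ| := by rw [← abs_mul]; exact le_abs_self _
      _ ≤ |δ| * (2 * m * D) := by gcongr
      _ ≤ _ := by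
        have : 2 * |δ| * D ≤ δ ^ 2 + D ^ 2 := by
          rw [← sq_abs δ]; exact two_mul_le_add_sq _ _
        calc _ = m * (2 * |δ| * D) := by ring
          _ ≤ _ := mul_le_mul_of_nonneg_left this hm0
  have hB := mul_le_mul_of_nonneg_left B (by positivity : 0 ≤ 4 * K + 38)
  have e1 : ((4 * K + 38) / r + 4 * ψ / (r ^ 2) ^ 3) * s = (4 * K + 38) * (s / r) - ψ * ℓ := by
    rw [hℓ]; ring
  rw [e1]
  have hB2 : 2 * K * (m * D ^ 2) + 19 * (m * D ^ 2) - (2 * K + 19) * D ^ 3 ≤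
      (4 * K + 38) * (r' - r - s / r) := by
    refine le_trans (le_of_eq ?_) hB
    ring
  have e2 : 2 * m * (K * D ^ 2 - δ ^ 2) = 2 * K * (m * D ^ 2) - 2 * (m * δ ^ 2) := by ring
  rw [e2]
  have e3 : ψ ^ 2 * χ * δ = χ * ψ ^ 2 * δ := by ring
  rw [e3]
  linarith

end CR

namespace CR

/-! ### A Lipschitz function which is nowhere differentiable on a compact set -/

section nondiff
variable {E : Type*} [NormedAddCommGroup E] [NormedSpace ℝ E] [FiniteDimensional ℝ E]

lemma exists_scale {K : Set E} (hK : IsCompact K) {s : E → ℝ} (hs : ContDiff ℝ 1 s) (e : E)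
    (he : ‖e‖ = 1) {η b : ℝ} (hη : 0 < η) (hb : 0 < b) :
    ∃ r, 0 < r ∧ r ≤ b ∧ ∀ x ∈ K, |s (x + r • e) - s x - r * fderiv ℝ s x e| ≤ η * r := by
  have hc : Continuous (fderiv ℝ s) := hs.continuous_fderiv (by norm_num)
  have h1 := hK.uniformContinuousAt_of_continuousAt (fderiv ℝ s)
    (fun a _ => hc.continuousAt) (Metric.dist_mem_uniformity hη)
  obtain ⟨ε, hε, h2⟩ := Metric.mem_uniformity_dist.1 h1
  refine ⟨min b (ε / 2), by positivity, min_le_left _ _, fun x hx => ?_⟩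
  set r := min b (ε / 2) with hr
  have hr0 : 0 < r := by positivity
  have hrε : r < ε := (min_le_right _ _).trans_lt (by linarith)
  have h3 := (convex_ball x ε).norm_image_sub_le_of_norm_fderiv_le' (f := s) (φ := fderiv ℝ s x)
    (C := η) (x := x) (y := x + r • e) (𝕜 := ℝ)
    (fun y _ => (hs.differentiable (by norm_num)).differentiableAt)
    (fun y hy => by
      have := h2 (a := x) (b := y) (by rw [dist_comm]; exact hy) hx
      rw [← dist_eq_norm, dist_comm]; exact this.le)
    (mem_ball_self hε) (by
      rw [mem_ball, dist_eq_norm, add_sub_cancel_left, norm_smul, he, mul_one,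
        Real.norm_of_nonneg hr0.le]; exact hrε)
  rw [add_sub_cancel_left, norm_smul, he, mul_one, Real.norm_of_nonneg hr0.le, map_smul,
    smul_eq_mul, Real.norm_eq_abs] at h3
  exact h3

lemma nd_step {K : Set E} (hK : IsCompact K) {R : ℝ} (hKR : K ⊆ ball 0 R)
    {g : ℕ → E → ℝ} (hg : ∀ n, ContDiff ℝ 1 (g n)) (hg1 : ∀ n x, ‖fderiv ℝ (g n) x‖ ≤ 1)
    (hg0 : ∀ ε > 0, ∀ᶠ n in atTop, ∀ x ∈ ball (0:E) R, |g n x| ≤ ε)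
    {G : E → E →L[ℝ] ℝ} (hG : TendstoUniformlyOn (fun n => fderiv ℝ (g n)) G atTop K)
    {η : ℝ} (hη : 0 < η) (hη2 : η ≤ 1 / 2) {s : E → ℝ} (hs : ContDiff ℝ 1 s)
    (hs3 : ∀ x, ‖fderiv ℝ s x‖ ≤ 3) {T : E → E →L[ℝ] ℝ} (hT : ∀ x ∈ K, ‖T x‖ ≤ 1)
    {t : ℝ} (ht : t < η) (hst : ∀ x ∈ K, ‖fderiv ℝ s x - T x‖ ≤ t) {σ : ℝ} (hσ : |σ| = 1)
    {δ : ℝ} (hδ : 0 < δ) :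
    ∃ s' : E → ℝ, ContDiff ℝ 1 s' ∧ (∀ x, ‖fderiv ℝ s' x‖ ≤ 3) ∧
      (∃ t' < η, ∀ x ∈ K, ‖fderiv ℝ s' x - (T x + σ • G x)‖ ≤ t') ∧
      ∀ x, |s' x - s x| ≤ δ := by
  have hc : Continuous (fderiv ℝ s) := hs.continuous_fderiv (by norm_num)
  set O : Set E := {x | ‖fderiv ℝ s x‖ < 1 + η} ∩ ball 0 R with hO
  have hOo : IsOpen O := (isOpen_lt hc.norm continuous_const).inter isOpen_ball
  have hKO : K ⊆ O := fun x hx => ⟨by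
    have h1 := norm_le_norm_sub_add (fderiv ℝ s x) (T x)
    have h2 := hT x hx
    have h3 := hst x hx
    show ‖fderiv ℝ s x‖ < 1 + η; linarith, hKR hx⟩
  obtain ⟨χ, hχ1, hχ0, hχ⟩ := exists_contMDiffMap_one_nhds_of_subset_interior (n := 1)
    (modelWithCornersSelf ℝ E) hK.isClosed (hOo.interior_eq.symm ▸ hKO)
  have hχs : ContDiff ℝ 1 (χ : E → ℝ) := χ.contMDiff.contDiff
  have hχc : Continuous (fderiv ℝ (χ : E → ℝ)) := hχs.continuous_fderiv (by norm_num)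
  obtain ⟨M, hM⟩ := (isCompact_closedBall (0:E) R).exists_bound_of_continuousOn hχc.continuousOn
  have hM0 : 0 < |M| + 1 := by positivity
  obtain ⟨n, hn1, hn2⟩ := ((hg0 (min δ (η / (|M| + 1))) (by positivity)).and
    (Metric.tendstoUniformlyOn_iff.1 hG ((η - t) / 2) (by linarith))).exists
  have hgs := hg n
  have hχd : Differentiable ℝ (χ : E → ℝ) := hχs.differentiable (by norm_num)
  have hgd : Differentiable ℝ (g n) := hgs.differentiable (by norm_num)
  have hsd : Differentiable ℝ s := hs.differentiable (by norm_num)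
  have hder : ∀ x, HasFDerivAt (fun x => s x + σ * (χ x * g n x))
      (fderiv ℝ s x + σ • (χ x • fderiv ℝ (g n) x + g n x • fderiv ℝ χ x)) x := fun x =>
    (hsd x).hasFDerivAt.add (((hχd x).hasFDerivAt.mul (hgd x).hasFDerivAt).const_mul σ)
  have hsm : ContDiff ℝ 1 (fun x => s x + σ * (χ x * g n x)) :=
    hs.add (contDiff_const.mul (hχs.mul hgs))
  have hχabs : ∀ x, |χ x| ≤ 1 := fun x => by
    rw [abs_of_nonneg (hχ x).1]; exact (hχ x).2
  refine ⟨fun x => s x + σ * (χ x * g n x), hsm, fun x => ?_, ⟨(t + η) / 2, by linarith, fun x hx => ?_⟩,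
    fun x => ?_⟩
  · -- gradient bound
    by_cases hx : x ∈ O
    · rw [(hder x).fderiv]
      have h1 : ‖χ x • fderiv ℝ (g n) x‖ ≤ 1 := by
        rw [norm_smul, Real.norm_eq_abs]
        exact mul_le_one₀ (hχabs x) (norm_nonneg _) (hg1 n x)
      have h2 : ‖g n x • fderiv ℝ χ x‖ ≤ η := by
        rw [norm_smul, Real.norm_eq_abs]
        calc |g n x| * ‖fderiv ℝ χ x‖ ≤ (η / (|M| + 1)) * (|M| + 1) := by
              refine mul_le_mul ((hn1 x hx.2).trans (min_le_right _ _)) ?_ (norm_nonneg _)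
                (by positivity)
              have := hM x (ball_subset_closedBall hx.2)
              linarith [le_abs_self M]
          _ = η := by field_simp
      have h3 : ‖fderiv ℝ s x‖ < 1 + η := hx.1
      calc _ ≤ ‖fderiv ℝ s x‖ + ‖σ • (χ x • fderiv ℝ (g n) x + g n x • fderiv ℝ χ x)‖ := norm_add_le _ _
        _ ≤ ‖fderiv ℝ s x‖ + (‖χ x • fderiv ℝ (g n) x‖ + ‖g n x • fderiv ℝ χ x‖) := by
            rw [norm_smul, Real.norm_eq_abs, hσ, one_mul]
            gcongr; exact norm_add_le _ _
        _ ≤ 3 := by linarith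
    · rw [(hder x).fderiv]
      have h0 : χ x = 0 := hχ0 x hx
      have hmin : IsLocalMin (χ : E → ℝ) x := Filter.Eventually.of_forall fun y => by
        rw [h0]; exact (hχ y).1
      rw [h0, hmin.fderiv_eq_zero]
      simpa using hs3 x
  · rw [(hder x).fderiv]
    have hx1 : ∀ᶠ y in 𝓝 x, χ y = 1 := hχ1.filter_mono (nhds_le_nhdsSet hx)
    have h1 : χ x = 1 := hx1.self_of_nhds
    have h2 : fderiv ℝ (χ : E → ℝ) x = 0 := by
      rw [Filter.EventuallyEq.fderiv_eq (f := fun _ => (1:ℝ)) hx1]; simp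
    rw [h1, h2]
    have h3 := hn2 x hx
    rw [dist_eq_norm] at h3
    have h4 : fderiv ℝ s x + σ • ((1:ℝ) • fderiv ℝ (g n) x + g n x • (0 : E →L[ℝ] ℝ)) - (T x + σ • G x)
        = (fderiv ℝ s x - T x) - σ • (G x - fderiv ℝ (g n) x) := by
      rw [smul_zero, add_zero, one_smul, smul_sub]; abel
    rw [h4]
    calc _ ≤ ‖fderiv ℝ s x - T x‖ + ‖σ • (G x - fderiv ℝ (g n) x)‖ := norm_sub_le _ _
      _ ≤ t + (η - t) / 2 := by
          rw [norm_smul, Real.norm_eq_abs, hσ, one_mul]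
          exact add_le_add (hst x hx) h3.le
      _ = (t + η) / 2 := by ring
  · simp only [add_sub_cancel_left]
    rw [abs_mul, hσ, one_mul]
    by_cases hx : x ∈ O
    · rw [abs_mul]
      calc |χ x| * |g n x| ≤ 1 * |g n x| := by gcongr; exact hχabs x
        _ ≤ δ := by rw [one_mul]; exact (hn1 x hx.2).trans (min_le_left _ _)
    · rw [hχ0 x hx]; simpa using hδ.le

/-- target of the `k`-th step -/
def tgt (G : E → E →L[ℝ] ℝ) (k : ℕ) (x : E) : E →L[ℝ] ℝ := if Even k then 0 else G x

lemma nondiff {K : Set E} (hK : IsCompact K) {R : ℝ} (hKR : K ⊆ ball 0 R)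
    {g : ℕ → E → ℝ} (hg : ∀ n, ContDiff ℝ 1 (g n)) (hg1 : ∀ n x, ‖fderiv ℝ (g n) x‖ ≤ 1)
    (hg0 : ∀ ε > 0, ∀ᶠ n in atTop, ∀ x ∈ ball (0:E) R, |g n x| ≤ ε)
    {G : E → E →L[ℝ] ℝ} (hG : TendstoUniformlyOn (fun n => fderiv ℝ (g n)) G atTop K)
    {e : E} (he : ‖e‖ = 1) {c : ℝ} (hc : 0 < c) (hGc : ∀ x ∈ K, c ≤ G x e) :
    ∃ f : E → ℝ, LipschitzWith 3 f ∧ ∀ x ∈ K, ¬ DifferentiableAt ℝ f x := by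
  have hG1 : ∀ x ∈ K, ‖G x‖ ≤ 1 := fun x hx =>
    le_of_tendsto (hG.tendsto_at hx).norm (Eventually.of_forall fun n => hg1 n x)
  obtain ⟨η, hη, hη2, hηc⟩ : ∃ η : ℝ, 0 < η ∧ η ≤ 1 / 2 ∧ 10 * η < c :=
    ⟨min (1/2) (c / 11), by positivity, min_le_left _ _, by
      have := min_le_right (1/2) (c/11); linarith⟩
  let Inv : ℕ → (E → ℝ) × ℝ → Prop := fun k p => ContDiff ℝ 1 p.1 ∧ (∀ x, ‖fderiv ℝ p.1 x‖ ≤ 3) ∧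
    (∃ t < η, ∀ x ∈ K, ‖fderiv ℝ p.1 x - tgt G k x‖ ≤ t) ∧ 0 < p.2 ∧
    ∃ r, 0 < r ∧ r ≤ 1 / ((k:ℝ) + 1) ∧ p.2 ≤ η * r ∧
      ∀ x ∈ K, |p.1 (x + r • e) - p.1 x - r * fderiv ℝ p.1 x e| ≤ η * r
  have hstep : ∀ k p, Inv k p → ∃ p', Inv (k+1) p' ∧ (∀ x, |p'.1 x - p.1 x| ≤ p.2 / 2) ∧
      p'.2 ≤ p.2 / 2 := by
    rintro k ⟨s, ρ⟩ ⟨h1, h2, ⟨t, ht, h3⟩, hρ, -⟩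
    obtain ⟨s', a1, a2, ⟨t', ht', a3⟩, a4⟩ := nd_step hK hKR hg hg1 hg0 hG hη hη2 h1 h2
      (T := tgt G k) (fun x hx => by
        unfold tgt; split_ifs
        · simp
        · exact hG1 x hx) ht h3 (σ := if Even k then 1 else -1) (by split_ifs <;> simp)
      (δ := ρ / 2) (by simpa using hρ)
    obtain ⟨r, hr0, hr1, hr2⟩ := exists_scale hK a1 e he hη (b := 1 / (((k+1:ℕ):ℝ) + 1)) (by positivity)
    refine ⟨(s', min (ρ/2) (η * r)), ⟨a1, a2, ⟨t', ht', fun x hx => ?_⟩, ?_, r, hr0, hr1, min_le_right _ _, hr2⟩,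
      a4, min_le_left _ _⟩
    · convert a3 x hx using 3
      unfold tgt
      by_cases hk : Even k
      · simp [hk, Nat.even_add_one]
      · simp only [hk, Nat.even_add_one, not_false_eq_true, if_true, if_false]
        ext v
        simp
    · have : 0 < ρ := hρ
      positivity
  have hstart : ∃ p, Inv 0 p := by
    obtain ⟨r, hr0, hr1, hr2⟩ := exists_scale hK (s := fun _ => (0:ℝ)) contDiff_const e he hη
      (b := 1 / (((0:ℕ):ℝ) + 1)) (by positivity)
    exact ⟨(fun _ => 0, η * r), contDiff_const, fun x => by simp, ⟨0, hη, fun x _ => by simp [tgt]⟩,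
      by positivity, r, hr0, hr1, le_rfl, hr2⟩
  choose p0 hp0 using hstart
  choose! nx hnx1 hnx2 hnx3 using hstep
  let P : ℕ → (E → ℝ) × ℝ := fun k => Nat.rec p0 (fun k p => nx k p) k
  have hP0 : P 0 = p0 := rfl
  have hPs : ∀ k, P (k+1) = nx k (P k) := fun k => rfl
  have hInv : ∀ k, Inv k (P k) := by
    intro k
    induction k with
    | zero => exact hp0
    | succ k ih => rw [hPs]; exact hnx1 k _ ih
  have hd : ∀ k x, |(P (k+1)).1 x - (P k).1 x| ≤ (P k).2 / 2 := fun k x => by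
    rw [hPs]; exact hnx2 k _ (hInv k) x
  have hρ : ∀ k, (P (k+1)).2 ≤ (P k).2 / 2 := fun k => by
    rw [hPs]; exact hnx3 k _ (hInv k)
  have hρj : ∀ k j, (P (k+j)).2 ≤ (P k).2 / 2 / 2 ^ j * 2 := by
    intro k j
    induction j with
    | zero => simp
    | succ j ih => 
      have := hρ (k+j)
      rw [← add_assoc]
      rw [pow_succ]
      calc _ ≤ (P (k+j)).2 / 2 := this
        _ ≤ ((P k).2 / 2 / 2 ^ j * 2) / 2 := by gcongr
        _ = _ := by field_simp
  have hbd : ∀ k j x, dist ((P (k+j)).1 x) ((P (k+(j+1))).1 x) ≤ (P k).2 / 2 / 2 ^ j := by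
    intro k j x
    rw [dist_comm, Real.dist_eq]
    have h1 := hd (k+j) x
    have h2 := hρj k j
    rw [← add_assoc]
    linarith
  have hlim : ∀ x, ∃ l, Tendsto (fun k => (P k).1 x) atTop (𝓝 l) := fun x => by
    have h1 := cauchySeq_of_le_geometric_two (C := (P 0).2) (f := fun k => (P k).1 x) (fun n => by
      have := hbd 0 n x; simpa using this)
    exact cauchySeq_tendsto_of_complete h1
  choose f hf using hlim
  have hfk : ∀ k x, |f x - (P k).1 x| ≤ (P k).2 := by
    intro k x
    have h1 := dist_le_of_le_geometric_two_of_tendsto₀ (C := (P k).2) (f := fun j => (P (k+j)).1 x) (a := f x)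
      (fun n => hbd k n x)
      ((hf x).comp (tendsto_atTop_mono (fun n => Nat.le_add_left n k) tendsto_id))
    rw [dist_comm, Real.dist_eq] at h1
    simpa using h1
  have hlip : LipschitzWith 3 f := by
    refine LipschitzWith.of_dist_le_mul fun x y => ?_
    refine le_of_tendsto ((hf x).dist (hf y)) (Eventually.of_forall fun k => ?_)
    have h1 : LipschitzWith 3 (P k).1 := lipschitzWith_of_nnnorm_fderiv_le (𝕜 := ℝ)
      ((hInv k).1.differentiable (by norm_num)) (fun x => by
        have := (hInv k).2.1 x
        rw [← NNReal.coe_le_coe]; simpa using this)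
    exact h1.dist_le_mul x y
  refine ⟨f, hlip, fun x hx hdiff => ?_⟩
  set D := fderiv ℝ f x e with hD
  have hrs : ∀ k : ℕ, ∃ r : ℝ, 0 < r ∧ r ≤ 1 / ((k:ℝ) + 1) ∧ |f (x + r • e) - f x - r * tgt G k x e| ≤ 4 * η * r := by
    intro k
    obtain ⟨h1, h2, ⟨t, ht, h3⟩, h4, r, hr0, hr1, hr2, hr3⟩ := hInv k
    refine ⟨r, hr0, hr1, ?_⟩
    have a1 := abs_le.1 ((hfk k (x + r • e)).trans hr2)
    have a2 := abs_le.1 ((hfk k x).trans hr2)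
    have a3 := abs_le.1 (hr3 x hx)
    have a4 : |fderiv ℝ (P k).1 x e - tgt G k x e| ≤ η := by
      have := (fderiv ℝ (P k).1 x - tgt G k x).le_opNorm e
      rw [he, mul_one] at this
      exact this.trans ((h3 x hx).trans ht.le)
    have a5 : |r * fderiv ℝ (P k).1 x e - r * tgt G k x e| ≤ η * r := by
      rw [← mul_sub, abs_mul, abs_of_pos hr0, mul_comm]; gcongr
    have a5 := abs_le.1 a5
    rw [abs_le]; constructor <;> linarith
  choose r hr0 hr1 hr2 using hrs
  have hrlim : Tendsto r atTop (𝓝 0) := squeeze_zero (fun k => (hr0 k).le) hr1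
    tendsto_one_div_add_atTop_nhds_zero_nat
  have hder : HasDerivAt (fun t : ℝ => f (x + t • e)) D 0 := by
    have h1 : HasDerivAt (fun t : ℝ => x + t • e) e 0 := by
      simpa using ((hasDerivAt_id (0:ℝ)).smul_const e).const_add x
    have h2 : HasFDerivAt f (fderiv ℝ f x) (x + (0:ℝ) • e) := by
      simpa using hdiff.hasFDerivAt
    exact h2.comp_hasDerivAt 0 h1
  have hsl := hder.tendsto_slope_zero.comp (tendsto_nhdsWithin_iff.2 ⟨hrlim,
    Eventually.of_forall fun k => (hr0 k).ne'⟩)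
  have hev := (Metric.tendsto_atTop.1 hsl) η hη
  obtain ⟨N, hN⟩ := hev
  have key : ∀ k ≥ N, |D - tgt G k x e| ≤ 5 * η := by
    intro k hk
    have h1 := hN k hk
    simp only [Function.comp, zero_add, zero_smul, add_zero, smul_eq_mul, Real.dist_eq] at h1
    have h2 : |(r k)⁻¹ * (f (x + r k • e) - f x) - tgt G k x e| ≤ 4 * η := by
      have h3 := hr2 k
      have h4 : (r k)⁻¹ * (f (x + r k • e) - f x) - tgt G k x e
        = (r k)⁻¹ * (f (x + r k • e) - f x - r k * tgt G k x e) := by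
          have := (hr0 k).ne'
          field_simp
      rw [h4, abs_mul, abs_of_pos (inv_pos.2 (hr0 k)), inv_mul_le_iff₀ (hr0 k)]
      linarith
    have h5 := abs_lt.1 h1
    have h6 := abs_le.1 h2
    rw [abs_le]; constructor <;> linarith
  have k1 := abs_le.1 (key (2 * N) (by omega))
  have k2 := abs_le.1 (key (2 * N + 1) (by omega))
  have e1 : tgt G (2*N) x e = 0 := by simp [tgt]
  have e2 : tgt G (2*N+1) x e = G x e := by simp [tgt, Nat.even_add_one]
  rw [e1] at k1
  rw [e2] at k2
  have := hGc x hx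
  linarith

end nondiff
end CR

namespace CR

/-! ### Lemma A -/

lemma hilbert_nested {H : Type*} [NormedAddCommGroup H] [InnerProductSpace ℝ H] [CompleteSpace H]
    (Z : ℕ → Set H) (hconv : ∀ n, Convex ℝ (Z n)) (hanti : Antitone Z) (hne : ∀ n, (Z n).Nonempty)
    (M : ℝ) (hM : ∀ n, ∀ z ∈ Z n, ‖z‖ ≤ M) :
    ∃ z : ℕ → H, (∀ n, z n ∈ Z n) ∧ ∃ v, Tendsto z atTop (𝓝 v) := by
  let i : ℕ → ℝ := fun n => sInf (norm '' Z n)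
  have hbdd : ∀ n, BddBelow (norm '' Z n) := fun n => ⟨0, by rintro _ ⟨z, _, rfl⟩; exact norm_nonneg _⟩
  have hile : ∀ n, ∀ z ∈ Z n, i n ≤ ‖z‖ := fun n z hz => csInf_le (hbdd n) ⟨z, hz, rfl⟩
  have hi0 : ∀ n, 0 ≤ i n := fun n => Real.sInf_nonneg (by rintro _ ⟨z, _, rfl⟩; exact norm_nonneg _)
  have himono : Monotone i := fun m n hmn =>
    csInf_le_csInf (hbdd m) ((hne n).image _) (image_mono (hanti hmn))
  have hiM : ∀ n, i n ≤ M := fun n => by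
    obtain ⟨z, hz⟩ := hne n
    exact (hile n z hz).trans (hM n z hz)
  have hlim := tendsto_atTop_ciSup himono ⟨M, by rintro _ ⟨n, rfl⟩; exact hiM n⟩
  set I := ⨆ n, i n with hI
  have hiI : ∀ n, i n ≤ I := fun n => le_ciSup ⟨M, by rintro _ ⟨n, rfl⟩; exact hiM n⟩ n
  have hex : ∀ n, ∃ z ∈ Z n, ‖z‖ < i n + 1 / ((n:ℝ) + 1) := fun n => by
    obtain ⟨_, ⟨z, hz, rfl⟩, h⟩ := exists_lt_of_csInf_lt ((hne n).image norm)
      (show sInf (norm '' Z n) < i n + 1 / ((n:ℝ) + 1) from lt_add_of_pos_right _ (by positivity))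
    exact ⟨z, hz, h⟩
  choose z hz hzn using hex
  refine ⟨z, hz, cauchySeq_tendsto_of_complete ?_⟩
  let b : ℕ → ℝ := fun n => √(4 * (I + 1 / ((n:ℝ) + 1)) ^ 2 - 4 * (i n) ^ 2)
  refine cauchySeq_of_le_tendsto_0 (b := b) ?_ ?_
  · have hb : ∀ N n : ℕ, N ≤ n → ‖z n‖ ≤ I + 1 / ((N:ℝ) + 1) := fun N n h => by
      have h1 := (hzn n).le
      have h2 : 1 / ((n:ℝ) + 1) ≤ 1 / ((N:ℝ) + 1) := by gcongr
      linarith [hiI n]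
    intro n m N hn hm
    rw [dist_eq_norm]
    refine Real.le_sqrt_of_sq_le ?_
    have h1 : (2⁻¹ : ℝ) • (z n) + (2⁻¹ : ℝ) • z m ∈ Z N :=
      hconv N (hanti hn (hz n)) (hanti hm (hz m)) (by norm_num) (by norm_num) (by norm_num)
    have h2 := hile N _ h1
    rw [← smul_add, norm_smul, Real.norm_of_nonneg (by norm_num)] at h2
    have h3 := parallelogram_law_with_norm ℝ (z n) (z m)
    have h4 := hb N n hn
    have h5 := hb N m hm
    have h6 : (i N) ^ 2 ≤ (2⁻¹ * ‖z n + z m‖) ^ 2 := pow_le_pow_left₀ (hi0 N) h2 2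
    have h7 := pow_le_pow_left₀ (norm_nonneg _) h4 2
    have h8 := pow_le_pow_left₀ (norm_nonneg _) h5 2
    rw [mul_pow] at h6
    linarith
  · have h1 : Tendsto (fun n : ℕ => 4 * (I + 1 / ((n:ℝ) + 1)) ^ 2 - 4 * (i n) ^ 2) atTop
        (𝓝 (4 * (I + 0) ^ 2 - 4 * I ^ 2)) :=
      (((tendsto_const_nhds.add tendsto_one_div_add_atTop_nhds_zero_nat).pow 2).const_mul 4).sub
        ((hlim.pow 2).const_mul 4)
    have h2 := (Real.continuous_sqrt.tendsto _).comp h1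
    simpa [b, Function.comp_def] using h2

section stepA
variable {E : Type*} [NormedAddCommGroup E] [InnerProductSpace ℝ E] [FiniteDimensional ℝ E]
  [MeasurableSpace E] [BorelSpace E]

lemma inner_gradient (f : E → ℝ) (x e : E) : ⟪gradient f x, e⟫ = fderiv ℝ f x e := by
  rw [gradient, InnerProductSpace.toDual_symm_apply]

lemma norm_gradient (f : E → ℝ) (x : E) : ‖gradient f x‖ = ‖fderiv ℝ f x‖ := by
  rw [gradient, LinearIsometryEquiv.norm_map]

lemma continuous_gradient {f : E → ℝ} (hf : ContDiff ℝ 1 f) : Continuous (gradient f) :=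
  (InnerProductSpace.toDual ℝ E).symm.continuous.comp (hf.continuous_fderiv (by norm_num))

lemma stepA (ν : Measure E) [IsFiniteMeasure ν] {K : Set E} (hK : IsCompact K) (hνK : ν Kᶜ = 0)
    {R : ℝ} (hKR : K ⊆ ball 0 R)
    (h : ∀ f : E → ℝ, (∃ C : NNReal, LipschitzWith C f) → ∀ᵐ x ∂ν, DifferentiableAt ℝ f x)
    {e : E} (he : ‖e‖ = 1) {κ : ℝ} (hκ : 0 < κ) :
    ∃ δ > 0, ∀ f : E → ℝ, ContDiff ℝ 1 f → (∀ x, ‖fderiv ℝ f x‖ ≤ 1) →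
      (∀ x ∈ ball (0:E) R, |f x| ≤ δ) → ∫ x, fderiv ℝ f x e ∂ν < κ := by
  by_contra hcon
  push Not at hcon
  have hintg : ∀ f : E → ℝ, ContDiff ℝ 1 f → (∀ x, ‖fderiv ℝ f x‖ ≤ 1) →
      Integrable (fun x => fderiv ℝ f x e) ν := fun f hf hf1 => by
    refine Integrable.of_bound (C := 1) ?_ (Eventually.of_forall fun x => ?_)
    · exact ((hf.continuous_fderiv (by norm_num)).clm_apply continuous_const).aestronglyMeasurable
    · refine ((fderiv ℝ f x).le_opNorm e).trans ?_
      rw [he, mul_one]; exact hf1 x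
  have hmem : ∀ f : E → ℝ, ContDiff ℝ 1 f → (∀ x, ‖fderiv ℝ f x‖ ≤ 1) →
      MemLp (gradient f) 2 ν := fun f hf hf1 =>
    MemLp.of_bound (continuous_gradient hf).aestronglyMeasurable 1
      (Eventually.of_forall fun x => by rw [norm_gradient]; exact hf1 x)
  let Z : ℕ → Set (Lp E 2 ν) := fun n => {z | ∃ f : E → ℝ, ContDiff ℝ 1 f ∧
    (∀ x, ‖fderiv ℝ f x‖ ≤ 1) ∧ (∀ x ∈ ball (0:E) R, |f x| ≤ 1 / ((n:ℝ) + 1)) ∧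
    κ ≤ ∫ x, fderiv ℝ f x e ∂ν ∧ z =ᵐ[ν] gradient f}
  obtain ⟨z, hz, v, hzv⟩ := hilbert_nested Z (fun n => by
      rintro z1 ⟨f1, a1, a2, a3, a4, a5⟩ z2 ⟨f2, b1, b2, b3, b4, b5⟩ a b ha hb hab
      have hder : ∀ x, fderiv ℝ (a • f1 + b • f2) x = a • fderiv ℝ f1 x + b • fderiv ℝ f2 x := fun x => by
        have d1 := (a1.differentiable (by norm_num)) x
        have d2 := (b1.differentiable (by norm_num)) x
        exact ((d1.hasFDerivAt.const_smul a).add (d2.hasFDerivAt.const_smul b)).fderiv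
      refine ⟨a • f1 + b • f2, (contDiff_const.smul a1).add (contDiff_const.smul b1), fun x => ?_, fun x hx => ?_, ?_, ?_⟩
      · rw [hder]
        have := (convex_closedBall (0 : E →L[ℝ] ℝ) 1) (x := fderiv ℝ f1 x) (by simpa using a2 x)
          (y := fderiv ℝ f2 x) (by simpa using b2 x) ha hb hab
        simpa using this
      · have := (convex_closedBall (0 : ℝ) (1 / ((n:ℝ) + 1))) (x := f1 x) (by rw [mem_closedBall_zero_iff]; exact a3 x hx)
          (y := f2 x) (by rw [mem_closedBall_zero_iff]; exact b3 x hx) ha hb hab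
        rw [mem_closedBall_zero_iff] at this
        exact this
      · simp only [hder]
        have : ∫ x, (a • fderiv ℝ f1 x + b • fderiv ℝ f2 x) e ∂ν
          = a * ∫ x, fderiv ℝ f1 x e ∂ν + b * ∫ x, fderiv ℝ f2 x e ∂ν := by
          simp only [add_apply, smul_apply, smul_eq_mul]
          rw [integral_add ((hintg f1 a1 a2).const_mul a) ((hintg f2 b1 b2).const_mul b),
            integral_const_mul, integral_const_mul]
        rw [this]
        calc κ = a * κ + b * κ := by rw [← add_mul, hab, one_mul]
          _ ≤ _ := by gcongr
      · filter_upwards [Lp.coeFn_add (a • z1) (b • z2), Lp.coeFn_smul a z1, Lp.coeFn_smul b z2, a5, b5]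
          with x h1 h2 h3 h4 h5
        rw [h1, Pi.add_apply, h2, h3, Pi.smul_apply, Pi.smul_apply, h4, h5, gradient, gradient, gradient, hder]
        simp [map_add])
    (fun n m hnm z => by
      rintro ⟨f, a1, a2, a3, a4, a5⟩
      exact ⟨f, a1, a2, fun x hx => (a3 x hx).trans (by gcongr), a4, a5⟩)
    (fun n => by
      obtain ⟨f, hf, hf1, hf2, hf3⟩ := hcon (1 / ((n:ℝ) + 1)) (by positivity)
      exact ⟨(hmem f hf hf1).toLp, f, hf, hf1, hf2, hf3, (hmem f hf hf1).coeFn_toLp⟩)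
    ((measureUnivNNReal ν : ℝ) ^ (2:ℝ≥0∞).toReal⁻¹ * 1)
    (fun n z hz => by
      obtain ⟨f, a1, a2, a3, a4, a5⟩ := hz
      refine Lp.norm_le_of_ae_bound zero_le_one ?_
      filter_upwards [a5] with x hx
      rw [hx, norm_gradient]; exact a2 x)
  choose f hf1 hf2 hf3 hf4 hf5 using hz
  obtain ⟨φ, hφ, hae⟩ := (tendstoInMeasure_of_tendsto_Lp hzv).exists_seq_tendsto_ae
  have hae2 : ∀ᵐ x ∂ν, Tendsto (fun i => gradient (f (φ i)) x) atTop (𝓝 (v x)) := by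
    filter_upwards [hae, ae_all_iff.2 hf5] with x h1 h2
    simpa only [h2] using h1
  have hIv : κ ≤ ∫ x, ⟪v x, e⟫ ∂ν := by
    have ht : Tendsto (fun i => ∫ x, fderiv ℝ (f (φ i)) x e ∂ν) atTop (𝓝 (∫ x, ⟪v x, e⟫ ∂ν)) := by
      refine tendsto_integral_of_dominated_convergence (fun _ => 1)
        (fun i => (hintg _ (hf1 _) (hf2 _)).aestronglyMeasurable) (integrable_const _)
        (fun i => Eventually.of_forall fun x => ?_) ?_
      · refine ((fderiv ℝ (f (φ i)) x).le_opNorm e).trans ?_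
        rw [he, mul_one]; exact hf2 _ x
      · filter_upwards [hae2] with x hx
        simpa only [inner_gradient] using hx.inner (𝕜 := ℝ) (tendsto_const_nhds (x := e))
    exact ge_of_tendsto' ht fun i => hf4 _
  set c := κ / (2 * (ν.real univ + 1)) with hc
  have hm0 : 0 ≤ ν.real univ := measureReal_nonneg
  have hc0 : 0 < c := by positivity
  set A : Set E := {x | c ≤ ⟪v x, e⟫} with hA
  have hvm : StronglyMeasurable (v : E → E) := Lp.stronglyMeasurable v
  have hAm : MeasurableSet A :=
    measurableSet_le measurable_const (hvm.inner stronglyMeasurable_const).measurable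
  have hA0 : ν A ≠ 0 := by
    intro h0
    have h1 : ∀ᵐ x ∂ν, ⟪v x, e⟫ ≤ c := by
      have : ∀ᵐ x ∂ν, x ∉ A := measure_eq_zero_iff_ae_notMem.1 h0
      filter_upwards [this] with x hx
      exact (not_le.1 hx).le
    have h2 : ∫ x, ⟪v x, e⟫ ∂ν ≤ ∫ x, c ∂ν := by
      refine integral_mono_ae ?_ (integrable_const _) h1
      by_contra hni
      rw [integral_undef hni] at hIv
      linarith
    rw [integral_const, smul_eq_mul] at h2
    have h3 : ν.real univ * c < κ := by
      rw [hc, ← mul_div_assoc, div_lt_iff₀ (by positivity)]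
      nlinarith
    linarith
  obtain ⟨t, htm, htA, htu⟩ := tendstoUniformlyOn_of_ae_tendsto' (μ := ν)
    (fun i => (continuous_gradient (hf1 (φ i))).stronglyMeasurable) hvm hae2
    (ε := (ν A).toReal / 2) (by have := ENNReal.toReal_pos hA0 (measure_ne_top ν A); positivity)
  have htA' : ν t < ν A := by
    refine htA.trans_lt ?_
    have := ENNReal.toReal_pos hA0 (measure_ne_top ν A)
    conv_rhs => rw [← ENNReal.ofReal_toReal (measure_ne_top ν A)]
    rw [ENNReal.ofReal_lt_ofReal_iff this]
    linarith
  have hpos : 0 < ν ((A \ t) ∩ K) := by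
    have h1 : ν ((A \ t) ∩ K) = ν (A \ t) := measure_inter_conull hνK
    rw [h1]
    refine lt_of_lt_of_le (tsub_pos_of_lt htA') (le_measure_sdiff)
  obtain ⟨K', hK's, hK'c, hK'pos⟩ := ((hAm.diff htm).inter hK.isClosed.measurableSet).exists_lt_isCompact hpos
  have hun : TendstoUniformlyOn (fun i => fderiv ℝ (f (φ i))) (fun x => InnerProductSpace.toDual ℝ E (v x)) atTop K' := by
    have h1 := htu.mono (s' := K') (fun x hx => (hK's hx).1.2)
    rw [Metric.tendstoUniformlyOn_iff] at h1 ⊢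
    intro ε hε
    filter_upwards [h1 ε hε] with i hi x hx
    have h2 := hi x hx
    rw [← (InnerProductSpace.toDual ℝ E).dist_map] at h2
    simpa [gradient] using h2
  obtain ⟨F, hF, hFnd⟩ := nondiff (e := e) (c := c) hK'c (R := R) (fun x hx => hKR (hK's hx).2) (g := fun i => f (φ i))
    (fun i => hf1 _) (fun i => hf2 _) (fun ε hε => by
      obtain ⟨N, hN⟩ := exists_nat_one_div_lt hε
      filter_upwards [eventually_ge_atTop N] with i hi x hx
      refine (hf3 _ x hx).trans (le_trans ?_ hN.le)
      have : (N:ℝ) ≤ φ i := by exact_mod_cast hi.trans (hφ.id_le i)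
      gcongr) hun he hc0 (fun x hx => by
        have : c ≤ ⟪v x, e⟫ := (hK's hx).1.1
        simpa using this)
  have h1 := h F ⟨3, hF⟩
  have h2 : ν K' = 0 := by
    refine measure_mono_null (fun x hx => ?_) (ae_iff.1 h1)
    exact hFnd x hx
  exact hK'pos.ne' h2

end stepA
end CR

namespace CR

/-! ### Kernel estimates -/

/-- Euclidean space -/
abbrev V (d : ℕ) := EuclideanSpace ℝ (Fin d)

lemma lint_sq {α : Type*} [MeasurableSpace α] (μ : Measure α) {f : α → ℝ≥0∞} (hf : AEMeasurable f μ) :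
    (∫⁻ x, f x ∂μ) ^ 2 ≤ μ univ * ∫⁻ x, f x ^ 2 ∂μ := by
  have h := ENNReal.lintegral_mul_le_Lp_mul_Lq μ Real.HolderConjugate.two_two hf
    (aemeasurable_const (b := (1:ℝ≥0∞)))
  simp only [Pi.mul_apply, mul_one, ENNReal.one_rpow, lintegral_const, one_mul] at h
  calc (∫⁻ x, f x ∂μ) ^ 2 ≤ ((∫⁻ x, f x ^ (2:ℝ) ∂μ) ^ (1/(2:ℝ)) * (μ univ) ^ (1/(2:ℝ))) ^ 2 := by gcongr
    _ = μ univ * ∫⁻ x, f x ^ 2 ∂μ := by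
      rw [mul_pow, ← ENNReal.rpow_natCast, ← ENNReal.rpow_natCast, ← ENNReal.rpow_mul, ← ENNReal.rpow_mul]
      norm_num
      rw [mul_comm]

variable {d : ℕ} {Y : Type*} [NormedAddCommGroup Y] [NormedSpace ℝ Y]

/-- local integral -/
def qb (r : ℝ) (b : V d → ℝ≥0∞) (x : V d) : ℝ≥0∞ := ∫⁻ y in closedBall x r, b y

lemma vol_ball (x : V d) (r : ℝ) : volume (closedBall x r) = volume (closedBall (0:V d) r) := by
  rw [Measure.addHaar_closedBall_center]

lemma qb_sq_le (r : ℝ) {b : V d → ℝ≥0∞} (hb : AEMeasurable b) (x : V d) :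
    (qb r b x) ^ 2 ≤ volume (closedBall (0:V d) r) * ∫⁻ y in closedBall x r, b y ^ 2 := by
  have := lint_sq (volume.restrict (closedBall x r)) hb.restrict
  rwa [Measure.restrict_apply_univ, vol_ball] at this

lemma lintegral_qb (r : ℝ) {b : V d → ℝ≥0∞} (hb : AEMeasurable b) :
    ∫⁻ x, ∫⁻ y in closedBall x r, b y = volume (closedBall (0:V d) r) * ∫⁻ y, b y := by
  have h1 : ∀ x : V d, ∫⁻ y in closedBall x r, b y
      = ∫⁻ y, (closedBall y r).indicator (fun _ => b y) x := fun x => by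
    rw [← lintegral_indicator isClosed_closedBall.measurableSet]
    refine lintegral_congr fun y => ?_
    simp only [indicator, mem_closedBall, dist_comm]
  simp only [h1]
  have hms : MeasurableSet {p : V d × V d | dist p.1 p.2 ≤ r} :=
    (isClosed_le continuous_dist continuous_const).measurableSet
  rw [lintegral_lintegral_swap]
  · have h2 : ∀ y : V d, ∫⁻ x, (closedBall y r).indicator (fun _ => b y) x
        = volume (closedBall (0:V d) r) * b y := fun y => by
      rw [lintegral_indicator isClosed_closedBall.measurableSet, setLIntegral_const, vol_ball, mul_comm]
    simp only [h2]
    rw [lintegral_const_mul'' _ hb]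
  · have : (Function.uncurry fun (x y : V d) => (closedBall y r).indicator (fun _ => b y) x)
        = {p : V d × V d | dist p.1 p.2 ≤ r}.indicator (fun p => b p.2) := by
      ext ⟨x, y⟩
      simp only [Function.uncurry, indicator, mem_closedBall]; rfl
    rw [this]
    exact (hb.comp_quasiMeasurePreserving Measure.quasiMeasurePreserving_snd).indicator hms

lemma qb_le (r : ℝ) {b : V d → ℝ≥0∞} (hb : AEMeasurable b) (x : V d) :
    (qb r b x) ^ 2 ≤ volume (closedBall (0:V d) r) * ∫⁻ y, b y ^ 2 :=
  (qb_sq_le r hb x).trans (by gcongr; exact Measure.restrict_le_self)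

lemma lintegral_qb_sq (r : ℝ) {b : V d → ℝ≥0∞} (hb : AEMeasurable b) :
    ∫⁻ x, (qb r b x) ^ 2 ≤ volume (closedBall (0:V d) r) ^ 2 * ∫⁻ y, b y ^ 2 := by
  calc ∫⁻ x, (qb r b x) ^ 2 ≤ ∫⁻ x, volume (closedBall (0:V d) r) * ∫⁻ y in closedBall x r, b y ^ 2 :=
        lintegral_mono fun x => qb_sq_le r hb x
    _ = _ := by
      rw [lintegral_const_mul' _ _ (measure_closedBall_lt_top.ne), lintegral_qb r (hb.pow_const 2), pow_two, mul_assoc]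

/-- convolution type integral -/
def cv (k : V d → ℝ) (B : V d → Y) (x : V d) : Y := ∫ y, k (x - y) • B y

lemma cv_bound {κ : V d → ℝ} {c r : ℝ} {z : V d}
    (h : ∀ p, |κ p| ≤ c * ((closedBall (0:V d) r).indicator 1 p + (closedBall (0:V d) r).indicator 1 (p + z)))
    (hc : 0 ≤ c) {B : V d → Y} (hB : AEStronglyMeasurable B) (x : V d) :
    ∫⁻ y, ‖κ (x - y) • B y‖ₑ ≤ ENNReal.ofReal c * (qb r (fun y => ‖B y‖ₑ) x + qb r (fun y => ‖B y‖ₑ) (x + z)) := by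
  have h1 : ∀ y, ‖κ (x - y) • B y‖ₑ ≤ ENNReal.ofReal c * ((closedBall x r).indicator (fun y => ‖B y‖ₑ) y
      + (closedBall (x + z) r).indicator (fun y => ‖B y‖ₑ) y) := fun y => by
    rw [enorm_smul]
    have h2 : ‖κ (x - y)‖ₑ ≤ ENNReal.ofReal c * ((closedBall x r).indicator 1 y + (closedBall (x + z) r).indicator 1 y) := by
      rw [← ofReal_norm, Real.norm_eq_abs]
      refine (ENNReal.ofReal_le_ofReal (h _)).trans ?_
      rw [ENNReal.ofReal_mul hc]
      gcongr
      have e1 : x - y ∈ closedBall (0:V d) r ↔ y ∈ closedBall x r := by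
        rw [mem_closedBall_zero_iff, mem_closedBall', dist_eq_norm]
      have e2 : x - y + z ∈ closedBall (0:V d) r ↔ y ∈ closedBall (x + z) r := by
        rw [mem_closedBall_zero_iff, mem_closedBall', dist_eq_norm, sub_add_eq_add_sub]
      by_cases c1 : y ∈ closedBall x r <;> by_cases c2 : y ∈ closedBall (x+z) r <;>
        simp only [indicator, e1, e2, c1, c2, if_true, if_false, Pi.one_apply] <;> norm_num
    calc ‖κ (x - y)‖ₑ * ‖B y‖ₑ ≤ (ENNReal.ofReal c * ((closedBall x r).indicator 1 y + (closedBall (x + z) r).indicator 1 y)) * ‖B y‖ₑ := by gcongr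
      _ = _ := by
        rw [mul_assoc, add_mul]
        simp [indicator]
  refine (lintegral_mono h1).trans ?_
  rw [lintegral_const_mul' _ _ ENNReal.ofReal_ne_top]
  gcongr
  rw [lintegral_add_left' (hB.enorm.indicator isClosed_closedBall.measurableSet), qb, qb, lintegral_indicator isClosed_closedBall.measurableSet, lintegral_indicator isClosed_closedBall.measurableSet]


lemma kernel_taylor {φ : V d → ℝ} (hφ : ContDiff ℝ 2 φ) {r : ℝ} (hs : tsupport φ ⊆ closedBall 0 r) :
    ∃ c, 0 ≤ c ∧ (∀ p, |φ p| ≤ c) ∧ (∀ p, ‖fderiv ℝ φ p‖ ≤ c) ∧ (∀ p z, |φ (p + z) - φ p| ≤ c * ‖z‖) ∧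
      (∀ p z, ‖fderiv ℝ φ (p + z) - fderiv ℝ φ p‖ ≤ c * ‖z‖) ∧
      (∀ p z, |φ (p + z) - φ p - fderiv ℝ φ p z| ≤ c * ‖z‖ ^ 2) ∧
      (∀ p, p ∉ closedBall 0 r → φ p = 0) ∧ (∀ p, p ∉ closedBall 0 r → fderiv ℝ φ p = 0) := by
  have hcs : HasCompactSupport φ := HasCompactSupport.of_support_subset_isCompact
    (isCompact_closedBall 0 r) ((subset_tsupport φ).trans hs)
  have hφ1 : ContDiff ℝ 1 φ := hφ.of_le (by norm_num)
  have hD : ContDiff ℝ 1 (fderiv ℝ φ) := hφ.fderiv_right (by norm_num)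
  have hDcs : HasCompactSupport (fderiv ℝ φ) := hcs.fderiv (𝕜 := ℝ)
  obtain ⟨c1, h1⟩ := hφ.continuous.bounded_above_of_compact_support hcs
  obtain ⟨c2, h2⟩ := hD.continuous.bounded_above_of_compact_support hDcs
  obtain ⟨c3, h3⟩ := hφ1.lipschitzWith_of_hasCompactSupport hcs (by norm_num)
  obtain ⟨c4, h4⟩ := hD.lipschitzWith_of_hasCompactSupport hDcs (by norm_num)
  have c10 : 0 ≤ c1 := (norm_nonneg _).trans (h1 0)
  have c20 : 0 ≤ c2 := (norm_nonneg _).trans (h2 0)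
  have hz3 : ∀ p z, |φ (p + z) - φ p| ≤ c3 * ‖z‖ := fun p z => by
    have := h3.dist_le_mul (p + z) p
    rw [dist_eq_norm, dist_eq_norm, add_sub_cancel_left] at this
    exact this
  have hz4 : ∀ p z, ‖fderiv ℝ φ (p + z) - fderiv ℝ φ p‖ ≤ c4 * ‖z‖ := fun p z => by
    have := h4.dist_le_mul (p + z) p
    rwa [dist_eq_norm, dist_eq_norm, add_sub_cancel_left] at this
  refine ⟨c1 + c2 + c3 + c4, by positivity, fun p => (h1 p).trans ?_, fun p => (h2 p).trans ?_,
    fun p z => (hz3 p z).trans ?_, fun p z => (hz4 p z).trans ?_, fun p z => ?_, fun p hp => ?_, fun p hp => ?_⟩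
  · linarith [c3.coe_nonneg, c4.coe_nonneg]
  · linarith [c3.coe_nonneg, c4.coe_nonneg]
  · gcongr; linarith [c3.coe_nonneg, c4.coe_nonneg]
  · gcongr; linarith [c3.coe_nonneg, c4.coe_nonneg]
  · have := (convex_closedBall p ‖z‖).norm_image_sub_le_of_norm_fderiv_le' (𝕜 := ℝ) (f := φ)
      (φ := fderiv ℝ φ p) (C := c4 * ‖z‖) (x := p) (y := p + z)
      (fun y _ => (hφ1.differentiable (by norm_num)).differentiableAt)
      (fun y hy => by
        have h5 := hz4 p (y - p)
        rw [add_sub_cancel] at h5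
        refine h5.trans ?_
        gcongr
        rwa [mem_closedBall, dist_eq_norm] at hy)
      (by simp) (by simp)
    rw [add_sub_cancel_left, Real.norm_eq_abs] at this
    refine this.trans ?_
    rw [pow_two, ← mul_assoc]
    gcongr; linarith [c3.coe_nonneg, c4.coe_nonneg]
  · exact image_eq_zero_of_notMem_tsupport fun h => hp (hs h)
  · have : p ∉ tsupport (fderiv ℝ φ) := fun h => hp (hs (tsupport_fderiv_subset ℝ h))
    exact image_eq_zero_of_notMem_tsupport this

lemma ind_bound {κ : V d → ℝ} {c r : ℝ} {z : V d} (hc : 0 ≤ c) (h : ∀ p, |κ p| ≤ c)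
    (h0 : ∀ p, p ∉ closedBall (0:V d) r → p + z ∉ closedBall (0:V d) r → κ p = 0) (p : V d) :
    |κ p| ≤ c * ((closedBall (0:V d) r).indicator 1 p + (closedBall (0:V d) r).indicator 1 (p + z)) := by
  have := h p
  by_cases c1 : p ∈ closedBall (0:V d) r <;> by_cases c2 : p + z ∈ closedBall (0:V d) r
  · simp only [indicator, c1, c2, if_true, Pi.one_apply]; linarith
  · simp only [indicator, c1, c2, if_true, if_false, Pi.one_apply]; linarith
  · simp only [indicator, c1, c2, if_true, if_false, Pi.one_apply]; linarith
  · rw [h0 p c1 c2]; simp [indicator, c1, c2]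

/-- regularity of a map together with its derivatives -/
structure Good (M : ℝ) (F : V d → Y) (D : Fin d → V d → Y) : Prop where
  bd : ∀ x, ‖F x‖ ≤ M
  bdD : ∀ k x, ‖D k x‖ ≤ M
  lip : ∀ x z, ‖F (x + z) - F x‖ ≤ M * ‖z‖
  lipD : ∀ k x z, ‖D k (x + z) - D k x‖ ≤ M * ‖z‖
  inc : ∀ z, ∫⁻ x, ‖F (x + z) - F x‖ₑ ^ 2 ≤ ENNReal.ofReal (M * ‖z‖ ^ 2)
  rem : ∀ z, ∫⁻ x, ‖F (x + z) - F x - ∑ k, z k • D k x‖ₑ ^ 2 ≤ ENNReal.ofReal (M * ‖z‖ ^ 4)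

lemma enorm_le_iff {y : Y} {c : ℝ} (hc : 0 ≤ c) : ‖y‖ₑ ≤ ENNReal.ofReal c ↔ ‖y‖ ≤ c := by
  rw [← ofReal_norm, ENNReal.ofReal_le_ofReal_iff hc]

lemma cv_pt {B : V d → Y} (hB : MemLp B 2) (r : ℝ) : ∃ M, 0 ≤ M ∧ ∀ (κ : V d → ℝ) (c : ℝ) (z : V d), Measurable κ →
    0 ≤ c → (∀ p, |κ p| ≤ c) → (∀ p, p ∉ closedBall (0:V d) r → p + z ∉ closedBall (0:V d) r → κ p = 0) →
    (∀ x, Integrable (fun y => κ (x - y) • B y)) ∧ (∀ x, ‖cv κ B x‖ ≤ M * c) ∧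
    ∫⁻ x, ‖cv κ B x‖ₑ ^ 2 ≤ ENNReal.ofReal (M * c ^ 2) := by
  set W := volume (closedBall (0:V d) r) with hW
  have hWt : W ≠ ∞ := measure_closedBall_lt_top.ne
  set I := ∫⁻ y, ‖B y‖ₑ ^ 2 with hI
  have hIt : I ≠ ∞ := by
    have := hB.2
    rw [eLpNorm_lt_top_iff_lintegral_rpow_enorm_lt_top (by norm_num) (by norm_num)] at this
    simpa using this.ne
  set m := (W * I).toReal with hm
  set n := (W ^ 2 * I).toReal with hn
  have hWI : W * I = ENNReal.ofReal m := (ENNReal.ofReal_toReal (ENNReal.mul_ne_top hWt hIt)).symm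
  have hWI2 : W ^ 2 * I = ENNReal.ofReal n :=
    (ENNReal.ofReal_toReal (ENNReal.mul_ne_top (ENNReal.pow_ne_top hWt) hIt)).symm
  have hm0 : 0 ≤ m := ENNReal.toReal_nonneg
  have hn0 : 0 ≤ n := ENNReal.toReal_nonneg
  have hBm := hB.1
  have hq : ∀ x, qb r (fun y => ‖B y‖ₑ) x ≤ ENNReal.ofReal (√m) := fun x => by
    have h1 := qb_le r hBm.enorm x
    rw [← hW, ← hI, hWI] at h1
    rw [← ENNReal.pow_le_pow_left_iff two_ne_zero, ← ENNReal.ofReal_pow (by positivity), Real.sq_sqrt hm0]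
    exact h1
  refine ⟨2 * √m + 4 * n, by positivity, fun κ c z hκ hc h h0 => ?_⟩
  have hb := fun x => cv_bound (ind_bound hc h h0) hc hBm x
  have hb2 : ∀ x, ∫⁻ y, ‖κ (x - y) • B y‖ₑ ≤ ENNReal.ofReal (2 * √m * c) := fun x => by
    refine (hb x).trans ?_
    calc _ ≤ ENNReal.ofReal c * (ENNReal.ofReal (√m) + ENNReal.ofReal (√m)) := by
          gcongr <;> exact hq _
      _ = _ := by
        rw [← ENNReal.ofReal_add (by positivity) (by positivity), ← ENNReal.ofReal_mul hc]
        congr 1; ring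
  refine ⟨fun x => ⟨?_, (hb2 x).trans_lt ENNReal.ofReal_lt_top⟩, fun x => ?_, ?_⟩
  · exact ((hκ.comp (measurable_const.sub measurable_id)).aestronglyMeasurable).smul hBm
  · have h1 : ‖cv κ B x‖ₑ ≤ ENNReal.ofReal (2 * √m * c) := (enorm_integral_le_lintegral_enorm _).trans (hb2 x)
    rw [enorm_le_iff (by positivity)] at h1
    refine h1.trans ?_
    gcongr; linarith
  · have h1 : ∀ x, ‖cv κ B x‖ₑ ^ 2 ≤ ENNReal.ofReal (c ^ 2) * (2 * (qb r (fun y => ‖B y‖ₑ) x ^ 2 + qb r (fun y => ‖B y‖ₑ) (x + z) ^ 2)) := fun x => by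
      calc ‖cv κ B x‖ₑ ^ 2 ≤ (ENNReal.ofReal c * (qb r (fun y => ‖B y‖ₑ) x + qb r (fun y => ‖B y‖ₑ) (x + z))) ^ 2 := by
            gcongr
            exact (enorm_integral_le_lintegral_enorm _).trans (hb x)
        _ ≤ _ := by
          rw [mul_pow, ← ENNReal.ofReal_pow hc]
          gcongr
          have := ENNReal.rpow_add_le_mul_rpow_add_rpow (qb r (fun y => ‖B y‖ₑ) x) (qb r (fun y => ‖B y‖ₑ) (x + z)) (p := 2) (by norm_num)
          norm_num at this
          exact_mod_cast this
    refine (lintegral_mono h1).trans ?_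
    have hqm : AEMeasurable (fun x => qb r (fun y => ‖B y‖ₑ) x ^ 2) (volume : Measure (V d)) := by
      have : Measurable (fun x => qb r (fun y => ‖B y‖ₑ) x) := by
        have e : (fun x => qb r (fun y => ‖B y‖ₑ) x) = fun x => ∫⁻ y, (closedBall x r).indicator (fun _ => ‖hBm.mk B y‖ₑ) y := by
          ext x
          rw [qb, ← lintegral_indicator isClosed_closedBall.measurableSet]
          refine lintegral_congr_ae ?_
          filter_upwards [hBm.ae_eq_mk] with y hy
          simp only [indicator, hy]
        rw [e]
        have e2 : (Function.uncurry fun (x y : V d) => (closedBall x r).indicator (fun _ => ‖hBm.mk B y‖ₑ) y)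
          = {p : V d × V d | dist p.1 p.2 ≤ r}.indicator (fun p => ‖hBm.mk B p.2‖ₑ) := by
          ext ⟨x, y⟩
          simp only [Function.uncurry, indicator, mem_closedBall']; rfl
        refine Measurable.lintegral_prod_right' (f := Function.uncurry fun (x y : V d) => (closedBall x r).indicator (fun _ => ‖hBm.mk B y‖ₑ) y) ?_
        rw [e2]
        exact (hBm.stronglyMeasurable_mk.enorm.comp measurable_snd).indicator
          (isClosed_le continuous_dist continuous_const).measurableSet
      exact (this.pow_const 2).aemeasurable
    rw [lintegral_const_mul' _ _ ENNReal.ofReal_ne_top, lintegral_const_mul' _ _ (by norm_num),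
      lintegral_add_left' hqm, lintegral_add_right_eq_self (fun x => qb r (fun y => ‖B y‖ₑ) x ^ 2) z]
    have h2 := lintegral_qb_sq r hBm.enorm
    rw [← hW, ← hI, hWI2] at h2
    calc _ ≤ ENNReal.ofReal (c ^ 2) * (2 * (ENNReal.ofReal n + ENNReal.ofReal n)) := by gcongr
      _ = ENNReal.ofReal (4 * n * c ^ 2) := by
        rw [← ENNReal.ofReal_add hn0 hn0, show (2:ℝ≥0∞) = ENNReal.ofReal 2 by norm_num,
          ← ENNReal.ofReal_mul (by norm_num), ← ENNReal.ofReal_mul (by positivity)]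
        congr 1; ring
      _ ≤ _ := by
        apply ENNReal.ofReal_le_ofReal
        gcongr
        linarith [Real.sqrt_nonneg m]

lemma sum_single (z : V d) : z = ∑ k, z k • EuclideanSpace.single k (1:ℝ) := by
  ext j
  simp [Pi.single_apply]

lemma good_cv {φ : V d → ℝ} (hφ : ContDiff ℝ 2 φ) {r : ℝ} (hs : tsupport φ ⊆ closedBall 0 r)
    {B : V d → Y} (hB : MemLp B 2) :
    ∃ M, 0 ≤ M ∧ Good M (cv φ B) (fun k => cv (fun p => fderiv ℝ φ p (EuclideanSpace.single k 1)) B) := by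
  obtain ⟨c, hc, h1, h2, h3, h4, h5, h6, h7⟩ := kernel_taylor hφ hs
  obtain ⟨M, hM, H⟩ := cv_pt hB r
  have hφm : Measurable φ := hφ.continuous.measurable
  have hDc : Continuous (fderiv ℝ φ) := hφ.continuous_fderiv (by norm_num)
  have hDm : ∀ z, Measurable (fun p => fderiv ℝ φ p z) := fun z => (hDc.clm_apply continuous_const).measurable
  have hap : ∀ (z : V d) (p : V d), |fderiv ℝ φ p z| ≤ c * ‖z‖ := fun z p =>
    ((fderiv ℝ φ p).le_opNorm z).trans (by gcongr; exact h2 p)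
  have H0 := H φ c 0 hφm hc h1 (fun p hp _ => h6 p hp)
  have HD := fun z => H (fun p => fderiv ℝ φ p z) (c * ‖z‖) 0 (hDm z) (by positivity) (hap z)
    (fun p hp _ => by simp [h7 p hp])
  have Hinc := fun z => H (fun p => φ (p + z) - φ p) (c * ‖z‖) z
    ((hφm.comp (measurable_id.add_const z)).sub hφm) (by positivity) (fun p => h3 p z)
    (fun p hp hp' => by simp [h6 p hp, h6 _ hp'])
  have Hrem := fun z => H (fun p => φ (p + z) - φ p - fderiv ℝ φ p z) (c * ‖z‖ ^ 2) z
    (((hφm.comp (measurable_id.add_const z)).sub hφm).sub (hDm z)) (by positivity) (fun p => h5 p z)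
    (fun p hp hp' => by simp [h6 p hp, h6 _ hp', h7 p hp])
  have HDinc := fun (k : Fin d) z => H (fun p => fderiv ℝ φ (p + z) (EuclideanSpace.single k 1) - fderiv ℝ φ p (EuclideanSpace.single k 1)) (c * ‖z‖) z
    (((hDm _).comp (measurable_id.add_const z)).sub (hDm _)) (by positivity) (fun p => by
      have := (fderiv ℝ φ (p + z) - fderiv ℝ φ p).le_opNorm (EuclideanSpace.single k (1:ℝ))
      rw [sub_apply] at this
      refine this.trans ?_
      simpa using h4 p z)
    (fun p hp hp' => by simp [h7 p hp, h7 _ hp'])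
  have einc : ∀ x z, cv φ B (x + z) - cv φ B x = cv (fun p => φ (p + z) - φ p) B x := fun x z => by
    rw [cv, cv, cv, ← integral_sub (H0.1 _) (H0.1 _)]
    congr 1; ext y
    rw [← sub_smul, add_sub_right_comm]
  have eDinc : ∀ v x z, cv (fun p => fderiv ℝ φ p v) B (x + z) - cv (fun p => fderiv ℝ φ p v) B x
      = cv (fun p => fderiv ℝ φ (p + z) v - fderiv ℝ φ p v) B x := fun v x z => by
    rw [cv, cv, cv, ← integral_sub ((HD v).1 _) ((HD v).1 _)]
    congr 1; ext y
    rw [← sub_smul, add_sub_right_comm]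
  have esum : ∀ x (z : V d), ∑ k, z k • cv (fun p => fderiv ℝ φ p (EuclideanSpace.single k 1)) B x
      = cv (fun p => fderiv ℝ φ p z) B x := fun x z => by
    simp only [cv, ← integral_smul]
    rw [← integral_finsetSum _ (fun k _ => by exact ((HD (EuclideanSpace.single k 1)).1 x).smul (z k))]
    congr 1; ext y
    conv_rhs => rw [sum_single z]
    rw [map_sum, Finset.sum_smul]
    simp [smul_smul]
  have erem : ∀ x z, cv φ B (x + z) - cv φ B x - ∑ k, z k • cv (fun p => fderiv ℝ φ p (EuclideanSpace.single k 1)) B x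
      = cv (fun p => φ (p + z) - φ p - fderiv ℝ φ p z) B x := fun x z => by
    rw [einc, esum, cv, cv, cv, ← integral_sub ((Hinc z).1 _) ((HD z).1 _)]
    congr 1; ext y
    rw [← sub_smul]
  refine ⟨M * c + M * c ^ 2, by positivity, fun x => ?_, fun k x => ?_, fun x z => ?_, fun k x z => ?_, fun z => ?_, fun z => ?_⟩
  · refine (H0.2.1 x).trans ?_
    have : 0 ≤ M * c ^ 2 := by positivity
    linarith
  · refine ((HD _).2.1 x).trans ?_
    have : 0 ≤ M * c ^ 2 := by positivity
    simp; linarith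
  · rw [einc]
    refine ((Hinc z).2.1 x).trans ?_
    rw [← mul_assoc]; gcongr
    have : 0 ≤ M * c ^ 2 := by positivity
    linarith
  · rw [eDinc]
    refine ((HDinc k z).2.1 x).trans ?_
    rw [← mul_assoc]; gcongr
    have : 0 ≤ M * c ^ 2 := by positivity
    linarith
  · simp only [einc]
    refine ((Hinc z).2.2).trans (ENNReal.ofReal_le_ofReal ?_)
    rw [mul_pow, ← mul_assoc]; gcongr
    have : 0 ≤ M * c := by positivity
    linarith
  · simp only [erem]
    refine ((Hrem z).2.2).trans (ENNReal.ofReal_le_ofReal ?_)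
    rw [mul_pow, ← mul_assoc, ← pow_mul]; gcongr
    have : 0 ≤ M * c := by positivity
    linarith

end CR

namespace CR

/-! ### Gaussian averages -/

/-- standard Gaussian -/
abbrev gam (d : ℕ) : Measure (V d) := ProbabilityTheory.stdGaussian (V d)

section
variable {d : ℕ}

lemma gam_memLp (p : ℝ≥0∞) (hp : p ≠ ∞) : MemLp (fun z : V d => z) p (gam d) :=
  ProbabilityTheory.IsGaussian.memLp_id (gam d) p hp

lemma gam_int_pow (n : ℕ) : Integrable (fun z : V d => ‖z‖ ^ n) (gam d) :=
  (gam_memLp (n : ℝ≥0∞) (by simp)).integrable_norm_pow'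

lemma gam_mean (i : Fin d) : ∫ z : V d, z i ∂(gam d) = 0 :=
  ProbabilityTheory.integral_strongDual_stdGaussian (EuclideanSpace.proj (𝕜 := ℝ) i)

lemma gam_int_mul (i j : Fin d) : Integrable (fun z : V d => z i * z j) (gam d) := by
  refine (gam_int_pow 2).mono (by fun_prop) (ae_of_all _ fun z => ?_)
  have h : ∀ i, |z i| ≤ ‖z‖ := fun i => PiLp.norm_apply_le z i
  rw [norm_pow, norm_norm, norm_mul, pow_two, Real.norm_eq_abs, Real.norm_eq_abs]
  exact mul_le_mul (h i) (h j) (abs_nonneg _) (norm_nonneg _)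

lemma gam_cov (i j : Fin d) : ∫ z : V d, z i * z j ∂(gam d) = if i = j then 1 else 0 := by
  have h := ProbabilityTheory.covarianceBilin_apply (gam_memLp (d := d) 2 (by simp))
    (EuclideanSpace.single i (1:ℝ)) (EuclideanSpace.single j (1:ℝ))
  rw [ProbabilityTheory.covarianceBilin_stdGaussian] at h
  have e : ∫ x, id x ∂(gam d) = 0 := ProbabilityTheory.integral_id_stdGaussian
  have e' : ∫ x, x ∂(gam d) = 0 := ProbabilityTheory.integral_id_stdGaussian
  rw [innerSL_apply_apply] at h
  simp [e', EuclideanSpace.inner_single_left] at h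
  rw [← h]

end

section
variable {d : ℕ} {Y : Type*} [NormedAddCommGroup Y] [InnerProductSpace ℝ Y] [CompleteSpace Y]

lemma gam_sum_sq (D : Fin d → Y) :
    ∫ z : V d, ‖∑ k, z k • D k‖ ^ 2 ∂(gam d) = ∑ k, ‖D k‖ ^ 2 := by
  have h : ∀ z : V d, ‖∑ k, z k • D k‖ ^ 2 = ∑ i, ∑ j, (z i * z j) * ⟪D i, D j⟫ := fun z => by
    rw [← real_inner_self_eq_norm_sq, sum_inner]
    simp only [inner_sum, real_inner_smul_left, real_inner_smul_right]
    refine Finset.sum_congr rfl fun i _ => Finset.sum_congr rfl fun j _ => by ring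
  simp only [h]
  rw [integral_finsetSum _ (fun i _ => integrable_finsetSum _ fun j _ => (gam_int_mul i j).mul_const _)]
  refine Finset.sum_congr rfl fun i _ => ?_
  rw [integral_finsetSum _ (fun j _ => (gam_int_mul i j).mul_const _)]
  simp only [integral_mul_const, gam_cov]
  simp

lemma gam_lin_mean (D : Fin d → Y) : ∫ z : V d, ∑ k, z k • D k ∂(gam d) = 0 := by
  have hi : ∀ i : Fin d, Integrable (fun z : V d => z i) (gam d) := fun i => by
    have := ((gam_memLp (d := d) 1 (by simp)).integrable le_rfl)
    exact (EuclideanSpace.proj (𝕜 := ℝ) i).integrable_comp this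
  rw [integral_finsetSum _ (fun i _ => (hi i).smul_const _)]
  simp only [integral_smul_const, gam_mean]
  simp

/-- the mean minimizes the square distance -/
lemma var_le {Ω : Type*} [MeasurableSpace Ω] (P : Measure Ω) [IsProbabilityMeasure P] {f : Ω → Y}
    (hf : MemLp f 2 P) (c : Y) :
    ∫ ω, ‖f ω - ∫ ω', f ω' ∂P‖ ^ 2 ∂P + ‖(∫ ω', f ω' ∂P) - c‖ ^ 2 = ∫ ω, ‖f ω - c‖ ^ 2 ∂P := by
  set m := ∫ ω', f ω' ∂P with hm
  have hfi : Integrable f P := hf.integrable (by norm_num)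
  have h : ∀ ω, ‖f ω - c‖ ^ 2 = ‖f ω - m‖ ^ 2 + 2 * ⟪m - c, f ω - m⟫ + ‖m - c‖ ^ 2 := fun ω => by
    rw [show f ω - c = (f ω - m) + (m - c) by abel, norm_add_sq_real, real_inner_comm]
  simp only [h]
  have i1 : Integrable (fun ω => ‖f ω - m‖ ^ 2) P := (hf.sub (memLp_const m)).integrable_norm_pow (by norm_num)
  have i2 : Integrable (fun ω => 2 * ⟪m - c, f ω - m⟫) P :=
    ((innerSL ℝ (m - c)).integrable_comp (hfi.sub (integrable_const m))).const_mul 2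
  rw [integral_add (by exact i1.add i2) (integrable_const _), integral_add i1 i2, integral_const_mul,
    integral_inner (by exact hfi.sub (integrable_const m)), integral_sub hfi (integrable_const m)]
  simp [hm]

/-- Gaussian average -/
def Ps (s : ℝ) (F : V d → Y) (x : V d) : Y := ∫ z, F (x + s • z) ∂(gam d)

lemma Good.cont {Z : Type*} [NormedAddCommGroup Z] [NormedSpace ℝ Z] {M : ℝ} (hM : 0 ≤ M) {F : V d → Z} {D : Fin d → V d → Z}
    (h : Good M F D) : Continuous F := by
  have : LipschitzWith ⟨M, hM⟩ F := LipschitzWith.of_dist_le_mul fun x y => by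
    have := h.lip y (x - y)
    rw [add_sub_cancel] at this
    rwa [dist_eq_norm, dist_eq_norm]
  exact this.continuous

lemma Good.contD {Z : Type*} [NormedAddCommGroup Z] [NormedSpace ℝ Z] {M : ℝ} (hM : 0 ≤ M) {F : V d → Z} {D : Fin d → V d → Z}
    (h : Good M F D) (k : Fin d) : Continuous (D k) := by
  have : LipschitzWith ⟨M, hM⟩ (D k) := LipschitzWith.of_dist_le_mul fun x y => by
    have := h.lipD k y (x - y)
    rw [add_sub_cancel] at this
    rwa [dist_eq_norm, dist_eq_norm]
  exact this.continuous

lemma Ps_memLp {F : V d → Y} {M : ℝ} (hF : Continuous F) (hM : ∀ x, ‖F x‖ ≤ M) (s : ℝ) (x : V d) (p : ℝ≥0∞) :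
    MemLp (fun z => F (x + s • z)) p (gam d) :=
  MemLp.of_bound (by fun_prop) M (ae_of_all _ fun z => hM _)

lemma lin_memLp (D : Fin d → Y) : MemLp (fun z : V d => ∑ k, z k • D k) 2 (gam d) := by
  refine memLp_finsetSum _ fun k _ => ?_
  exact ((EuclideanSpace.proj (𝕜 := ℝ) k).smulRight (D k)).comp_memLp' (gam_memLp (d := d) 2 (by simp))

end
end CR

namespace CR

section
variable {d : ℕ} {X : Type*} [NormedAddCommGroup X] [InnerProductSpace ℝ X] [CompleteSpace X]

/-- Taylor remainder -/
def rh {Z : Type*} [NormedAddCommGroup Z] [NormedSpace ℝ Z] (F : V d → Z) (D : Fin d → V d → Z) (x z : V d) : Z :=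
  F (x + z) - F x - ∑ k, z k • D k x

lemma rh_memLp {F : V d → X} {D : Fin d → V d → X} {M : ℝ} (hM : 0 ≤ M) (h : Good M F D) (s : ℝ) (x : V d) :
    MemLp (fun z => rh F D x (s • z)) 2 (gam d) := by
  have h1 := ((Ps_memLp (h.cont hM) h.bd s x 2).sub (memLp_const (F x))).sub (lin_memLp (fun k => s • D k x))
  refine h1.congr_norm ?_ (ae_of_all _ fun z => ?_) |> fun h => h
  · have := h1.aestronglyMeasurable
    refine this.congr (ae_of_all _ fun z => ?_)
    simp [rh, smul_smul, mul_comm]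
  · simp [rh, smul_smul, mul_comm]

lemma var_lower {F : V d → X} {D : Fin d → V d → X} {M : ℝ} (hM : 0 ≤ M) (h : Good M F D) (s : ℝ) (x : V d) :
    s ^ 2 * ∑ k, ‖D k x‖ ^ 2 ≤ 2 * ∫ z, ‖F (x + s • z) - Ps s F x‖ ^ 2 ∂(gam d)
      + 2 * ∫ z, ‖rh F D x (s • z)‖ ^ 2 ∂(gam d) := by
  have mF := Ps_memLp (h.cont hM) h.bd s x 2
  have mr := rh_memLp hM h s x
  have mL := lin_memLp (fun k => s • D k x)
  set rb := ∫ z, rh F D x (s • z) ∂(gam d) with hrb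
  have e0 : ∀ z : V d, ∑ k, (s • z) k • D k x = ∑ k, z k • (s • D k x) := fun z => by
    simp [smul_smul, mul_comm]
  have erb : rb = Ps s F x - F x := by
    rw [hrb]
    simp only [rh, e0]
    rw [integral_sub (by exact (mF.integrable (by norm_num)).sub (integrable_const _)) (mL.integrable (by norm_num)),
      integral_sub (mF.integrable (by norm_num)) (integrable_const _), gam_lin_mean]
    simp [Ps]
  have e1 : ∑ k, ‖s • D k x‖ ^ 2 = s ^ 2 * ∑ k, ‖D k x‖ ^ 2 := by
    simp [norm_smul, mul_pow, Finset.mul_sum]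
  rw [← e1, ← gam_sum_sq]
  have v := var_le (gam d) mr 0
  rw [← hrb] at v
  simp only [sub_zero] at v
  have i1 : Integrable (fun z => ‖F (x + s • z) - Ps s F x‖ ^ 2) (gam d) :=
    (mF.sub (memLp_const _)).integrable_norm_pow (by norm_num)
  have i2 : Integrable (fun z => ‖rh F D x (s • z) - rb‖ ^ 2) (gam d) :=
    (mr.sub (memLp_const _)).integrable_norm_pow (by norm_num)
  have : ∫ z : V d, ‖∑ k, z k • (s • D k x)‖ ^ 2 ∂(gam d) ≤
      ∫ z, (2 * ‖F (x + s • z) - Ps s F x‖ ^ 2 + 2 * ‖rh F D x (s • z) - rb‖ ^ 2) ∂(gam d) := by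
    refine integral_mono (mL.integrable_norm_pow (by norm_num)) (by exact (i1.const_mul 2).add (i2.const_mul 2)) fun z => ?_
    have e2 : ∑ k, z k • (s • D k x) = (F (x + s • z) - Ps s F x) - (rh F D x (s • z) - rb) := by
      rw [rh, erb, ← e0]; abel
    simp only [e2]
    have := parallelogram_law_with_norm ℝ (F (x + s • z) - Ps s F x) (rh F D x (s • z) - rb)
    nlinarith [sq_nonneg ‖(F (x + s • z) - Ps s F x) + (rh F D x (s • z) - rb)‖]
  rw [integral_add (by exact i1.const_mul 2) (by exact i2.const_mul 2), integral_const_mul, integral_const_mul] at this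
  nlinarith [sq_nonneg ‖rb‖]

lemma var_upper {F : V d → X} {D : Fin d → V d → X} {M : ℝ} (hM : 0 ≤ M) (h : Good M F D) (s : ℝ) (x : V d) :
    ∫ z, ‖F (x + s • z) - Ps s F x‖ ^ 2 ∂(gam d) ≤ 2 * (s ^ 2 * ∑ k, ‖D k x‖ ^ 2)
      + 2 * ∫ z, ‖rh F D x (s • z)‖ ^ 2 ∂(gam d) := by
  have mF := Ps_memLp (h.cont hM) h.bd s x 2
  have mr := rh_memLp hM h s x
  have mL := lin_memLp (fun k => s • D k x)
  have e0 : ∀ z : V d, ∑ k, (s • z) k • D k x = ∑ k, z k • (s • D k x) := fun z => by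
    simp [smul_smul, mul_comm]
  have e1 : ∑ k, ‖s • D k x‖ ^ 2 = s ^ 2 * ∑ k, ‖D k x‖ ^ 2 := by
    simp [norm_smul, mul_pow, Finset.mul_sum]
  rw [← e1, ← gam_sum_sq]
  have v := var_le (gam d) mF (F x)
  have i1 : Integrable (fun z : V d => ‖∑ k, z k • (s • D k x)‖ ^ 2) (gam d) := mL.integrable_norm_pow (by norm_num)
  have i2 : Integrable (fun z => ‖rh F D x (s • z)‖ ^ 2) (gam d) := mr.integrable_norm_pow (by norm_num)
  have : ∫ z : V d, ‖F (x + s • z) - F x‖ ^ 2 ∂(gam d) ≤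
      ∫ z, (2 * ‖∑ k, z k • (s • D k x)‖ ^ 2 + 2 * ‖rh F D x (s • z)‖ ^ 2) ∂(gam d) := by
    refine integral_mono ((mF.sub (memLp_const _)).integrable_norm_pow (by norm_num)) (by exact (i1.const_mul 2).add (i2.const_mul 2)) fun z => ?_
    have e2 : F (x + s • z) - F x = (∑ k, z k • (s • D k x)) + rh F D x (s • z) := by
      rw [rh, ← e0]; abel
    simp only [e2]
    have := parallelogram_law_with_norm ℝ (∑ k, z k • (s • D k x)) (rh F D x (s • z))
    nlinarith [sq_nonneg ‖(∑ k, z k • (s • D k x)) - rh F D x (s • z)‖]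
  rw [integral_add (by exact i1.const_mul 2) (by exact i2.const_mul 2), integral_const_mul, integral_const_mul] at this
  change ∫ z, ‖F (x + s • z) - Ps s F x‖ ^ 2 ∂(gam d) + ‖Ps s F x - F x‖ ^ 2 = _ at v
  nlinarith [sq_nonneg ‖Ps s F x - F x‖]

lemma cube_upper {F : V d → X} {D : Fin d → V d → X} {M : ℝ} (hM : 0 ≤ M) (h : Good M F D) {s : ℝ} (hs : 0 ≤ s) (x : V d) :
    ∫ z, ‖F (x + s • z) - Ps s F x‖ ^ 3 ∂(gam d) ≤
      ∫ z, 4 * M * s * (‖z‖ + ∫ w, ‖w‖ ∂(gam d)) * ‖F (x + s • z) - F x‖ ^ 2 ∂(gam d)  ∧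
      Integrable (fun z => 4 * M * s * (‖z‖ + ∫ w, ‖w‖ ∂(gam d)) * ‖F (x + s • z) - F x‖ ^ 2) (gam d) := by
  have mF := Ps_memLp (h.cont hM) h.bd s x 
  set e := ∫ w, ‖w‖ ∂(gam d) with he
  have he0 : 0 ≤ e := integral_nonneg fun _ => norm_nonneg _
  have hcF := h.cont hM
  have i1 : Integrable (fun z : V d => ‖z‖) (gam d) := by simpa using gam_int_pow (d := d) 1
  have mA : ∀ p, MemLp (fun z => F (x + s • z) - F x) p (gam d) := fun p => (mF p).sub (memLp_const _)
  have lA : ∀ z, ‖F (x + s • z) - F x‖ ≤ M * s * ‖z‖ := fun z => by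
    have := h.lip x (s • z)
    rwa [norm_smul, Real.norm_of_nonneg hs, ← mul_assoc] at this
  have bA : ∀ z, ‖F (x + s • z) - F x‖ ≤ 2 * M := fun z => (norm_sub_le _ _).trans (by linarith [h.bd x, h.bd (x + s • z)])
  have iA2 : Integrable (fun z => ‖F (x + s • z) - F x‖ ^ 2) (gam d) := (mA 2).integrable_norm_pow (by norm_num)
  have iZA : Integrable (fun z => ‖z‖ * ‖F (x + s • z) - F x‖ ^ 2) (gam d) := by
    refine i1.mul_bdd (c := (2 * M) ^ 2) (by fun_prop) (ae_of_all _ fun z => ?_)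
    rw [norm_pow, norm_norm]; gcongr; exact bA z
  have iR : Integrable (fun z => 4 * M * s * (‖z‖ + e) * ‖F (x + s • z) - F x‖ ^ 2) (gam d) := by
    refine ((iZA.add (iA2.const_mul e)).const_mul (4 * M * s)).congr (ae_of_all _ fun z => ?_)
    simp only [Pi.add_apply]; ring
  refine ⟨?_, iR⟩
  set B := Ps s F x - F x with hB
  have eB : B = ∫ z, (F (x + s • z) - F x) ∂(gam d) := by
    rw [integral_sub ((mF 1).integrable le_rfl) (integrable_const _)]; simp [hB, Ps]
  have B1 : ‖B‖ ≤ M * s * e := by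
    rw [eB, he, ← integral_const_mul]
    exact norm_integral_le_of_norm_le (i1.const_mul _) (ae_of_all _ lA)
  have B2 : ‖B‖ ^ 2 ≤ ∫ z, ‖F (x + s • z) - F x‖ ^ 2 ∂(gam d) := by
    have v := var_le (gam d) (mA 2) 0
    rw [← eB] at v
    simp only [sub_zero] at v
    have : 0 ≤ ∫ z, ‖F (x + s • z) - F x - B‖ ^ 2 ∂(gam d) := integral_nonneg fun _ => by positivity
    linarith
  have B3 : ‖B‖ ^ 3 ≤ M * s * e * ∫ z, ‖F (x + s • z) - F x‖ ^ 2 ∂(gam d) := by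
    calc ‖B‖ ^ 3 = ‖B‖ * ‖B‖ ^ 2 := by ring
      _ ≤ _ := by gcongr
  calc ∫ z, ‖F (x + s • z) - Ps s F x‖ ^ 3 ∂(gam d)
      ≤ ∫ z, (4 * M * s * (‖z‖ * ‖F (x + s • z) - F x‖ ^ 2) + 4 * ‖B‖ ^ 3) ∂(gam d) := by
        refine integral_mono (((mF 3).sub (memLp_const _)).integrable_norm_pow (by norm_num))
          (by exact (iZA.const_mul _).add (integrable_const _)) fun z => ?_
        set A := F (x + s • z) - F x with hA
        have : F (x + s • z) - Ps s F x = A - B := by rw [hA, hB]; abel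
        simp only [this]
        have c1 : ‖A - B‖ ^ 3 ≤ (‖A‖ + ‖B‖) ^ 3 := by gcongr; exact norm_sub_le _ _
        have c2 : (‖A‖ + ‖B‖) ^ 3 ≤ 4 * (‖A‖ ^ 3 + ‖B‖ ^ 3) := by
          have := add_pow_le (norm_nonneg A) (norm_nonneg B) 3
          norm_num at this; linarith
        have c3 : ‖A‖ ^ 3 ≤ M * s * ‖z‖ * ‖A‖ ^ 2 := by
          rw [show ‖A‖ ^ 3 = ‖A‖ * ‖A‖ ^ 2 by ring]; gcongr; exact lA z
        linarith
    _ = 4 * M * s * ∫ z, ‖z‖ * ‖F (x + s • z) - F x‖ ^ 2 ∂(gam d) + 4 * ‖B‖ ^ 3 := by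
        rw [integral_add (by exact iZA.const_mul _) (integrable_const _), integral_const_mul]; simp
    _ ≤ 4 * M * s * ∫ z, ‖z‖ * ‖F (x + s • z) - F x‖ ^ 2 ∂(gam d)
        + 4 * M * s * e * ∫ z, ‖F (x + s • z) - F x‖ ^ 2 ∂(gam d) := by linarith
    _ = _ := by
        rw [← integral_const_mul, ← integral_const_mul, ← integral_add (by exact iZA.const_mul _) (by exact iA2.const_mul _)]
        congr 1; ext z; ring

end
end CR

namespace CR

section
variable {d : ℕ} {X : Type*} [NormedAddCommGroup X] [InnerProductSpace ℝ X] [CompleteSpace X]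

lemma theta_nonneg (x : X) : 0 ≤ √(1 + ‖x‖ ^ 2) - 1 := by
  have : 1 ≤ √(1 + ‖x‖ ^ 2) := Real.one_le_sqrt.2 (by nlinarith [sq_nonneg ‖x‖])
  linarith

lemma theta_le (x : X) : √(1 + ‖x‖ ^ 2) - 1 ≤ ‖x‖ := by
  have : √(1 + ‖x‖ ^ 2) ≤ 1 + ‖x‖ := Real.sqrt_le_iff.2 ⟨by positivity, by nlinarith [norm_nonneg x]⟩
  linarith

lemma bW_ge {C : ℝ} (hC : 0 ≤ C) (x : X) {y : ℝ} (hy : 0 ≤ y) : 1 - 1 / (1 + y) ≤ bW C x y := by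
  have h1 : (1 / (1 + y)) * (1 / (1 + ‖x‖ ^ 2) ^ 2) ≤ (1 / (1 + y)) * 1 := by
    gcongr
    rw [div_le_one (by positivity)]
    exact one_le_pow₀ (by nlinarith [sq_nonneg ‖x‖])
  have h2 := mul_nonneg hC (theta_nonneg x)
  rw [bW]; linarith

lemma bW_nonneg {C : ℝ} (hC : 0 ≤ C) (x : X) {y : ℝ} (hy : 0 ≤ y) : 0 ≤ bW C x y := by
  have h := bW_ge hC x hy
  have : 1 / (1 + y) ≤ 1 := by rw [div_le_one (by positivity)]; linarith
  linarith

lemma bW_le {C : ℝ} (hC : 0 ≤ C) (x : X) {y : ℝ} (hy : 0 ≤ y) : bW C x y ≤ 1 + C * ‖x‖ := by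
  have h1 : 0 ≤ (1 / (1 + y)) * (1 / (1 + ‖x‖ ^ 2) ^ 2) := by positivity
  have h2 := mul_le_mul_of_nonneg_left (theta_le x) hC
  rw [bW]; linarith

lemma bW_cont {T : Type*} [TopologicalSpace T] {C : ℝ} {a : T → X} {u : T → ℝ} (ha : Continuous a) (hu : Continuous u) (hu0 : ∀ x, 0 ≤ u x) :
    Continuous (fun x => bW C (a x) (u x)) := by
  unfold bW
  refine Continuous.add (continuous_const.sub (Continuous.mul ?_ ?_)) (by fun_prop)
  · exact continuous_const.div (by fun_prop) fun x => by have := hu0 x; positivity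
  · exact continuous_const.div (by fun_prop) fun x => by positivity

/-- error term of one step -/
def errT (M s : ℝ) (a : V d → X) (Da : Fin d → V d → X) (u : V d → ℝ) (Du : Fin d → V d → ℝ) (x z : V d) : ℝ :=
  8 * d * ‖rh a Da x (s • z)‖ ^ 2 + 4 * ‖rh u Du x (s • z)‖ ^ 2 +
    (27 + 2 * (4 * d)) * (4 * M * s * (‖z‖ + ∫ w, ‖w‖ ∂(gam d)) * ‖a (x + s • z) - a x‖ ^ 2)

lemma step_pt {M : ℝ} (hM : 0 ≤ M) {a : V d → X} {Da : Fin d → V d → X} {u : V d → ℝ} {Du : Fin d → V d → ℝ}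
    (ha : Good M a Da) (hu : Good M u Du) (hu0 : ∀ x, 0 ≤ u x)
    (hrel : ∀ x, ∑ k, ‖Du k x‖ ^ 2 ≤ d * ∑ k, ‖Da k x‖ ^ 2) {s : ℝ} (hs : 0 ≤ s) (x : V d) :
    bW (4 * (4 * d) + 38) (Ps s a x) (Ps s u x) ≤
      ∫ z, (bW (4 * (4 * d) + 38) (a (x + s • z)) (u (x + s • z)) + errT M s a Da u Du x z) ∂(gam d) ∧
    Integrable (fun z => bW (4 * (4 * d) + 38) (a (x + s • z)) (u (x + s • z)) + errT M s a Da u Du x z) (gam d) := by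
  set K : ℝ := 4 * d with hK
  have hK0 : 0 ≤ K := by positivity
  set C : ℝ := 4 * K + 38 with hC
  have hC0 : 0 ≤ C := by positivity
  have mFa := Ps_memLp (ha.cont hM) ha.bd s x
  have mFu := Ps_memLp (hu.cont hM) hu.bd s x
  have ub0 : 0 ≤ Ps s u x := integral_nonneg fun z => hu0 _
  obtain ⟨hcub, iE3⟩ := cube_upper hM ha hs x
  have iE1 : Integrable (fun z => ‖rh a Da x (s • z)‖ ^ 2) (gam d) := (rh_memLp hM ha s x).integrable_norm_pow (by norm_num)
  have iE2 : Integrable (fun z => ‖rh u Du x (s • z)‖ ^ 2) (gam d) := (rh_memLp hM hu s x).integrable_norm_pow (by norm_num)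
  have iW : Integrable (fun z => bW C (a (x + s • z)) (u (x + s • z))) (gam d) := by
    refine Integrable.of_bound (C := 1 + C * M) ?_ (ae_of_all _ fun z => ?_)
    · have hac := ha.cont hM
      have huc := hu.cont hM
      exact (bW_cont (by fun_prop) (by fun_prop) fun z => hu0 _).aestronglyMeasurable
    · rw [Real.norm_of_nonneg (bW_nonneg hC0 _ (hu0 _))]
      refine (bW_le hC0 _ (hu0 _)).trans ?_
      gcongr; exact ha.bd _
  have iErr : Integrable (fun z => errT M s a Da u Du x z) (gam d) := by
    exact ((iE1.const_mul _).add (iE2.const_mul _)).add (iE3.const_mul _)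
  refine ⟨?_, iW.add iErr⟩
  rw [integral_add iW iErr]
  have eErr : ∫ z, errT M s a Da u Du x z ∂(gam d) = 8 * d * ∫ z, ‖rh a Da x (s • z)‖ ^ 2 ∂(gam d)
     + 4 * ∫ z, ‖rh u Du x (s • z)‖ ^ 2 ∂(gam d) + (27 + 2 * K) * ∫ z, 4 * M * s * (‖z‖ + ∫ w, ‖w‖ ∂(gam d)) * ‖a (x + s • z) - a x‖ ^ 2 ∂(gam d) := by
    unfold errT
    rw [integral_add (by exact (iE1.const_mul _).add (iE2.const_mul _)) (by exact iE3.const_mul _),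
      integral_add (by exact iE1.const_mul _) (by exact iE2.const_mul _), integral_const_mul, integral_const_mul, integral_const_mul]
  rw [eErr]
  obtain ⟨α, β, m, hm0, hm1, H⟩ := bW_taylor K hK0 (Ps s a x) (Ps s u x) ub0
  set ab := Ps s a x with hab
  set ub := Ps s u x with hub
  have ia := (mFa 1).integrable le_rfl
  have iu := (mFu 1).integrable le_rfl
  have i1 : Integrable (fun z => ⟪ab, a (x + s • z) - ab⟫) (gam d) :=
    (innerSL ℝ ab).integrable_comp (ia.sub (integrable_const ab))
  have i2 : Integrable (fun z => u (x + s • z) - ub) (gam d) := iu.sub (integrable_const ub)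
  have i3 : Integrable (fun z => ‖a (x + s • z) - ab‖ ^ 2) (gam d) :=
    ((mFa 2).sub (memLp_const _)).integrable_norm_pow (by norm_num)
  have i4 : Integrable (fun z => ‖u (x + s • z) - ub‖ ^ 2) (gam d) :=
    ((mFu 2).sub (memLp_const _)).integrable_norm_pow (by norm_num)
  have i5 : Integrable (fun z => ‖a (x + s • z) - ab‖ ^ 3) (gam d) :=
    ((mFa 3).sub (memLp_const _)).integrable_norm_pow (by norm_num)
  have z1 : ∫ z, ⟪ab, a (x + s • z) - ab⟫ ∂(gam d) = 0 := by
    rw [integral_inner (by exact ia.sub (integrable_const _)), integral_sub ia (integrable_const _)]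
    simp [hab, Ps]
  have z2 : ∫ z, (u (x + s • z) - ub) ∂(gam d) = 0 := by
    rw [integral_sub iu (integrable_const _)]
    simp [hub, Ps]
  have hI : ∫ z, (bW C ab ub + (α * ⟪ab, a (x + s • z) - ab⟫ + β * (u (x + s • z) - ub))
      + (2 * m * K * ‖a (x + s • z) - ab‖ ^ 2 - 2 * m * ‖u (x + s • z) - ub‖ ^ 2)
      - (27 + 2 * K) * ‖a (x + s • z) - ab‖ ^ 3) ∂(gam d) ≤ ∫ z, bW C (a (x + s • z)) (u (x + s • z)) ∂(gam d) := by
    refine integral_mono ?_ iW fun z => ?_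
    · exact (((integrable_const _).add ((i1.const_mul _).add (i2.const_mul _))).add ((i3.const_mul _).sub (i4.const_mul _))).sub (i5.const_mul _)
    · have := H (a (x + s • z)) (u (x + s • z)) (hu0 _)
      simp only [Real.norm_eq_abs, sq_abs]
      linarith
  rw [integral_sub (by exact ((integrable_const _).add ((i1.const_mul _).add (i2.const_mul _))).add ((i3.const_mul _).sub (i4.const_mul _))) (by exact i5.const_mul _),
    integral_add (by exact (integrable_const _).add ((i1.const_mul _).add (i2.const_mul _))) (by exact (i3.const_mul _).sub (i4.const_mul _)),
    integral_add (integrable_const _) (by exact (i1.const_mul _).add (i2.const_mul _)),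
    integral_add (by exact i1.const_mul _) (by exact i2.const_mul _),
    integral_sub (by exact i3.const_mul _) (by exact i4.const_mul _)] at hI
  simp only [integral_const_mul, z1, z2, integral_const, probReal_univ, one_smul, mul_zero, add_zero] at hI
  have v1 := var_lower hM ha s x
  have v2 := var_upper hM hu s x
  rw [← hab] at v1
  rw [← hub] at v2
  set VA := ∫ z, ‖a (x + s • z) - ab‖ ^ 2 ∂(gam d)
  set VU := ∫ z, ‖u (x + s • z) - ub‖ ^ 2 ∂(gam d)
  set RA := ∫ z, ‖rh a Da x (s • z)‖ ^ 2 ∂(gam d) with hRA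
  set RU := ∫ z, ‖rh u Du x (s • z)‖ ^ 2 ∂(gam d) with hRU
  have RA0 : 0 ≤ RA := integral_nonneg fun _ => by positivity
  have RU0 : 0 ≤ RU := integral_nonneg fun _ => by positivity
  have v3 : VU ≤ K * VA + 4 * d * RA + 2 * RU := by
    have := mul_le_mul_of_nonneg_left (hrel x) (sq_nonneg s)
    have := mul_le_mul_of_nonneg_left v1 (Nat.cast_nonneg (α := ℝ) d)
    rw [hK]; linarith
  have v4 : m * (VU - K * VA) ≤ 4 * d * RA + 2 * RU := by
    rcases le_total (VU - K * VA) 0 with h0 | h0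
    · have := mul_nonpos_of_nonneg_of_nonpos hm0 h0
      have : 0 ≤ 4 * d * RA + 2 * RU := by positivity
      linarith
    · have := mul_le_mul_of_nonneg_right hm1 h0
      linarith
  have v5 := mul_le_mul_of_nonneg_left hcub (show 0 ≤ 27 + 2 * K by positivity)
  linarith

end
end CR

namespace CR

section
variable {d : ℕ} {X : Type*} [NormedAddCommGroup X] [InnerProductSpace ℝ X] [CompleteSpace X]

lemma ofReal_sq_norm {Z : Type*} [NormedAddCommGroup Z] (z : Z) : ENNReal.ofReal (‖z‖ ^ 2) = ‖z‖ₑ ^ 2 := by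
  rw [ENNReal.ofReal_pow (norm_nonneg _), ofReal_norm]

/-- squared `L²` bound for averages -/
lemma Ps_sq {H : V d → X} (hH : Continuous H) (s : ℝ) :
    ∫⁻ x, ‖Ps s H x‖ₑ ^ 2 ≤ ∫⁻ x, ‖H x‖ₑ ^ 2 := by
  have h1 : ∀ x, ‖Ps s H x‖ₑ ^ 2 ≤ ∫⁻ z, ‖H (x + s • z)‖ₑ ^ 2 ∂(gam d) := fun x => by
    have h2 : ‖Ps s H x‖ₑ ≤ ∫⁻ z, ‖H (x + s • z)‖ₑ ∂(gam d) := enorm_integral_le_lintegral_enorm _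
    have h3 := lint_sq (gam d) (f := fun z => ‖H (x + s • z)‖ₑ) (by fun_prop)
    rw [measure_univ, one_mul] at h3
    exact le_trans (by gcongr) h3
  refine (lintegral_mono h1).trans ?_
  rw [lintegral_lintegral_swap (by fun_prop)]
  have : ∀ z : V d, ∫⁻ x, ‖H (x + s • z)‖ₑ ^ 2 = ∫⁻ x, ‖H x‖ₑ ^ 2 := fun z =>
    lintegral_add_right_eq_self (fun x => ‖H x‖ₑ ^ 2) (s • z)
  simp only [this, lintegral_const, measure_univ, mul_one, le_refl]

lemma Ps_bd {F : V d → X} {M : ℝ} (hM : ∀ x, ‖F x‖ ≤ M) (s : ℝ) (x : V d) : ‖Ps s F x‖ ≤ M := by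
  refine (norm_integral_le_of_norm_le_const (ae_of_all _ fun z => hM _)).trans ?_
  simp

lemma Ps_sub {F G : V d → X} {M N : ℝ} (hF : Continuous F) (hM : ∀ x, ‖F x‖ ≤ M) (hG : Continuous G) (hN : ∀ x, ‖G x‖ ≤ N) (s : ℝ) (x : V d) :
    Ps s F x - Ps s G x = Ps s (fun x => F x - G x) x := by
  rw [Ps, Ps, Ps, integral_sub ((Ps_memLp hF hM s x 1).integrable le_rfl) ((Ps_memLp hG hN s x 1).integrable le_rfl)]

lemma Ps_shift {F : V d → X} (s : ℝ) (x z : V d) : Ps s F (x + z) = Ps s (fun x => F (x + z)) x := by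
  simp only [Ps, add_right_comm]

lemma Good.Ps {F : V d → X} {D : Fin d → V d → X} {M : ℝ} (hM : 0 ≤ M) (h : Good M F D) (s : ℝ) :
    Good M (CR.Ps s F) (fun k => CR.Ps s (D k)) := by
  have cF := h.cont hM
  have cD := h.contD hM
  have e1 : ∀ x z, CR.Ps s F (x + z) - CR.Ps s F x = CR.Ps s (fun x => F (x + z) - F x) x := fun x z => by
    rw [Ps_shift, Ps_sub (M := M) (N := M) (by fun_prop) (fun x => h.bd _) cF h.bd]
  have e2 : ∀ k x z, CR.Ps s (D k) (x + z) - CR.Ps s (D k) x = CR.Ps s (fun x => D k (x + z) - D k x) x := fun k x z => by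
    have := cD k
    rw [Ps_shift, Ps_sub (M := M) (N := M) (by fun_prop) (fun x => h.bdD k _) (cD k) (h.bdD k)]
  have e3 : ∀ x (z : V d), ∑ k, z k • CR.Ps s (D k) x = CR.Ps s (fun x => ∑ k, z k • D k x) x := fun x z => by
    simp only [CR.Ps, ← integral_smul]
    rw [integral_finsetSum _ fun k _ => by exact ((Ps_memLp (cD k) (h.bdD k) s x 1).integrable le_rfl).smul (z k)]
  have e4 : ∀ x (z : V d), CR.Ps s F (x + z) - CR.Ps s F x - ∑ k, z k • CR.Ps s (D k) x
      = CR.Ps s (fun x => F (x + z) - F x - ∑ k, z k • D k x) x := fun x z => by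
    rw [e1, e3, Ps_sub (M := 2 * M) (N := ∑ k, ‖z k‖ * M) (by fun_prop) _ (by fun_prop) _]
    · exact fun x => (norm_sub_le _ _).trans (by linarith [h.bd x, h.bd (x + z)])
    · intro x
      refine norm_sum_le_of_le _ fun k _ => ?_
      rw [norm_smul]
      gcongr; exact h.bdD k x
  refine ⟨Ps_bd h.bd s, fun k => Ps_bd (h.bdD k) s, fun x z => ?_, fun k x z => ?_, fun z => ?_, fun z => ?_⟩
  · rw [e1]; exact Ps_bd (fun x => h.lip x z) s x
  · rw [e2]; exact Ps_bd (fun x => h.lipD k x z) s x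
  · simp only [e1]
    exact (Ps_sq (by fun_prop) s).trans (h.inc z)
  · simp only [e4]
    exact (Ps_sq (by fun_prop) s).trans (h.rem z)

lemma step_int {M : ℝ} (hM : 0 ≤ M) : ∃ C1 : ℝ, 0 ≤ C1 ∧ ∀ {a : V d → X} {Da : Fin d → V d → X} {u : V d → ℝ} {Du : Fin d → V d → ℝ}
    (_ : Good M a Da) (_ : Good M u Du) (_ : ∀ x, 0 ≤ u x)
    (_ : ∀ x, ∑ k, ‖Du k x‖ ^ 2 ≤ d * ∑ k, ‖Da k x‖ ^ 2) {s : ℝ} (_ : 0 ≤ s) (_ : s ≤ 1),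
    ∫⁻ x, ENNReal.ofReal (bW (4 * (4 * d) + 38) (Ps s a x) (Ps s u x)) ≤
      (∫⁻ x, ENNReal.ofReal (bW (4 * (4 * d) + 38) (a x) (u x))) + ENNReal.ofReal (C1 * s ^ 3) := by
  set e := ∫ w, ‖w‖ ∂(gam d) with he
  have he0 : 0 ≤ e := integral_nonneg fun _ => norm_nonneg _
  set c : ℝ := (27 + 2 * (4 * d)) * (4 * M) with hc
  have hc0 : 0 ≤ c := by positivity
  set p : V d → ℝ := fun z => (8 * d + 4) * M * ‖z‖ ^ 4 + c * M * (‖z‖ ^ 3 + e * ‖z‖ ^ 2) with hp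
  have hp0 : ∀ z, 0 ≤ p z := fun z => by positivity
  have hpi : Integrable p (gam d) :=
    ((gam_int_pow 4).const_mul _).add (((gam_int_pow 3).add ((gam_int_pow 2).const_mul e)).const_mul _)
  refine ⟨∫ z, p z ∂(gam d), integral_nonneg hp0, ?_⟩
  intro a Da u Du ha hu hu0 hrel s hs hs1
  set C : ℝ := 4 * (4 * d) + 38 with hC
  have hC0 : 0 ≤ C := by positivity
  have ca := ha.cont hM
  have cu := hu.cont hM
  have cDa := ha.contD hM
  have cDu := hu.contD hM
  have err0 : ∀ x z, 0 ≤ errT M s a Da u Du x z := fun x z => by unfold errT; positivity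
  have W0 : ∀ x, 0 ≤ bW C (a x) (u x) := fun x => bW_nonneg hC0 _ (hu0 _)
  have cW : Continuous (fun x => bW C (a x) (u x)) := bW_cont ca cu hu0
  have cW2 : Continuous (fun q : V d × V d => bW C (a (q.1 + s • q.2)) (u (q.1 + s • q.2))) := cW.comp (by fun_prop)
  have cE2 : Continuous (fun q : V d × V d => errT M s a Da u Du q.1 q.2) := by
    unfold errT rh; fun_prop
  have h1 : ∀ x, ENNReal.ofReal (bW C (Ps s a x) (Ps s u x)) ≤
      ∫⁻ z, (ENNReal.ofReal (bW C (a (x + s • z)) (u (x + s • z))) + ENNReal.ofReal (errT M s a Da u Du x z)) ∂(gam d) := fun x => by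
    obtain ⟨h, hi⟩ := step_pt hM ha hu hu0 hrel hs x
    refine (ENNReal.ofReal_le_ofReal h).trans ?_
    rw [ofReal_integral_eq_lintegral_ofReal hi (ae_of_all _ fun z => add_nonneg (W0 _) (err0 x z))]
    refine lintegral_mono fun z => ?_
    rw [ENNReal.ofReal_add (W0 _) (err0 x z)]
  refine (lintegral_mono h1).trans ?_
  rw [lintegral_lintegral_swap (by
    exact ((ENNReal.continuous_ofReal.comp cW2).measurable.add (ENNReal.continuous_ofReal.comp cE2).measurable).aemeasurable)]
  have h2 : ∀ z, ∫⁻ x, (ENNReal.ofReal (bW C (a (x + s • z)) (u (x + s • z))) + ENNReal.ofReal (errT M s a Da u Du x z))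
      ≤ (∫⁻ x, ENNReal.ofReal (bW C (a x) (u x))) + ENNReal.ofReal (s ^ 3 * p z) := fun z => by
    rw [lintegral_add_right _ (by
      exact (ENNReal.continuous_ofReal.comp (cE2.comp (Continuous.prodMk_left z))).measurable),
      lintegral_add_right_eq_self (fun x => ENNReal.ofReal (bW C (a x) (u x))) (s • z)]
    gcongr
    have h3 : ∀ x, ENNReal.ofReal (errT M s a Da u Du x z) = ENNReal.ofReal (8 * d) * ‖rh a Da x (s • z)‖ₑ ^ 2
        + 4 * ‖rh u Du x (s • z)‖ₑ ^ 2 + ENNReal.ofReal (c * s * (‖z‖ + e)) * ‖a (x + s • z) - a x‖ₑ ^ 2 := fun x => by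
      simp only [← ofReal_sq_norm]
      rw [show (4:ℝ≥0∞) = ENNReal.ofReal 4 by norm_num, ← ENNReal.ofReal_mul (by positivity),
        ← ENNReal.ofReal_mul (by positivity), ← ENNReal.ofReal_mul (by positivity),
        ← ENNReal.ofReal_add (by positivity) (by positivity), ← ENNReal.ofReal_add (by positivity) (by positivity)]
      congr 1
      rw [errT, hc]; ring
    simp only [h3]
    have mq1 : Measurable fun x => ‖rh a Da x (s • z)‖ₑ ^ 2 :=
      (show Continuous fun x => rh a Da x (s • z) by unfold rh; fun_prop).enorm.measurable.pow_const 2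
    have mq2 : Measurable fun x => ‖rh u Du x (s • z)‖ₑ ^ 2 :=
      (show Continuous fun x => rh u Du x (s • z) by unfold rh; fun_prop).enorm.measurable.pow_const 2
    rw [lintegral_add_left (by exact (mq1.const_mul _).add (mq2.const_mul _)), lintegral_add_left (by exact mq1.const_mul _),
      lintegral_const_mul' _ _ ENNReal.ofReal_ne_top, lintegral_const_mul' _ _ (by norm_num),
      lintegral_const_mul' _ _ ENNReal.ofReal_ne_top]
    calc _ ≤ ENNReal.ofReal (8 * d) * ENNReal.ofReal (M * ‖s • z‖ ^ 4) + 4 * ENNReal.ofReal (M * ‖s • z‖ ^ 4)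
          + ENNReal.ofReal (c * s * (‖z‖ + e)) * ENNReal.ofReal (M * ‖s • z‖ ^ 2) := by
          gcongr
          · exact ha.rem _
          · exact hu.rem _
          · exact ha.inc _
      _ = ENNReal.ofReal (8 * d * (M * ‖s • z‖ ^ 4) + 4 * (M * ‖s • z‖ ^ 4) + (c * s * (‖z‖ + e)) * (M * ‖s • z‖ ^ 2)) := by
          rw [show (4:ℝ≥0∞) = ENNReal.ofReal 4 by norm_num, ← ENNReal.ofReal_mul (by positivity),
            ← ENNReal.ofReal_mul (by positivity), ← ENNReal.ofReal_mul (by positivity),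
            ← ENNReal.ofReal_add (by positivity) (by positivity), ← ENNReal.ofReal_add (by positivity) (by positivity)]
      _ ≤ _ := by
          apply ENNReal.ofReal_le_ofReal
          rw [norm_smul, Real.norm_of_nonneg hs, hp]
          have h4 : s ^ 4 ≤ s ^ 3 := pow_le_pow_of_le_one hs hs1 (by norm_num)
          have h5 := mul_le_mul_of_nonneg_right h4 (show 0 ≤ (8 * d + 4) * M * ‖z‖ ^ 4 by positivity)
          calc _ = s ^ 4 * ((8 * d + 4) * M * ‖z‖ ^ 4) + s ^ 3 * (c * M * (‖z‖ ^ 3 + e * ‖z‖ ^ 2)) := by ring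
            _ ≤ s ^ 3 * ((8 * d + 4) * M * ‖z‖ ^ 4) + s ^ 3 * (c * M * (‖z‖ ^ 3 + e * ‖z‖ ^ 2)) := by linarith
            _ = _ := by ring
  refine (lintegral_mono h2).trans ?_
  rw [lintegral_add_left measurable_const, lintegral_const, measure_univ, mul_one]
  gcongr
  rw [← ofReal_integral_eq_lintegral_ofReal (hpi.const_mul _) (ae_of_all _ fun z => mul_nonneg (by positivity) (hp0 z)), integral_const_mul, mul_comm]

lemma gam_conv (s t : ℝ) : ((gam d).map (fun z => s • z)).conv ((gam d).map (fun z => t • z))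
    = (gam d).map (fun z => √(s ^ 2 + t ^ 2) • z) := by
  apply Measure.ext_of_charFun
  ext ξ
  have h1 : ∀ r : ℝ, IsProbabilityMeasure ((gam d).map (fun z : V d => r • z)) := fun r =>
    Measure.isProbabilityMeasure_map (by fun_prop)
  have := h1 s
  have := h1 t
  rw [charFun_conv, charFun_map_smul, charFun_map_smul, charFun_map_smul,
    ProbabilityTheory.charFun_stdGaussian, ProbabilityTheory.charFun_stdGaussian, ProbabilityTheory.charFun_stdGaussian,
    ← Complex.exp_add]
  congr 1
  simp only [norm_smul, Real.norm_eq_abs]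
  norm_cast
  simp only [mul_pow, sq_abs, Real.sq_sqrt (add_nonneg (sq_nonneg s) (sq_nonneg t))]
  ring

lemma Ps_Ps {F : V d → X} {M : ℝ} (hF : Continuous F) (hM : ∀ x, ‖F x‖ ≤ M) (s t : ℝ) (x : V d) :
    Ps s (Ps t F) x = Ps √(s ^ 2 + t ^ 2) F x := by
  have h1 : ∀ r : ℝ, IsProbabilityMeasure ((gam d).map (fun z : V d => r • z)) := fun r =>
    Measure.isProbabilityMeasure_map (by fun_prop)
  have := h1 s
  have := h1 t
  have e : ∀ (G : V d → X) (hG : Continuous G) (r : ℝ) (y : V d), Ps r G y = ∫ z, G (y + z) ∂((gam d).map (fun z => r • z)) := fun G hG r y => by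
    rw [integral_map (by fun_prop) (by fun_prop)]; rfl
  have hc : Continuous (Ps t F) := by
    refine continuous_of_dominated (bound := fun _ => M) (fun x => by fun_prop) (fun x => ae_of_all _ fun z => hM _) (integrable_const _)
      (ae_of_all _ fun z => by fun_prop)
  rw [e _ hF, ← gam_conv, e _ hc, integral_conv]
  · refine integral_congr_ae (ae_of_all _ fun z => ?_)
    simp only [e F hF, add_assoc]
  · have := h1 √(s ^ 2 + t ^ 2)
    rw [gam_conv]
    exact Integrable.of_bound (by fun_prop) M (ae_of_all _ fun z => hM _)

end
end CR

namespace CR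

/-- matrices with Euclidean norm -/
abbrev W (d : ℕ) := PiLp 2 (fun _ : Fin d => V d)

section
variable {d : ℕ}

/-- entry as a continuous linear map -/
def ent (i j : Fin d) : W d →L[ℝ] ℝ :=
  (EuclideanSpace.proj (𝕜 := ℝ) j : V d →L[ℝ] ℝ).comp (PiLp.proj 2 (fun _ : Fin d => V d) i)

lemma ent_apply (i j : Fin d) (w : W d) : ent i j w = w i j := rfl

lemma norm_W (w : W d) : ‖w‖ ^ 2 = ∑ i, ∑ j, (w i j) ^ 2 := by
  rw [PiLp.norm_sq_eq_of_L2]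
  simp [EuclideanSpace.real_norm_sq_eq]

lemma rel_sq {Da : Fin d → W d} {Du : Fin d → ℝ} (h : ∀ i, Du i = ∑ j, ent i j (Da j)) :
    ∑ k, ‖Du k‖ ^ 2 ≤ d * ∑ k, ‖Da k‖ ^ 2 := by
  have h1 : ∀ i, ‖Du i‖ ^ 2 ≤ d * ∑ j, ∑ l, ((Da j) i l) ^ 2 := fun i => by
    rw [Real.norm_eq_abs, sq_abs, h i]
    refine (sq_sum_le_card_mul_sum_sq).trans ?_
    simp only [Finset.card_univ, Fintype.card_fin]
    gcongr with j _
    rw [ent_apply]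
    exact Finset.single_le_sum (f := fun l => ((Da j) i l) ^ 2) (fun l _ => sq_nonneg _) (Finset.mem_univ j)
  refine (Finset.sum_le_sum fun i _ => h1 i).trans ?_
  rw [← Finset.mul_sum, Finset.sum_comm]
  simp only [norm_W, le_refl]

lemma Ps_zero {Y : Type*} [NormedAddCommGroup Y] [InnerProductSpace ℝ Y] [CompleteSpace Y] (F : V d → Y) : Ps 0 F = F := by
  ext x; simp [Ps]

lemma flow {M : ℝ} (hM : 0 ≤ M) {a : V d → W d} {Da : Fin d → V d → W d} {u : V d → ℝ} {Du : Fin d → V d → ℝ}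
    (ha : Good M a Da) (hu : Good M u Du) (hu0 : ∀ x, 0 ≤ u x)
    (hrel : ∀ x i, Du i x = ∑ j, ent i j (Da j x)) :
    ∫⁻ x, ENNReal.ofReal (bW (4 * (4 * d) + 38) (Ps 1 a x) (Ps 1 u x)) ≤
      ∫⁻ x, ENNReal.ofReal (bW (4 * (4 * d) + 38) (a x) (u x)) := by
  obtain ⟨C1, hC1, H⟩ := step_int (d := d) (X := W d) hM
  have key : ∀ (s : ℝ), 0 ≤ s → s ≤ 1 → ∀ n : ℕ,
      ∫⁻ x, ENNReal.ofReal (bW (4 * (4 * d) + 38) (Ps (√n * s) a x) (Ps (√n * s) u x)) ≤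
      (∫⁻ x, ENNReal.ofReal (bW (4 * (4 * d) + 38) (a x) (u x))) + ENNReal.ofReal (n * (C1 * s ^ 3)) := by
    intro s hs hs1 n
    induction n with
    | zero => simp [Ps_zero]
    | succ n ih =>
      have h1 := H (ha.Ps hM (√n * s)) (hu.Ps hM (√n * s)) (fun x => integral_nonneg fun z => hu0 _)
        (fun x => rel_sq fun i => by
          simp only [Ps, hrel]
          rw [integral_finsetSum _ fun j _ => ?_]
          · refine Finset.sum_congr rfl fun j _ => ?_
            exact (ent i j).integral_comp_comm ((Ps_memLp (ha.contD hM j) (ha.bdD j) _ _ 1).integrable le_rfl)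
          · exact (ent i j).integrable_comp ((Ps_memLp (ha.contD hM j) (ha.bdD j) _ _ 1).integrable le_rfl)) hs hs1
      have e : √(s ^ 2 + (√n * s) ^ 2) = √((n + 1 : ℕ) : ℝ) * s := by
        rw [mul_pow, Real.sq_sqrt (Nat.cast_nonneg n), show s ^ 2 + n * s ^ 2 = ((n + 1 : ℕ) : ℝ) * s ^ 2 by push_cast; ring,
          Real.sqrt_mul (by positivity), Real.sqrt_sq hs]
      simp only [Ps_Ps (ha.cont hM) ha.bd, Ps_Ps (hu.cont hM) hu.bd, e] at h1
      refine h1.trans ((add_le_add_left ih _).trans ?_)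
      rw [add_assoc, ← ENNReal.ofReal_add (by positivity) (by positivity)]
      gcongr
      push_cast; linarith
  have key2 : ∀ n : ℕ, ∫⁻ x, ENNReal.ofReal (bW (4 * (4 * d) + 38) (Ps 1 a x) (Ps 1 u x)) ≤
      (∫⁻ x, ENNReal.ofReal (bW (4 * (4 * d) + 38) (a x) (u x))) + ENNReal.ofReal (C1 * (1 / √((n : ℝ) + 1))) := fun n => by
    have hn : 0 < √((n:ℝ) + 1) := Real.sqrt_pos.2 (by positivity)
    have hn1 : 1 ≤ √((n:ℝ) + 1) := Real.one_le_sqrt.2 (by simp)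
    have h := key (1 / √((n : ℝ) + 1)) (by positivity) (by rw [div_le_one hn]; exact hn1) (n + 1)
    have e1 : √((n + 1 : ℕ) : ℝ) * (1 / √((n : ℝ) + 1)) = 1 := by push_cast; field_simp
    rw [e1] at h
    refine h.trans (add_le_add_right (ENNReal.ofReal_le_ofReal ?_) _)
    have e2 : ((n + 1 : ℕ) : ℝ) = √((n:ℝ) + 1) ^ 2 := by rw [Real.sq_sqrt (by positivity)]; push_cast; ring
    rw [e2]
    apply le_of_eq
    field_simp
  have lim : Tendsto (fun n : ℕ => (∫⁻ x, ENNReal.ofReal (bW (4 * (4 * d) + 38) (a x) (u x))) + ENNReal.ofReal (C1 * (1 / √((n : ℝ) + 1)))) atTop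
      (𝓝 ((∫⁻ x, ENNReal.ofReal (bW (4 * (4 * d) + 38) (a x) (u x))) + ENNReal.ofReal (C1 * 0))) := by
    refine Tendsto.const_add _ (ENNReal.tendsto_ofReal (Tendsto.const_mul _ ?_))
    refine tendsto_const_nhds.div_atTop (Real.tendsto_sqrt_atTop.comp ?_)
    exact tendsto_atTop_add_const_right _ _ tendsto_natCast_atTop_atTop
  have := ge_of_tendsto' lim key2
  simpa using this

end
end CR

namespace CR

section
variable {d : ℕ} {Y : Type*} [NormedAddCommGroup Y] [InnerProductSpace ℝ Y] [CompleteSpace Y]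

/-- mollifier -/
structure Moll (s : ℝ) (φ : V d → ℝ) : Prop where
  smooth : ContDiff ℝ 2 φ
  nonneg : ∀ x, 0 ≤ φ x
  even : ∀ x, φ (-x) = φ x
  int : ∫ x, φ x = 1
  supp : tsupport φ ⊆ closedBall 0 s

lemma exists_moll {s : ℝ} (hs : 0 < s) : ∃ φ : V d → ℝ, Moll s φ := by
  let b : ContDiffBump (0 : V d) := ⟨s / 2, s, by linarith, by linarith⟩
  exact ⟨b.normed volume, b.contDiff_normed, b.nonneg_normed, b.normed_neg, b.integral_normed, by rw [b.tsupport_normed_eq]⟩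

variable {s : ℝ} {φ : V d → ℝ}

lemma Moll.hcs (h : Moll s φ) : HasCompactSupport φ :=
  HasCompactSupport.of_support_subset_isCompact (isCompact_closedBall 0 s) ((subset_tsupport φ).trans h.supp)

lemma Moll.cont (h : Moll s φ) : Continuous φ := h.smooth.continuous

lemma Moll.integrable (h : Moll s φ) : Integrable φ := h.cont.integrable_of_hasCompactSupport h.hcs

lemma Moll.lint (h : Moll s φ) : ∫⁻ x, ENNReal.ofReal (φ x) = 1 := by
  rw [← ofReal_integral_eq_lintegral_ofReal h.integrable (ae_of_all _ h.nonneg), h.int, ENNReal.ofReal_one]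

lemma Moll.lint' (h : Moll s φ) (x : V d) : ∫⁻ y, ENNReal.ofReal (φ (x - y)) = 1 := by
  rw [lintegral_sub_left_eq_self (fun y => ENNReal.ofReal (φ y)) x, h.lint]

lemma Moll.lint'' (h : Moll s φ) (y : V d) : ∫⁻ x, ENNReal.ofReal (φ (x - y)) = 1 := by
  rw [lintegral_sub_right_eq_self (fun y => ENNReal.ofReal (φ y)) y, h.lint]

lemma Moll.bdd (h : Moll s φ) : ∃ c : ℝ, 0 ≤ c ∧ ∀ x, φ x ≤ c := by
  obtain ⟨c, hc⟩ := h.cont.bounded_above_of_compact_support h.hcs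
  exact ⟨c, (norm_nonneg _).trans (hc 0), fun x => (le_abs_self _).trans (hc x)⟩

lemma Moll.meas (h : Moll s φ) (x : V d) : Measurable fun y => ENNReal.ofReal (φ (x - y)) := by
  have := h.cont
  exact (ENNReal.continuous_ofReal.comp (by fun_prop : Continuous fun y => φ (x - y))).measurable

lemma young_one_pt (h : Moll s φ) (B : V d → Y) (x : V d) :
    ‖cv φ B x‖ₑ ≤ ∫⁻ y, ENNReal.ofReal (φ (x - y)) * ‖B y‖ₑ := by
  refine (enorm_integral_le_lintegral_enorm _).trans (le_of_eq ?_)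
  refine lintegral_congr fun y => ?_
  rw [enorm_smul, ← ofReal_norm, Real.norm_of_nonneg (h.nonneg _)]

lemma young_two_pt (h : Moll s φ) {B : V d → Y} (hB : AEStronglyMeasurable B) (x : V d) :
    ‖cv φ B x‖ₑ ^ 2 ≤ ∫⁻ y, ENNReal.ofReal (φ (x - y)) * ‖B y‖ₑ ^ 2 := by
  have h1 := lint_sq (volume.withDensity fun y => ENNReal.ofReal (φ (x - y))) (f := fun y => ‖B y‖ₑ)
    (hB.enorm.mono_ac (withDensity_absolutelyContinuous _ _))
  rw [lintegral_withDensity_eq_lintegral_mul₀ (h.meas x).aemeasurable hB.enorm,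
    lintegral_withDensity_eq_lintegral_mul₀ (h.meas x).aemeasurable (hB.enorm.pow_const 2),
    withDensity_apply _ MeasurableSet.univ, Measure.restrict_univ, h.lint' x, one_mul] at h1
  exact le_trans (by gcongr; exact young_one_pt h B x) h1

lemma young_swap (h : Moll s φ) {f : V d → ℝ≥0∞} (hf : AEMeasurable f) :
    ∫⁻ x, ∫⁻ y, ENNReal.ofReal (φ (x - y)) * f y = ∫⁻ y, f y := by
  have hc := h.cont
  rw [lintegral_lintegral_swap]
  · refine lintegral_congr fun y => ?_
    rw [lintegral_mul_const'' _ (by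
      exact (ENNReal.continuous_ofReal.comp (by fun_prop : Continuous fun x => φ (x - y))).measurable.aemeasurable), h.lint'' y, one_mul]
  · refine AEMeasurable.mul ?_ (hf.comp_quasiMeasurePreserving Measure.quasiMeasurePreserving_snd)
    exact (ENNReal.continuous_ofReal.comp (by fun_prop : Continuous fun q : V d × V d => φ (q.1 - q.2))).measurable.aemeasurable

lemma young_one (h : Moll s φ) {B : V d → Y} (hB : AEStronglyMeasurable B) :
    ∫⁻ x, ‖cv φ B x‖ₑ ≤ ∫⁻ x, ‖B x‖ₑ :=
  (lintegral_mono (young_one_pt h B)).trans (young_swap h hB.enorm).le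

lemma young_two (h : Moll s φ) {B : V d → Y} (hB : AEStronglyMeasurable B) :
    ∫⁻ x, ‖cv φ B x‖ₑ ^ 2 ≤ ∫⁻ x, ‖B x‖ₑ ^ 2 :=
  (lintegral_mono (young_two_pt h hB)).trans (young_swap h (hB.enorm.pow_const 2)).le

lemma young_sup (h : Moll s φ) {c : ℝ} (hc : ∀ x, φ x ≤ c) {B : V d → Y} (hB : AEStronglyMeasurable B) (x : V d) :
    ‖cv φ B x‖ₑ ^ 2 ≤ ENNReal.ofReal c * ∫⁻ x, ‖B x‖ₑ ^ 2 := by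
  refine (young_two_pt h hB x).trans ?_
  rw [← lintegral_const_mul' _ _ ENNReal.ofReal_ne_top]
  refine lintegral_mono fun y => ?_
  gcongr
  exact hc _

lemma cv_eq_conv (φ : V d → ℝ) (f : V d → ℝ) : cv φ f = convolution φ f (ContinuousLinearMap.lsmul ℝ ℝ) volume := by
  ext x
  rw [convolution_lsmul_swap]; rfl

lemma cv_contDiff (h : Moll s φ) {f : V d → ℝ} (hf : ContDiff ℝ 1 f) (hfc : HasCompactSupport f) :
    ContDiff ℝ 1 (cv φ f) := by
  rw [cv_eq_conv]
  exact hfc.contDiff_convolution_right (n := 1) _ h.cont.locallyIntegrable hf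

lemma cv_hcs (h : Moll s φ) {f : V d → ℝ} (hfc : HasCompactSupport f) : HasCompactSupport (cv φ f) := by
  rw [cv_eq_conv]
  exact h.hcs.convolution _ hfc

lemma gradient_hcs {f : V d → ℝ} (hfc : HasCompactSupport f) : HasCompactSupport (gradient f) :=
  (hfc.fderiv (𝕜 := ℝ)).comp_left (g := (InnerProductSpace.toDual ℝ (V d)).symm) (map_zero _)

lemma cv_fderiv (h : Moll s φ) {f : V d → ℝ} (hf : ContDiff ℝ 1 f) (hfc : HasCompactSupport f) (x v : V d) :
    fderiv ℝ (cv φ f) x v = ∫ y, φ (x - y) * fderiv ℝ f y v := by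
  have h1 := hfc.hasFDerivAt_convolution_right (ContinuousLinearMap.lsmul ℝ ℝ) h.cont.locallyIntegrable hf x (μ := volume)
  rw [← cv_eq_conv] at h1
  have hDc : Continuous (fderiv ℝ f) := hf.continuous_fderiv (by norm_num)
  rw [h1.fderiv]
  have h2 := convolution_precompR_apply (ContinuousLinearMap.lsmul ℝ ℝ) (f := φ) (g := fderiv ℝ f) (μ := volume) h.cont.locallyIntegrable (hfc.fderiv (𝕜 := ℝ)) hDc x v
  refine h2.trans ?_
  exact convolution_lsmul_swap

lemma cv_inner {φ : V d → ℝ} (hc : Continuous φ) {g : V d → V d} (hg : Continuous g) (hgc : HasCompactSupport g) (x v : V d) :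
    ⟪cv φ g x, v⟫ = ∫ y, φ (x - y) * ⟪g y, v⟫ := by
  have hi : Integrable (fun y => φ (x - y) • g y) :=
    Continuous.integrable_of_hasCompactSupport (by fun_prop) (hgc.mono fun y hy => by
      simp only [Function.mem_support] at hy ⊢
      exact fun h0 => hy (by rw [h0, smul_zero]))
  rw [real_inner_comm]
  refine (integral_inner hi v).symm.trans ?_
  refine integral_congr_ae (ae_of_all _ fun y => ?_)
  simp only [real_inner_smul_right]
  rw [real_inner_comm]

lemma cv_grad (h : Moll s φ) {f : V d → ℝ} (hf : ContDiff ℝ 1 f) (hfc : HasCompactSupport f) (x : V d) :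
    gradient (cv φ f) x = cv φ (gradient f) x := by
  refine ext_inner_right ℝ fun v => ?_
  rw [cv_inner h.cont (continuous_gradient hf) (gradient_hcs hfc), inner_gradient, cv_fderiv h hf hfc]
  refine integral_congr_ae (ae_of_all _ fun y => ?_)
  simp only [inner_gradient]

end
end CR

namespace CR

section
variable {d : ℕ} {s : ℝ} {φ : V d → ℝ}

lemma Moll.integrable' (h : Moll s φ) (x : V d) : Integrable fun y => φ (x - y) :=
  h.integrable.comp_sub_left x

lemma Moll.int' (h : Moll s φ) (x : V d) : ∫ y, φ (x - y) = 1 := by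
  rw [integral_sub_left_eq_self φ volume x, h.int]

lemma Moll.zero_of (h : Moll s φ) {x : V d} (hx : s < ‖x‖) : φ x = 0 := by
  by_contra h0
  have := h.supp (subset_tsupport φ (Function.mem_support.2 h0))
  rw [mem_closedBall_zero_iff] at this
  linarith

lemma cv_close (h : Moll s φ) {g : V d → ℝ} (hg : Continuous g) (hgc : HasCompactSupport g) (hL : LipschitzWith 1 g) (hs : 0 ≤ s) (x : V d) :
    |cv φ g x - g x| ≤ s := by
  have hc := h.cont
  have hi : Integrable fun y => φ (x - y) * g y :=
    Continuous.integrable_of_hasCompactSupport (by fun_prop) (hgc.mono fun y hy => by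
      simp only [Function.mem_support] at hy ⊢
      exact fun h0 => hy (by rw [h0, mul_zero]))
  have e1 : cv φ g x - g x = ∫ y, φ (x - y) * (g y - g x) := by
    simp only [mul_sub]
    rw [integral_sub hi ((h.integrable' x).mul_const _), integral_mul_const, h.int' x, one_mul]
    rfl
  have e2 : s = ∫ y, φ (x - y) * s := by rw [integral_mul_const, h.int' x, one_mul]
  rw [e1, ← Real.norm_eq_abs]
  conv_rhs => rw [e2]
  refine norm_integral_le_of_norm_le ((h.integrable' x).mul_const _) (ae_of_all _ fun y => ?_)
  rw [norm_mul, Real.norm_of_nonneg (h.nonneg _)]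
  rcases lt_or_ge s ‖x - y‖ with h1 | h1
  · rw [h.zero_of h1]; simp
  · refine mul_le_mul_of_nonneg_left ?_ (h.nonneg _)
    have := hL.dist_le_mul y x
    rw [dist_eq_norm, dist_comm, dist_eq_norm] at this
    simp at this
    rw [Real.norm_eq_abs]; linarith

lemma lip_of_fderiv {g : V d → ℝ} (hg : ContDiff ℝ 1 g) {C : ℝ} (h1 : ∀ x, ‖fderiv ℝ g x‖ ≤ C) (x y : V d) :
    |g x - g y| ≤ C * ‖x - y‖ := by
  have := Convex.norm_image_sub_le_of_norm_fderiv_le (𝕜 := ℝ) (f := g) (s := univ) (C := C)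
    (fun x _ => hg.differentiable (by norm_num) x) (fun x _ => h1 x) convex_univ (mem_univ y) (mem_univ x)
  exact this

lemma lemC (ν : Measure (V d)) [IsFiniteMeasure ν] {K : Set (V d)} (hK : IsCompact K) (hνK : ν Kᶜ = 0) {R : ℝ} (hKR : K ⊆ ball 0 R)
    (h : ∀ f : V d → ℝ, (∃ C : NNReal, LipschitzWith C f) → ∀ᵐ x ∂ν, DifferentiableAt ℝ f x) {e : V d} (he : ‖e‖ = 1) {κ : ℝ} (hκ : 0 < κ) :
    ∃ η > 0, ∀ g : V d → ℝ, ContDiff ℝ 1 g → HasCompactSupport g → (∀ x, ‖fderiv ℝ g x‖ ≤ 1) →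
      ∫⁻ x, ‖gradient g x‖ₑ ^ 2 ≤ ENNReal.ofReal (η ^ 2) → ∫ x, fderiv ℝ g x e ∂ν < κ := by
  obtain ⟨δ, hδ, hA⟩ := stepA ν hK hνK hKR h he hκ
  obtain ⟨ω, hω⟩ := exists_moll (d := d) (show 0 < δ / 4 by linarith)
  obtain ⟨c, hc0, hc⟩ := hω.bdd
  have hR1 : (0:ℝ) < |R| + 1 := by positivity
  have hc1 : 0 < √c + 1 := by positivity
  refine ⟨δ / (4 * (|R| + 1) * (√c + 1)), by positivity, fun g hg hgc hg1 hg2 => ?_⟩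
  set η := δ / (4 * (|R| + 1) * (√c + 1)) with hη
  have hη0 : 0 < η := by positivity
  have hηR : √c * η * |R| ≤ δ / 4 := by
    have : (√c + 1) * η * (|R| + 1) = δ / 4 := by rw [hη]; field_simp
    rw [← this]
    have := abs_nonneg R
    gcongr <;> linarith
  have hL : LipschitzWith 1 g := LipschitzWith.of_dist_le_mul fun x y => by
    have := lip_of_fderiv hg hg1 x y
    rw [dist_eq_norm, dist_eq_norm]; simpa using this
  have hG1 : ∀ x, ‖fderiv ℝ (cv ω g) x‖ ≤ √c * η := by
    intro x
    rw [← norm_gradient, cv_grad hω hg hgc]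
    have h1 := young_sup hω hc (B := gradient g) (continuous_gradient hg).aestronglyMeasurable x
    have h2 := h1.trans (mul_le_mul_right hg2 _)
    rw [← ENNReal.ofReal_mul hc0, ← ofReal_sq_norm, ENNReal.ofReal_le_ofReal_iff (by positivity)] at h2
    refine abs_le_of_sq_le_sq' ?_ (by positivity) |>.2
    rw [mul_pow, Real.sq_sqrt hc0]; exact h2
  have hkey : ∀ x ∈ ball (0 : V d) R, |g x - g 0| ≤ δ := by
    intro x hx
    have a1 := cv_close hω hg.continuous hgc hL (by linarith) x
    have a2 := cv_close hω hg.continuous hgc hL (by linarith) 0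
    have a3 := lip_of_fderiv (cv_contDiff hω hg hgc) hG1 x 0
    have a4 : ‖x - 0‖ ≤ |R| := by
      rw [mem_ball_zero_iff] at hx; rw [sub_zero]; exact hx.le.trans (le_abs_self R)
    have a5 : √c * η * ‖x - 0‖ ≤ √c * η * |R| := by gcongr
    rw [abs_le] at *
    constructor <;> linarith [a1.1, a1.2, a2.1, a2.2, a3.1, a3.2]
  have := hA (fun x => g x - g 0) (hg.sub contDiff_const) (fun x => by rw [fderiv_sub_const]; exact hg1 x) hkey
  simpa only [fderiv_sub_const] using this

end
end CR

namespace CR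

section
variable {d : ℕ} {s : ℝ} {φ : V d → ℝ}

abbrev HH (d : ℕ) := Lp (V d) 2 (volume : Measure (V d))

lemma lint_norm (G : HH d) : ∫⁻ x, ‖G x‖ₑ ^ 2 = ENNReal.ofReal (‖G‖ ^ 2) := by
  have h := eLpNorm_nnreal_pow_eq_lintegral (f := fun x => G x) (μ := (volume : Measure (V d))) (p := 2) (by norm_num)
  have e2 : ((2 : NNReal) : ℝ) = ((2 : ℕ) : ℝ) := by norm_num
  rw [e2] at h
  simp only [ENNReal.rpow_natCast] at h
  rw [← h, ofReal_sq_norm, Lp.enorm_def]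
  rfl

/-- C1 compactly supported test function -/
structure Test (f : V d → ℝ) : Prop where
  smooth : ContDiff ℝ 1 f
  hcs : HasCompactSupport f

lemma Test.diff {f : V d → ℝ} (hf : Test f) (x : V d) : DifferentiableAt ℝ f x := hf.smooth.differentiable (by norm_num) x

lemma Test.memLp {f : V d → ℝ} (hf : Test f) : MemLp (gradient f) 2 :=
  (continuous_gradient hf.smooth).memLp_of_hasCompactSupport (gradient_hcs hf.hcs)

lemma grad_add {f g : V d → ℝ} (hf : Test f) (hg : Test g) (x : V d) : gradient (f + g) x = gradient f x + gradient g x := by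
  refine ext_inner_right ℝ fun v => ?_
  rw [inner_add_left, inner_gradient, inner_gradient, inner_gradient, fderiv_add (hf.diff x) (hg.diff x)]
  rfl

lemma grad_smul {f : V d → ℝ} (hf : Test f) (c : ℝ) (x : V d) : gradient (c • f) x = c • gradient f x := by
  refine ext_inner_right ℝ fun v => ?_
  rw [real_inner_smul_left, inner_gradient, inner_gradient, fderiv_const_smul (hf.diff x)]
  rfl

lemma Test.smul {f : V d → ℝ} (hf : Test f) (c : ℝ) : Test (c • f) :=
  ⟨contDiff_const.smul hf.smooth, hf.hcs.mono fun x hx => by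
      simp only [Function.mem_support, Pi.smul_apply, smul_eq_mul] at hx ⊢
      exact fun h0 => hx (by rw [h0, mul_zero])⟩

/-- gradients -/
def SG (d : ℕ) : Submodule ℝ (HH d) where
  carrier := {G | ∃ f, Test f ∧ (G : V d → V d) =ᵐ[volume] gradient f}
  add_mem' := by
    rintro G H ⟨f, hf, hG⟩ ⟨g, hg, hH⟩
    refine ⟨f + g, ⟨hf.smooth.add hg.smooth, hf.hcs.add hg.hcs⟩, ?_⟩
    filter_upwards [Lp.coeFn_add G H, hG, hH] with x h1 h2 h3
    rw [h1, Pi.add_apply, h2, h3, grad_add hf hg]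
  zero_mem' := by
    refine ⟨0, ⟨contDiff_const, HasCompactSupport.zero⟩, ?_⟩
    filter_upwards [Lp.coeFn_zero (V d) 2 (volume : Measure (V d))] with x h1
    rw [h1]
    refine ext_inner_right ℝ fun v => ?_
    rw [inner_gradient]
    simp
  smul_mem' := by
    rintro c G ⟨f, hf, hG⟩
    refine ⟨c • f, hf.smul c, ?_⟩
    filter_upwards [Lp.coeFn_smul c G, hG] with x h1 h2
    rw [h1, Pi.smul_apply, h2, grad_smul hf]

/-- L1 ball inside L2 -/
def Q1 (d : ℕ) (κ : ℝ) : Set (HH d) := {b | ∫⁻ y, ‖b y‖ₑ ≤ ENNReal.ofReal κ}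

lemma Q1_zero (κ : ℝ) : (0 : HH d) ∈ Q1 d κ := by
  have : ∫⁻ y, ‖(0 : HH d) y‖ₑ = 0 := by
    rw [lintegral_congr_ae (g := fun _ => 0)]
    · simp
    · filter_upwards [Lp.coeFn_zero (V d) 2 (volume : Measure (V d))] with x h1
      rw [h1]; simp
  simp [Q1]

lemma Q1_convex (κ : ℝ) : Convex ℝ (Q1 d κ) := by
  intro b hb c hc s t hs ht hst
  simp only [Q1, Set.mem_ofPred_eq] at *
  calc ∫⁻ y, ‖(s • b + t • c : HH d) y‖ₑ ≤ ∫⁻ y, (ENNReal.ofReal s * ‖b y‖ₑ + ENNReal.ofReal t * ‖c y‖ₑ) := by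
        refine lintegral_mono_ae ?_
        filter_upwards [Lp.coeFn_add (s • b) (t • c), Lp.coeFn_smul s b, Lp.coeFn_smul t c] with x h1 h2 h3
        rw [h1, Pi.add_apply, h2, h3, Pi.smul_apply, Pi.smul_apply]
        refine (enorm_add_le _ _).trans ?_
        rw [enorm_smul, enorm_smul, Real.enorm_of_nonneg hs, Real.enorm_of_nonneg ht]
    _ = ENNReal.ofReal s * (∫⁻ y, ‖b y‖ₑ) + ENNReal.ofReal t * ∫⁻ y, ‖c y‖ₑ := by
        rw [lintegral_add_left' (by exact ((Lp.aestronglyMeasurable b).enorm.const_mul _)),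
          lintegral_const_mul' _ _ ENNReal.ofReal_ne_top, lintegral_const_mul' _ _ ENNReal.ofReal_ne_top]
    _ ≤ ENNReal.ofReal s * ENNReal.ofReal κ + ENNReal.ofReal t * ENNReal.ofReal κ := by gcongr
    _ = ENNReal.ofReal κ := by
        rw [← add_mul, ← ENNReal.ofReal_add hs ht, hst, ENNReal.ofReal_one, one_mul]

lemma Moll.memLp (h : Moll s φ) (x : V d) (p : ℝ≥0∞) : MemLp (fun y => φ (x - y)) p :=
  Continuous.memLp_of_hasCompactSupport (by have := h.cont; fun_prop)
    (h.hcs.comp_homeomorph (Homeomorph.subLeft x))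

lemma Moll.tv (h : Moll s φ) (x v : V d) : MemLp (fun y => φ (x - y) • v) 2 := by
  have h1 : MemLp (fun y => φ (x - y) • v) 2 :=
    Continuous.memLp_of_hasCompactSupport (by have := h.cont; fun_prop)
      ((h.hcs.comp_homeomorph (Homeomorph.subLeft x)).mono fun y hy => by
        simp only [Function.mem_support, Function.comp, Homeomorph.subLeft] at hy ⊢
        exact fun h0 => hy (by rw [show φ (x - y) = 0 from h0, zero_smul]))
  exact h1

lemma inner_tv (h : Moll s φ) (x v : V d) (G : HH d) : ⟪G, (h.tv x v).toLp⟫ = ⟪cv φ G x, v⟫ := by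
  rw [L2.inner_def]
  have hi : Integrable (fun y => φ (x - y) • G y) := by
    have := (Lp.memLp G).smul (h.memLp x 2) (r := 1)
    rw [memLp_one_iff_integrable] at this
    exact this
  rw [real_inner_comm]
  refine Eq.trans ?_ (integral_inner hi v)
  refine integral_congr_ae ?_
  filter_upwards [(h.tv x v).coeFn_toLp] with y hy
  rw [hy, real_inner_smul_right, real_inner_smul_right, real_inner_comm]

lemma norm_tv (h : Moll s φ) {c : ℝ} (hc0 : 0 ≤ c) (hc : ∀ x, φ x ≤ c) (x : V d) {v : V d} (hv : ‖v‖ = 1) : ‖(h.tv x v).toLp‖ ^ 2 ≤ c := by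
  rw [← ENNReal.ofReal_le_ofReal_iff hc0, ← lint_norm]
  calc ∫⁻ y, ‖((h.tv x v).toLp : HH d) y‖ₑ ^ 2 ≤ ∫⁻ y, ENNReal.ofReal c * ENNReal.ofReal (φ (x - y)) := by
        refine lintegral_mono_ae ?_
        filter_upwards [(h.tv x v).coeFn_toLp] with y hy
        rw [hy, ← ofReal_sq_norm, ← ENNReal.ofReal_mul hc0, norm_smul, hv, mul_one, sq, Real.norm_of_nonneg (h.nonneg _)]
        exact ENNReal.ofReal_le_ofReal (mul_le_mul_of_nonneg_right (hc _) (h.nonneg _))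
    _ = ENNReal.ofReal c := by
        rw [lintegral_const_mul' _ _ ENNReal.ofReal_ne_top, h.lint', mul_one]

lemma tv_Q1 (h : Moll s φ) (x : V d) {v : V d} (hv : ‖v‖ = 1) {κ : ℝ} (hκ : 0 ≤ κ) : κ • (h.tv x v).toLp ∈ Q1 d κ := by
  simp only [Q1, Set.mem_ofPred_eq]
  calc ∫⁻ y, ‖(κ • (h.tv x v).toLp : HH d) y‖ₑ ≤ ∫⁻ y, ENNReal.ofReal κ * ENNReal.ofReal (φ (x - y)) := by
        refine lintegral_mono_ae ?_
        filter_upwards [(h.tv x v).coeFn_toLp, Lp.coeFn_smul κ ((h.tv x v).toLp : HH d)] with y hy h2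
        rw [h2, Pi.smul_apply, hy, enorm_smul, Real.enorm_of_nonneg hκ, enorm_smul, Real.enorm_of_nonneg (h.nonneg _),
          ← ofReal_norm v, hv, ENNReal.ofReal_one, mul_one]
    _ ≤ ENNReal.ofReal κ := by
        rw [lintegral_const_mul' _ _ ENNReal.ofReal_ne_top, h.lint', mul_one]

end
end CR

namespace CR

section
open scoped Pointwise
variable {d : ℕ} {s : ℝ} {φ : V d → ℝ}

/-- separation part -/
lemma sep (w : HH d) {κ ρ : ℝ} (hρ : 0 < ρ)
    (hw : w ∉ ((SG d)ᗮ : Set (HH d)) + Q1 d κ + ball 0 ρ) :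
    ∃ G : HH d, G ∈ closure (SG d : Set (HH d)) ∧ 0 < ⟪G, w⟫ ∧ ρ / 2 * ‖G‖ ≤ ⟪G, w⟫ ∧ ∀ b ∈ Q1 d κ, ⟪G, b⟫ ≤ ⟪G, w⟫ := by
  have hconv : Convex ℝ (((SG d)ᗮ : Set (HH d)) + Q1 d κ + ball 0 ρ) :=
    (((SG d)ᗮ).convex.add (Q1_convex κ)).add (convex_ball 0 ρ)
  obtain ⟨f, hf⟩ := geometric_hahn_banach_open_point hconv (isOpen_ball.add_left) hw
  set G := (InnerProductSpace.toDual ℝ (HH d)).symm f with hG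
  have hGf : ∀ a, ⟪G, a⟫ = f a := fun a => InnerProductSpace.toDual_symm_apply
  have key : ∀ p ∈ (SG d)ᗮ, ∀ b ∈ Q1 d κ, ∀ t ∈ ball (0 : HH d) ρ, ⟪G, p⟫ + ⟪G, b⟫ + ⟪G, t⟫ < ⟪G, w⟫ := by
    intro p hp b hb t ht
    have := hf (p + b + t) (Set.add_mem_add (Set.add_mem_add hp hb) ht)
    rw [← hGf, ← hGf, inner_add_right, inner_add_right] at this
    exact this
  have z1 : (0 : HH d) ∈ (SG d)ᗮ := zero_mem _
  have z3 : (0 : HH d) ∈ ball (0 : HH d) ρ := mem_ball_self hρ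
  refine ⟨G, ?_, ?_, ?_, ?_⟩
  · have : G ∈ (SG d)ᗮᗮ := by
      rw [Submodule.mem_orthogonal']
      intro p hp
      by_contra h0
      have := key ((⟪G, w⟫ / ⟪G, p⟫) • p) ((SG d)ᗮ.smul_mem _ hp) 0 (Q1_zero κ) 0 z3
      rw [real_inner_smul_right, div_mul_cancel₀ _ h0] at this
      simp at this
    rw [Submodule.orthogonal_orthogonal_eq_closure] at this
    exact this
  · simpa using key 0 z1 0 (Q1_zero κ) 0 z3
  · have hc : 0 < ⟪G, w⟫ := by simpa using key 0 z1 0 (Q1_zero κ) 0 z3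
    rcases eq_or_ne ‖G‖ 0 with h0 | h0
    · rw [h0, mul_zero]; exact hc.le
    · have := key 0 z1 0 (Q1_zero κ) ((ρ / 2 / ‖G‖) • G) (by
        rw [mem_ball_zero_iff, norm_smul, norm_div, norm_norm, div_mul_cancel₀ _ h0, Real.norm_of_nonneg (by positivity)]
        linarith)
      rw [real_inner_smul_right, real_inner_self_eq_norm_sq] at this
      have e : ρ / 2 / ‖G‖ * ‖G‖ ^ 2 = ρ / 2 * ‖G‖ := by field_simp
      rw [e] at this
      simp at this
      exact this.le
  · intro b hb
    have := key 0 z1 b hb 0 z3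
    simp at this
    exact this.le

lemma cv_ae {Y : Type*} [NormedAddCommGroup Y] [NormedSpace ℝ Y] {φ : V d → ℝ} {f g : V d → Y} (h : f =ᵐ[volume] g) (x : V d) :
    (∫ y, φ (x - y) • f y) = ∫ y, φ (x - y) • g y :=
  integral_congr_ae (by filter_upwards [h] with y hy; rw [hy])

lemma dual_abs (h : Moll s φ) {wf : V d → V d} (hwf : MemLp wf 2) {κ ρ : ℝ} (hκ : 0 < κ) (hρ : 0 < ρ)
    (hyp : ∀ f, Test f → (∀ x, ‖cv φ (gradient f) x‖ ≤ 1) → ∫⁻ x, ‖gradient f x‖ₑ ^ 2 ≤ ENNReal.ofReal ((2 * κ / ρ) ^ 2) →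
      ∫ y, ⟪wf y, gradient f y⟫ < κ / 4) :
    ∃ b1 b2 : V d → V d, MemLp b1 2 ∧ MemLp b2 2 ∧ ∫⁻ y, ‖b1 y‖ₑ ≤ ENNReal.ofReal κ ∧
      ∫⁻ y, ‖b2 y‖ₑ ^ 2 ≤ ENNReal.ofReal (ρ ^ 2) ∧
      ∀ f, Test f → ∫ y, ⟪b1 y + b2 y, gradient f y⟫ = ∫ y, ⟪wf y, gradient f y⟫ := by
  set w : HH d := hwf.toLp with hw
  by_cases hQ : w ∈ ((SG d)ᗮ : Set (HH d)) + Q1 d κ + ball 0 ρ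
  · obtain ⟨pb, ⟨p, hp, b1, hb1, rfl⟩, b2, hb2, e⟩ := hQ
    refine ⟨b1, b2, Lp.memLp b1, Lp.memLp b2, hb1, ?_, fun f hf => ?_⟩
    · rw [lint_norm]
      rw [mem_ball_zero_iff] at hb2
      exact ENNReal.ofReal_le_ofReal (by gcongr)
    · have e0 : ⟪p, (hf.memLp.toLp : HH d)⟫ = 0 := by
        rw [SetLike.mem_coe, Submodule.mem_orthogonal'] at hp
        exact hp _ ⟨f, hf, hf.memLp.coeFn_toLp⟩
      have e1 : ⟪b1 + b2, (hf.memLp.toLp : HH d)⟫ = ⟪w, (hf.memLp.toLp : HH d)⟫ := by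
        rw [← e]
        simp only [inner_add_left, e0, zero_add]
      rw [L2.inner_def, L2.inner_def] at e1
      rw [integral_congr_ae (g := fun y => ⟪(b1 + b2 : HH d) y, (hf.memLp.toLp : HH d) y⟫), e1]
      · refine integral_congr_ae ?_
        filter_upwards [hf.memLp.coeFn_toLp, hwf.coeFn_toLp] with y h1 h2
        rw [h1, hw, h2]
      · filter_upwards [hf.memLp.coeFn_toLp, Lp.coeFn_add b1 b2] with y h1 h2
        rw [h1, h2, Pi.add_apply]
  · exfalso
    obtain ⟨G, hG, hc, hn, hb⟩ := sep w hρ hQ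
    set c := ⟪G, w⟫ with hcdef
    obtain ⟨m, hm0, hm⟩ := h.bdd
    -- choose epsilon
    obtain ⟨ε, hε, h1, h2, h3⟩ : ∃ ε > 0, ε * √m ≤ c / κ ∧ ε ≤ 2 * c / ρ ∧ ε * ‖w‖ ≤ c / 2 := by
      refine ⟨min (c / κ / (√m + 1)) (min (2 * c / ρ) (c / 2 / (‖w‖ + 1))), by positivity, ?_, ?_, ?_⟩
      · calc _ ≤ c / κ / (√m + 1) * (√m + 1) := by
              gcongr
              · exact min_le_left _ _
              · linarith
          _ = c / κ := by field_simp
      · exact (min_le_right _ _).trans (min_le_left _ _)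
      · calc _ ≤ c / 2 / (‖w‖ + 1) * (‖w‖ + 1) := by
              gcongr
              · exact (min_le_right _ _).trans (min_le_right _ _)
              · linarith
          _ = c / 2 := by field_simp
    obtain ⟨F, ⟨f, hf, hFf⟩, hGF⟩ := Metric.mem_closure_iff.1 hG ε hε
    rw [dist_eq_norm] at hGF
    have hFG : ‖F - G‖ < ε := by rw [norm_sub_rev]; exact hGF
    set t := κ / (2 * c) with ht
    have ht0 : 0 < t := by positivity
    have hgr : gradient (t • f) = fun x => t • gradient f x := funext (grad_smul hf t)
    have hcv : ∀ x, ‖cv φ F x‖ ≤ 2 * c / κ := by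
      intro x
      rcases eq_or_ne ‖cv φ F x‖ 0 with h0 | h0
      · rw [h0]; positivity
      set v := (‖cv φ F x‖)⁻¹ • cv φ F x with hv
      have hv1 : ‖v‖ = 1 := by rw [hv, norm_smul, norm_inv, norm_norm, inv_mul_cancel₀ h0]
      have a1 : ⟪F, (h.tv x v).toLp⟫ = ‖cv φ F x‖ := by
        rw [inner_tv h, hv, real_inner_smul_right, real_inner_self_eq_norm_sq]
        field_simp
      have a2 := hb _ (tv_Q1 h x hv1 hκ.le)
      rw [real_inner_smul_right] at a2
      have a3 : ⟪G, (h.tv x v).toLp⟫ ≤ c / κ := by rw [le_div_iff₀ hκ]; linarith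
      have a4 : ⟪F - G, ((h.tv x v).toLp : HH d)⟫ ≤ ε * √m := by
        refine (real_inner_le_norm _ _).trans ?_
        have : ‖((h.tv x v).toLp : HH d)‖ ≤ √m := Real.le_sqrt_of_sq_le (norm_tv h hm0 hm x hv1)
        gcongr
      rw [inner_sub_left] at a4
      have : 2 * c / κ = c / κ + c / κ := by ring
      rw [← a1]
      linarith
    have hlt := hyp (t • f) (hf.smul t) ?_ ?_
    · have e1 : ∫ y, ⟪wf y, gradient (t • f) y⟫ = t * ⟪F, w⟫ := by
        rw [real_inner_comm, L2.inner_def, ← integral_const_mul, hgr]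
        refine integral_congr_ae ?_
        filter_upwards [hFf, hwf.coeFn_toLp] with y h1 h2
        rw [h1, hw, h2, real_inner_smul_right]
      rw [e1] at hlt
      have e2 : ⟪G - F, w⟫ ≤ ε * ‖w‖ := by
        refine (real_inner_le_norm _ _).trans ?_
        gcongr
      rw [inner_sub_left] at e2
      have e3 : c / 2 ≤ ⟪F, w⟫ := by linarith
      have e4 : t * (c / 2) = κ / 4 := by rw [ht]; field_simp; norm_num
      have := mul_le_mul_of_nonneg_left e3 ht0.le
      linarith
    · intro x
      have e : cv φ (gradient (t • f)) x = t • cv φ F x := by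
        rw [cv, cv, ← integral_smul, hgr]
        refine integral_congr_ae ?_
        filter_upwards [hFf] with y h1
        rw [h1, smul_comm]
      rw [e, norm_smul, Real.norm_of_nonneg ht0.le]
      calc t * ‖cv φ F x‖ ≤ t * (2 * c / κ) := by gcongr; exact hcv x
        _ = 1 := by rw [ht]; field_simp
    · have e : ∫⁻ x, ‖gradient (t • f) x‖ₑ ^ 2 = ENNReal.ofReal ((t * ‖F‖) ^ 2) := by
        rw [mul_pow, ENNReal.ofReal_mul (by positivity), ← lint_norm, ← lintegral_const_mul' _ _ ENNReal.ofReal_ne_top]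
        refine lintegral_congr_ae ?_
        filter_upwards [hFf] with y h1
        rw [hgr, h1, enorm_smul, mul_pow, Real.enorm_of_nonneg ht0.le, ENNReal.ofReal_pow ht0.le]
      rw [e]
      refine ENNReal.ofReal_le_ofReal ?_
      have e2 : ‖F‖ ≤ ‖G‖ + ε := by
        have := norm_add_le (F - G) G
        rw [sub_add_cancel] at this
        linarith
      have e3 : ‖G‖ ≤ 2 * c / ρ := by
        rw [le_div_iff₀ hρ]; linarith
      have e4 : t * ‖F‖ ≤ 2 * κ / ρ := by
        calc t * ‖F‖ ≤ t * (2 * c / ρ + 2 * c / ρ) := by gcongr; linarith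
          _ = 2 * κ / ρ := by rw [ht]; field_simp; norm_num
      have : 0 ≤ t * ‖F‖ := by positivity
      gcongr

end
end CR

namespace CR

section
variable {d : ℕ} {s : ℝ} {φ : V d → ℝ}

/-- mollified measure -/
def us (φ : V d → ℝ) (ν : Measure (V d)) (y : V d) : ℝ := ∫ x, φ (y - x) ∂ν

variable (ν : Measure (V d)) [IsFiniteMeasure ν]

lemma Moll.norm_bdd (h : Moll s φ) : ∃ c : ℝ, 0 ≤ c ∧ ∀ x, ‖φ x‖ ≤ c := by
  obtain ⟨c, hc0, hc⟩ := h.bdd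
  exact ⟨c, hc0, fun x => by rw [Real.norm_of_nonneg (h.nonneg x)]; exact hc x⟩

lemma us_nonneg (h : Moll s φ) (y : V d) : 0 ≤ us φ ν y := integral_nonneg fun _ => h.nonneg _

lemma us_cont (h : Moll s φ) : Continuous (us φ ν) := by
  obtain ⟨c, hc0, hc⟩ := h.norm_bdd
  have hφ := h.cont
  refine continuous_of_dominated (bound := fun _ => c) (fun y => ?_) (fun y => ae_of_all _ fun x => hc _) (integrable_const c)
    (ae_of_all _ fun x => by fun_prop)
  exact (by fun_prop : Continuous fun x => φ (y - x)).aestronglyMeasurable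

lemma us_zero (h : Moll s φ) {K : Set (V d)} (hνK : ν Kᶜ = 0) {y : V d} (hy : y ∉ cthickening s K) : us φ ν y = 0 := by
  have : (fun x => φ (y - x)) =ᵐ[ν] fun _ => (0:ℝ) := by
    have h1 : ∀ᵐ x ∂ν, x ∈ K := by rw [ae_iff]; exact hνK
    filter_upwards [h1] with x hx
    apply h.zero_of
    by_contra h0
    push Not at h0
    exact hy (mem_cthickening_of_dist_le y x s K hx (by rwa [dist_eq_norm]))
  rw [us, integral_congr_ae this, integral_zero]

lemma us_hcs (h : Moll s φ) {K : Set (V d)} (hK : IsCompact K) (hνK : ν Kᶜ = 0) : HasCompactSupport (us φ ν) :=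
  HasCompactSupport.of_support_subset_isCompact (hK.cthickening (r := s)) fun y hy => by
    by_contra h0
    exact hy (us_zero ν h hνK h0)

lemma us_memLp (h : Moll s φ) {K : Set (V d)} (hK : IsCompact K) (hνK : ν Kᶜ = 0) (p : ℝ≥0∞) : MemLp (us φ ν) p :=
  (us_cont ν h).memLp_of_hasCompactSupport (us_hcs ν h hK hνK)

lemma us_ofReal (h : Moll s φ) (y : V d) : ENNReal.ofReal (us φ ν y) = ∫⁻ x, ENNReal.ofReal (φ (y - x)) ∂ν := by
  obtain ⟨c, hc0, hc⟩ := h.norm_bdd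
  have hφ := h.cont
  rw [us, ofReal_integral_eq_lintegral_ofReal _ (ae_of_all _ fun _ => h.nonneg _)]
  exact (integrable_const c).mono' (by fun_prop : Continuous fun x => φ (y - x)).aestronglyMeasurable (ae_of_all _ fun x => hc _)

lemma us_lint (h : Moll s φ) : ∫⁻ y, ENNReal.ofReal (us φ ν y) = ν univ := by
  have hφ := h.cont
  simp only [us_ofReal ν h]
  rw [lintegral_lintegral_swap]
  · simp [h.lint'']
  · exact (ENNReal.continuous_ofReal.comp (by fun_prop : Continuous fun q : V d × V d => φ (q.1 - q.2))).measurable.aemeasurable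

lemma us_swap (h : Moll s φ) {F : V d → ℝ} (hF : Continuous F) (hFc : HasCompactSupport F) :
    ∫ x, (∫ y, φ (x - y) * F y) ∂ν = ∫ y, us φ ν y * F y := by
  obtain ⟨c, hc0, hc⟩ := h.norm_bdd
  have hφ := h.cont
  have hi : Integrable (fun q : V d × V d => c * ‖F q.2‖) (ν.prod volume) :=
    (integrable_const c).mul_prod (hF.integrable_of_hasCompactSupport hFc).norm
  have hi2 : Integrable (Function.uncurry fun x y => φ (x - y) * F y) (ν.prod volume) := by
    refine hi.mono' ?_ (ae_of_all _ fun q => ?_)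
    · exact (by fun_prop : Continuous fun q : V d × V d => φ (q.1 - q.2) * F q.2).aestronglyMeasurable
    · simp only [Function.uncurry, norm_mul]
      gcongr
      exact hc _
  rw [integral_integral_swap hi2]
  refine integral_congr_ae (ae_of_all _ fun y => ?_)
  simp only [integral_mul_const, us]
  congr 2
  ext x
  rw [← h.even, neg_sub]

lemma dual {K : Set (V d)} (hK : IsCompact K) (hνK : ν Kᶜ = 0) {R : ℝ} (hKR : K ⊆ ball 0 R)
    (h : ∀ f : V d → ℝ, (∃ C : NNReal, LipschitzWith C f) → ∀ᵐ x ∂ν, DifferentiableAt ℝ f x) {e : V d} (he : ‖e‖ = 1) {κ : ℝ} (hκ : 0 < κ) :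
    ∃ ρ0 > 0, ∀ ρ ≥ ρ0, ∀ s φ, Moll s φ → ∃ b1 b2 : V d → V d, MemLp b1 2 ∧ MemLp b2 2 ∧ ∫⁻ y, ‖b1 y‖ₑ ≤ ENNReal.ofReal κ ∧
      ∫⁻ y, ‖b2 y‖ₑ ^ 2 ≤ ENNReal.ofReal (ρ ^ 2) ∧
      ∀ f, Test f → ∫ y, ⟪b1 y + b2 y, gradient f y⟫ = ∫ y, us φ ν y * fderiv ℝ f y e := by
  obtain ⟨η, hη, hC⟩ := lemC ν hK hνK hKR h he (show 0 < κ / 4 by linarith)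
  refine ⟨2 * κ / η, by positivity, fun ρ hρ s φ hφ => ?_⟩
  have hρ0 : 0 < ρ := lt_of_lt_of_le (by positivity) hρ
  have hin : ∀ f, ∫ y, ⟪us φ ν y • e, gradient f y⟫ = ∫ y, us φ ν y * fderiv ℝ f y e := by
    intro f
    refine integral_congr_ae (ae_of_all _ fun y => ?_)
    simp only [real_inner_smul_left]
    rw [real_inner_comm, inner_gradient]
  have hwf : MemLp (fun y => us φ ν y • e) 2 :=
    ((us_cont ν hφ).smul continuous_const).memLp_of_hasCompactSupport ((us_hcs ν hφ hK hνK).mono fun y hy => by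
      simp only [Function.mem_support] at hy ⊢
      exact fun h0 => hy (by rw [Pi.smul_apply', h0, zero_smul]))
  obtain ⟨b1, b2, h1, h2, h3, h4, h5⟩ := dual_abs hφ hwf hκ hρ0 (fun f hf hf1 hf2 => by
    rw [hin]
    have hg := cv_grad hφ hf.smooth hf.hcs
    have hlt := hC (cv φ f) (cv_contDiff hφ hf.smooth hf.hcs) (cv_hcs hφ hf.hcs)
      (fun x => by rw [← norm_gradient, hg]; exact hf1 x) (by
        simp only [hg]
        refine (young_two hφ (continuous_gradient hf.smooth).aestronglyMeasurable).trans (hf2.trans ?_)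
        refine ENNReal.ofReal_le_ofReal ?_
        have : 2 * κ / ρ ≤ η := by
          rw [ge_iff_le, div_le_iff₀ hη] at hρ
          rw [div_le_iff₀ hρ0]; linarith
        have : 0 ≤ 2 * κ / ρ := by positivity
        gcongr)
    simp only [cv_fderiv hφ hf.smooth hf.hcs] at hlt
    have hDc : Continuous (fun y => fderiv ℝ f y e) := (hf.smooth.continuous_fderiv (by norm_num)).clm_apply continuous_const
    rw [us_swap ν hφ hDc (hf.hcs.fderiv_apply (𝕜 := ℝ) e)] at hlt
    exact hlt)
  exact ⟨b1, b2, h1, h2, h3, h4, fun f hf => by rw [h5 f hf, hin]⟩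

end
end CR

namespace CR

section
variable {d : ℕ} {s : ℝ} {φ : V d → ℝ}

lemma gaussReal_le : ProbabilityTheory.gaussianReal 0 1 ≤ (volume : Measure ℝ) := by
  rw [ProbabilityTheory.gaussianReal_of_var_ne_zero 0 (by norm_num)]
  calc _ ≤ (volume : Measure ℝ).withDensity 1 := by
        refine withDensity_mono (ae_of_all _ fun x => ?_)
        rw [ProbabilityTheory.gaussianPDF, Pi.one_apply, ← ENNReal.ofReal_one]
        refine ENNReal.ofReal_le_ofReal ?_
        rw [ProbabilityTheory.gaussianPDFReal]
        have h1 : (√(2 * π * ((1 : NNReal) : ℝ)))⁻¹ ≤ 1 := by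
          refine inv_le_one_of_one_le₀ ?_
          rw [Real.one_le_sqrt]
          have := Real.pi_gt_three
          push_cast
          linarith
        have h2 : rexp (-(x - 0) ^ 2 / (2 * ((1 : NNReal) : ℝ))) ≤ 1 := by
          rw [Real.exp_le_one_iff]
          have : 0 ≤ (x - 0) ^ 2 := sq_nonneg _
          push_cast
          linarith
        exact mul_le_one₀ h1 (Real.exp_pos _).le h2
    _ = volume := withDensity_one

lemma pi_le {μ ν : Measure ℝ} [SigmaFinite μ] [SigmaFinite ν] (h : μ ≤ ν) :
    Measure.pi (fun _ : Fin d => μ) ≤ Measure.pi (fun _ : Fin d => ν) := by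
  have h1 : (Measure.pi (fun _ : Fin d => μ)).toOuterMeasure ≤ OuterMeasure.pi (fun _ : Fin d => ν.toOuterMeasure) := by
    rw [OuterMeasure.le_pi]
    intro s _
    calc _ = Measure.pi (fun _ : Fin d => μ) (Set.pi univ s) := rfl
      _ = ∏ i, μ (s i) := Measure.pi_pi _ _
      _ ≤ ∏ i, ν (s i) := Finset.prod_le_prod' fun i _ => h (s i)
  refine Measure.le_iff.2 fun A hA => ?_
  conv_rhs => rw [Measure.pi, toMeasure_apply _ _ hA]
  exact h1 A

lemma gam_le : gam d ≤ volume := by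
  rw [gam, ← ProbabilityTheory.map_pi_eq_stdGaussian, ← (PiLp.volume_preserving_toLp (Fin d)).map_eq]
  exact Measure.map_mono (pi_le gaussReal_le) (by fun_prop)

lemma h_low {P : ℝ} (h0 : 0 ≤ P) (h1 : P ≤ 1) : P / 2 ≤ 1 - 1 / (1 + P) := by
  have : 1 - 1 / (1 + P) = P / (1 + P) := by field_simp; ring
  rw [this]
  gcongr
  linarith

lemma lower {M : ℝ} (hM : 0 ≤ M) {u : V d → ℝ} {Du : Fin d → V d → ℝ} (hu : Good M u Du) (hu0 : ∀ x, 0 ≤ u x) {a : V d → W d} {C : ℝ} (hC : 0 ≤ C)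
    {τ : ℝ} (hτ : τ ≤ 1) (hτ0 : 0 ≤ τ) (hintg : ∫⁻ x, ENNReal.ofReal (u x) = ENNReal.ofReal τ) :
    ENNReal.ofReal (τ / 2) ≤ ∫⁻ x, ENNReal.ofReal (bW C (Ps 1 a x) (Ps 1 u x)) := by
  have hcu : Continuous u := hu.cont hM
  have hP0 : ∀ x, 0 ≤ Ps 1 u x := fun x => integral_nonneg fun z => hu0 _
  have hPe : ∀ x, ENNReal.ofReal (Ps 1 u x) = ∫⁻ z, ENNReal.ofReal (u (x + z)) ∂(gam d) := by
    intro x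
    rw [Ps, ofReal_integral_eq_lintegral_ofReal _ (ae_of_all _ fun _ => hu0 _)]
    · simp only [one_smul]
    · exact memLp_one_iff_integrable.1 (Ps_memLp hcu hu.bd 1 x 1)
  have hP1 : ∀ x, Ps 1 u x ≤ 1 := by
    intro x
    refine le_trans ?_ hτ
    rw [← ENNReal.ofReal_le_ofReal_iff hτ0, hPe, ← hintg]
    calc _ ≤ ∫⁻ z, ENNReal.ofReal (u (x + z)) := lintegral_mono' gam_le le_rfl
      _ = _ := lintegral_add_left_eq_self (fun z => ENNReal.ofReal (u z)) x
  have hPi : ∫⁻ x, ENNReal.ofReal (Ps 1 u x) = ENNReal.ofReal τ := by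
    simp only [hPe]
    rw [lintegral_lintegral_swap]
    · have : ∀ z : V d, ∫⁻ x, ENNReal.ofReal (u (x + z)) = ENNReal.ofReal τ := fun z => by
        rw [lintegral_add_right_eq_self (fun z => ENNReal.ofReal (u z)) z, hintg]
      simp [this]
    · exact (ENNReal.continuous_ofReal.comp (by fun_prop : Continuous fun q : V d × V d => u (q.1 + q.2))).measurable.aemeasurable
  calc ENNReal.ofReal (τ / 2) = ∫⁻ x, ENNReal.ofReal (1 / 2) * ENNReal.ofReal (Ps 1 u x) := by
        rw [lintegral_const_mul' _ _ ENNReal.ofReal_ne_top, hPi, ← ENNReal.ofReal_mul (by norm_num)]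
        congr 1; ring
    _ ≤ _ := by
        refine lintegral_mono fun x => ?_
        rw [← ENNReal.ofReal_mul (by norm_num)]
        refine ENNReal.ofReal_le_ofReal ?_
        have h1 := h_low (hP0 x) (hP1 x)
        have h2 := bW_ge hC (Ps 1 a x) (hP0 x)
        linarith

lemma theta_add {X : Type*} [NormedAddCommGroup X] [InnerProductSpace ℝ X] (x y : X) : √(1 + ‖x + y‖ ^ 2) - 1 ≤ ‖x‖ + ‖y‖ ^ 2 := by
  have h := norm_add_le x y
  have hx := norm_nonneg x
  have hy := norm_nonneg y
  have : √(1 + ‖x + y‖ ^ 2) ≤ 1 + (‖x‖ + ‖y‖ ^ 2) := by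
    rw [Real.sqrt_le_left (by positivity)]
    have h1 : ‖x + y‖ ^ 2 ≤ (‖x‖ + ‖y‖) ^ 2 := by gcongr
    have h2 : ‖x‖ * ‖y‖ * 2 ≤ ‖x‖ * (1 + ‖y‖ ^ 2) := by
      have := mul_le_mul_of_nonneg_left (show ‖y‖ * 2 ≤ 1 + ‖y‖ ^ 2 by linarith [sq_nonneg (‖y‖ - 1)]) hx
      linarith
    have h3 : 0 ≤ ‖x‖ * ‖y‖ ^ 2 := by positivity
    have h4 : 0 ≤ (‖y‖ ^ 2) ^ 2 := by positivity
    linarith [sq_nonneg ‖y‖]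
  linarith

lemma bW_up {X : Type*} [NormedAddCommGroup X] [InnerProductSpace ℝ X] [CompleteSpace X] (C : ℝ) (x : X) {y : ℝ} (hy : 0 ≤ y) :
    bW C x y ≤ (1 - 1 / (1 + y)) + (C + 4) * (√(1 + ‖x‖ ^ 2) - 1) := by
  set t := √(1 + ‖x‖ ^ 2) - 1 with ht
  have ht0 : 0 ≤ t := theta_nonneg x
  have e : (1 + ‖x‖ ^ 2) = (1 + t) ^ 2 := by
    rw [ht, add_sub_cancel, Real.sq_sqrt (by positivity)]
  have h1 : 1 - 4 * t ≤ 1 / (1 + ‖x‖ ^ 2) ^ 2 := by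
    rw [e, le_div_iff₀ (by positivity)]
    have e2 : (1 - 4 * t) * ((1 + t) ^ 2) ^ 2 = 1 - (10 * t ^ 2 + 20 * t ^ 3 + 15 * t ^ 4 + 4 * t ^ 5) := by ring
    rw [e2]
    have : 0 ≤ 10 * t ^ 2 + 20 * t ^ 3 + 15 * t ^ 4 + 4 * t ^ 5 := by positivity
    linarith
  have h2 : 1 / (1 + y) ≤ 1 := by rw [div_le_one (by linarith)]; linarith
  have h3 : 0 ≤ 1 / (1 + y) := by positivity
  have h4 := mul_le_mul_of_nonneg_left h1 h3
  have h5 := mul_le_mul_of_nonneg_right h2 ht0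
  rw [bW, ← ht]
  linarith

end
end CR

namespace CR

section
variable {d : ℕ} {s : ℝ} {φ : V d → ℝ}

lemma Good.mono {Y : Type*} [NormedAddCommGroup Y] [NormedSpace ℝ Y] {M N : ℝ} {F : V d → Y} {D : Fin d → V d → Y} (h : Good M F D) (hMN : M ≤ N) : Good N F D where
  bd x := (h.bd x).trans hMN
  bdD k x := (h.bdD k x).trans hMN
  lip x z := (h.lip x z).trans (by gcongr)
  lipD k x z := (h.lipD k x z).trans (by gcongr)
  inc z := (h.inc z).trans (ENNReal.ofReal_le_ofReal (by gcongr))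
  rem z := (h.rem z).trans (ENNReal.ofReal_le_ofReal (by gcongr))

lemma ker_int {Y : Type*} [NormedAddCommGroup Y] [NormedSpace ℝ Y] {D : V d → ℝ} (hD : Continuous D) (hDc : HasCompactSupport D) {B : V d → Y} (hB : MemLp B 2) (x : V d) :
    Integrable (fun y => D (x - y) • B y) := by
  have h1 : MemLp (fun y => D (x - y)) 2 := Continuous.memLp_of_hasCompactSupport (by fun_prop)
    (hDc.comp_homeomorph (Homeomorph.subLeft x))
  have := hB.smul h1 (r := 1)
  rw [memLp_one_iff_integrable] at this
  exact this

/-- shorthand for unit vectors -/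
abbrev ev (i : Fin d) : V d := EuclideanSpace.single i 1

lemma test_shift (h : Moll s φ) (x : V d) : Test (fun y => φ (x - y)) :=
  ⟨(h.smooth.of_le (by norm_num)).comp (contDiff_const.sub contDiff_id), h.hcs.comp_homeomorph (Homeomorph.subLeft x)⟩

lemma fderiv_shift (h : Moll s φ) (x y v : V d) : fderiv ℝ (fun y => φ (x - y)) y v = - fderiv ℝ φ (x - y) v := by
  have h1 : HasFDerivAt φ (fderiv ℝ φ (x - y)) (x - y) := (h.smooth.differentiable (by norm_num) _).hasFDerivAt
  have h2 : HasFDerivAt (fun y : V d => x - y) (-ContinuousLinearMap.id ℝ (V d)) y := by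
    simpa using (hasFDerivAt_id y).const_sub x
  have h3 := h1.comp y h2
  have h4 : fderiv ℝ (fun y => φ (x - y)) y = (fderiv ℝ φ (x - y)).comp (-ContinuousLinearMap.id ℝ (V d)) := h3.fderiv
  rw [h4]
  simp

lemma Moll.dcont (h : Moll s φ) (v : V d) : Continuous fun p => fderiv ℝ φ p v :=
  (h.smooth.continuous_fderiv (by norm_num)).clm_apply continuous_const

lemma Moll.dhcs (h : Moll s φ) (v : V d) : HasCompactSupport fun p => fderiv ℝ φ p v := h.hcs.fderiv_apply (𝕜 := ℝ) v

lemma rel_aux (h : Moll s φ) {b : V d → V d} (hb : MemLp b 2) (x : V d) :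
    ∑ j, ∫ y, fderiv ℝ φ (x - y) (ev j) • b y j = - ∫ y, ⟪b y, gradient (fun y => φ (x - y)) y⟫ := by
  rw [← integral_finsetSum, ← integral_neg]
  · refine integral_congr_ae (ae_of_all _ fun y => ?_)
    simp only
    rw [real_inner_comm, inner_gradient, fderiv_shift h, neg_neg]
    conv_rhs => rw [sum_single (b y)]
    rw [map_sum]
    refine Finset.sum_congr rfl fun j _ => ?_
    rw [map_smul, smul_eq_mul, smul_eq_mul, mul_comm]
  · intro j _
    exact ker_int (h.dcont _) (h.dhcs _) (hb.eval_piLp j) x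

lemma rel (h : Moll s φ) {us' : V d → ℝ} {b : Fin d → V d → V d} (hb : ∀ i, MemLp (b i) 2)
    (heq : ∀ i f, Test f → ∫ y, ⟪b i y, gradient f y⟫ = ∫ y, us' y * fderiv ℝ f y (ev i)) (l : ℝ)
    (hB : MemLp (fun y => (WithLp.toLp 2 (fun i => l • b i y) : W d)) 2) (x : V d) (i : Fin d) :
    cv (fun p => fderiv ℝ φ p (ev i)) (fun y => l * us' y) x =
      ∑ j, ent i j (cv (fun p => fderiv ℝ φ p (ev j)) (fun y => (WithLp.toLp 2 (fun i => l • b i y) : W d)) x) := by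
  have e1 : ∀ j, ent i j (cv (fun p => fderiv ℝ φ p (ev j)) (fun y => (WithLp.toLp 2 (fun i => l • b i y) : W d)) x)
      = l * ∫ y, fderiv ℝ φ (x - y) (ev j) • b i y j := by
    intro j
    rw [cv, ← ContinuousLinearMap.integral_comp_comm _ (ker_int (h.dcont _) (h.dhcs _) hB x), ← integral_const_mul]
    refine integral_congr_ae (ae_of_all _ fun y => ?_)
    simp only [map_smul, ent_apply]
    simp only [PiLp.smul_apply, smul_eq_mul]
    ring
  simp only [e1]
  rw [← Finset.mul_sum, rel_aux h (hb i) x, heq i _ (test_shift h x), ← integral_neg, ← integral_const_mul, cv]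
  refine integral_congr_ae (ae_of_all _ fun y => ?_)
  simp only [fderiv_shift h, smul_eq_mul]
  ring

lemma enorm_W (w : W d) : ‖w‖ₑ ≤ ∑ i, ‖w i‖ₑ := by
  have : ‖w‖ ≤ ∑ i, ‖w i‖ := by
    refine abs_le_of_sq_le_sq' ?_ (Finset.sum_nonneg fun i _ => norm_nonneg _) |>.2
    rw [PiLp.norm_sq_eq_of_L2]
    exact Finset.sum_sq_le_sq_sum_of_nonneg fun i _ => norm_nonneg _
  rw [← ofReal_norm]
  refine (ENNReal.ofReal_le_ofReal this).trans ?_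
  rw [ENNReal.ofReal_sum_of_nonneg fun i _ => norm_nonneg _]
  simp only [ofReal_norm, le_refl]

lemma enorm_sq_W (w : W d) : ‖w‖ₑ ^ 2 = ∑ i, ‖w i‖ₑ ^ 2 := by
  rw [← ofReal_sq_norm, PiLp.norm_sq_eq_of_L2, ENNReal.ofReal_sum_of_nonneg fun i _ => by positivity]
  simp only [ofReal_sq_norm]

lemma B1_bd {b : Fin d → V d → V d} (hb : ∀ i, MemLp (b i) 2) {κ l : ℝ} (hl : 0 ≤ l) (h1 : ∀ i, ∫⁻ y, ‖b i y‖ₑ ≤ ENNReal.ofReal κ) :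
    ∫⁻ y, ‖(WithLp.toLp 2 (fun i => l • b i y) : W d)‖ₑ ≤ d * ENNReal.ofReal (l * κ) := by
  calc _ ≤ ∫⁻ y, ∑ i, ENNReal.ofReal l * ‖b i y‖ₑ := by
        refine lintegral_mono fun y => (enorm_W _).trans (le_of_eq ?_)
        refine Finset.sum_congr rfl fun i _ => ?_
        simp only [enorm_smul, Real.enorm_of_nonneg hl]
    _ = ∑ i, ENNReal.ofReal l * ∫⁻ y, ‖b i y‖ₑ := by
        rw [lintegral_finsetSum' _ fun i _ => (hb i).1.enorm.const_mul _]
        simp only [lintegral_const_mul' _ _ ENNReal.ofReal_ne_top]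
    _ ≤ ∑ _i : Fin d, ENNReal.ofReal (l * κ) := by
        refine Finset.sum_le_sum fun i _ => ?_
        rw [ENNReal.ofReal_mul hl]
        gcongr
        exact h1 i
    _ = _ := by simp

lemma B2_bd {b : Fin d → V d → V d} (hb : ∀ i, MemLp (b i) 2) {κ l : ℝ} (hl : 0 ≤ l) (h1 : ∀ i, ∫⁻ y, ‖b i y‖ₑ ^ 2 ≤ ENNReal.ofReal κ) :
    ∫⁻ y, ‖(WithLp.toLp 2 (fun i => l • b i y) : W d)‖ₑ ^ 2 ≤ d * ENNReal.ofReal (l ^ 2 * κ) := by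
  calc _ ≤ ∫⁻ y, ∑ i, ENNReal.ofReal (l ^ 2) * ‖b i y‖ₑ ^ 2 := by
        refine lintegral_mono fun y => (enorm_sq_W _).le.trans (le_of_eq ?_)
        refine Finset.sum_congr rfl fun i _ => ?_
        simp only [enorm_smul, Real.enorm_of_nonneg hl, mul_pow, ENNReal.ofReal_pow hl]
    _ = ∑ i, ENNReal.ofReal (l ^ 2) * ∫⁻ y, ‖b i y‖ₑ ^ 2 := by
        rw [lintegral_finsetSum' _ fun i _ => ((hb i).1.enorm.pow_const 2).const_mul _]
        simp only [lintegral_const_mul' _ _ ENNReal.ofReal_ne_top]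
    _ ≤ ∑ _i : Fin d, ENNReal.ofReal (l ^ 2 * κ) := by
        refine Finset.sum_le_sum fun i _ => ?_
        rw [ENNReal.ofReal_mul (by positivity)]
        gcongr
        exact h1 i
    _ = _ := by simp

lemma upper {a1 a2 : V d → W d} (h1 : Measurable a1) {u : V d → ℝ} (hu : ∀ x, 0 ≤ u x) {T : Set (V d)} (hT : MeasurableSet T)
    (huT : ∀ x ∉ T, u x = 0) {C : ℝ} (hC : 0 ≤ C) :
    ∫⁻ x, ENNReal.ofReal (bW C (a1 x + a2 x) (u x)) ≤ volume T + ENNReal.ofReal (C + 4) * ((∫⁻ x, ‖a1 x‖ₑ) + ∫⁻ x, ‖a2 x‖ₑ ^ 2) := by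
  calc _ ≤ ∫⁻ x, (T.indicator 1 x + ENNReal.ofReal (C + 4) * (‖a1 x‖ₑ + ‖a2 x‖ₑ ^ 2)) := by
        refine lintegral_mono fun x => ?_
        have e1 := bW_up C (a1 x + a2 x) (hu x)
        have e2 := mul_le_mul_of_nonneg_left (theta_add (a1 x) (a2 x)) (show 0 ≤ C + 4 by linarith)
        have e3 : ENNReal.ofReal (1 - 1 / (1 + u x)) ≤ T.indicator 1 x := by
          by_cases hx : x ∈ T
          · rw [Set.indicator_of_mem hx, Pi.one_apply, ← ENNReal.ofReal_one]
            refine ENNReal.ofReal_le_ofReal ?_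
            have : 0 ≤ 1 / (1 + u x) := by have := hu x; positivity
            linarith
          · rw [huT x hx]; simp
        have e4 : ENNReal.ofReal (C + 4) * (‖a1 x‖ₑ + ‖a2 x‖ₑ ^ 2) = ENNReal.ofReal ((C + 4) * (‖a1 x‖ + ‖a2 x‖ ^ 2)) := by
          rw [ENNReal.ofReal_mul (by linarith), ENNReal.ofReal_add (norm_nonneg _) (by positivity), ofReal_norm, ofReal_sq_norm]
        rw [e4]
        refine (ENNReal.ofReal_le_ofReal (e1.trans (add_le_add_right e2 _))).trans ?_
        exact ENNReal.ofReal_add_le.trans (add_le_add_left e3 _)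
    _ = _ := by
        rw [lintegral_add_left (measurable_one.indicator hT), lintegral_indicator_one hT, lintegral_const_mul' _ _ ENNReal.ofReal_ne_top,
          lintegral_add_left h1.enorm]

end
end CR

namespace CR

section
variable {d : ℕ} {s : ℝ} {φ : V d → ℝ}

/-- the constant from the flow lemma -/
abbrev CC (d : ℕ) : ℝ := 4 * (4 * d) + 38

lemma cv_add (h : Moll s φ) {B1 B2 : V d → W d} (h1 : MemLp B1 2) (h2 : MemLp B2 2) (x : V d) :
    cv φ (fun y => B1 y + B2 y) x = cv φ B1 x + cv φ B2 x := by
  simp only [cv, smul_add]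
  exact integral_add (ker_int h.cont h.hcs h1 x) (ker_int h.cont h.hcs h2 x)

lemma cv_meas (h : Moll s φ) {B : V d → W d} (hB : MemLp B 2) : Measurable (cv φ B) := by
  obtain ⟨M, hM, hG⟩ := good_cv h.smooth h.supp hB
  exact (hG.cont hM).measurable

lemma cv_lint (h : Moll s φ) {U : V d → ℝ} (hU : MemLp U 2) (hU0 : ∀ x, 0 ≤ U x) :
    ∫⁻ x, ENNReal.ofReal (cv φ U x) = ∫⁻ y, ENNReal.ofReal (U y) := by
  rw [← young_swap h hU.1.aemeasurable.ennreal_ofReal]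
  refine lintegral_congr fun x => ?_
  rw [cv, ofReal_integral_eq_lintegral_ofReal (ker_int h.cont h.hcs hU x) (ae_of_all _ fun y => mul_nonneg (h.nonneg _) (hU0 y))]
  refine lintegral_congr fun y => ?_
  rw [smul_eq_mul, ENNReal.ofReal_mul (h.nonneg _)]

lemma cv_zero (h : Moll s φ) (hs : 0 ≤ s) {K : Set (V d)} {U : V d → ℝ} (hU : ∀ y ∉ cthickening s K, U y = 0) {x : V d}
    (hx : x ∉ cthickening (2 * s) K) : cv φ U x = 0 := by
  rw [cv, integral_congr_ae (g := fun _ => (0:ℝ)), integral_zero]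
  refine ae_of_all _ fun y => ?_
  simp only [smul_eq_mul, mul_eq_zero]
  by_contra! h0
  refine hx ?_
  have h1 : y ∈ cthickening s K := by by_contra h2; exact h0.2 (hU y h2)
  have h2 : ‖x - y‖ ≤ s := by by_contra! h3; exact h0.1 (h.zero_of h3)
  rw [two_mul]
  exact cthickening_cthickening_subset hs hs K (mem_cthickening_of_dist_le x y s _ h1 (by rwa [dist_eq_norm]))

lemma final_ineq (h : Moll s φ) (hs : 0 ≤ s) (ν : Measure (V d)) [IsFiniteMeasure ν] {K : Set (V d)} (hK : IsCompact K) (hνK : ν Kᶜ = 0)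
    {m κ l ρ : ℝ} (hm : 0 ≤ m) (hνm : ν univ = ENNReal.ofReal m) (hl : 0 ≤ l) (hlm : l * m ≤ 1)
    {b1 b2 : Fin d → V d → V d} (h1 : ∀ i, MemLp (b1 i) 2) (h2 : ∀ i, MemLp (b2 i) 2)
    (h3 : ∀ i, ∫⁻ y, ‖b1 i y‖ₑ ≤ ENNReal.ofReal κ) (h4 : ∀ i, ∫⁻ y, ‖b2 i y‖ₑ ^ 2 ≤ ENNReal.ofReal (ρ ^ 2))
    (h5 : ∀ i f, Test f → ∫ y, ⟪b1 i y + b2 i y, gradient f y⟫ = ∫ y, us φ ν y * fderiv ℝ f y (ev i)) :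
    ENNReal.ofReal (l * m / 2) ≤ volume (cthickening (2 * s) K) +
      ENNReal.ofReal (CC d + 4) * (d * ENNReal.ofReal (l * κ) + d * ENNReal.ofReal (l ^ 2 * ρ ^ 2)) := by
  have hC : 0 ≤ CC d := by positivity
  set B1 : V d → W d := fun y => WithLp.toLp 2 (fun i => l • b1 i y) with hB1
  set B2 : V d → W d := fun y => WithLp.toLp 2 (fun i => l • b2 i y) with hB2
  set B : V d → W d := fun y => WithLp.toLp 2 (fun i => l • (b1 i y + b2 i y)) with hB
  set U : V d → ℝ := fun y => l * us φ ν y with hU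
  have mB1 : MemLp B1 2 := MemLp.of_eval_piLp fun i => (h1 i).const_smul l
  have mB2 : MemLp B2 2 := MemLp.of_eval_piLp fun i => (h2 i).const_smul l
  have mB : MemLp B 2 := MemLp.of_eval_piLp fun i => ((h1 i).add (h2 i)).const_smul l
  have mU : MemLp U 2 := (us_memLp ν h hK hνK 2).const_mul l
  have hU0 : ∀ y, 0 ≤ U y := fun y => mul_nonneg hl (us_nonneg ν h y)
  have hu0 : ∀ x, 0 ≤ cv φ U x := fun x => integral_nonneg fun y => mul_nonneg (h.nonneg _) (hU0 y)
  obtain ⟨M1, hM1, ga⟩ := good_cv h.smooth h.supp mB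
  obtain ⟨M2, hM2, gu⟩ := good_cv h.smooth h.supp mU
  have hM : 0 ≤ max M1 M2 := le_max_of_le_left hM1
  have ga' := ga.mono (le_max_left M1 M2)
  have gu' := gu.mono (le_max_right M1 M2)
  have hflow := flow hM ga' gu' hu0 (fun x i => rel h (b := fun i y => b1 i y + b2 i y) (fun i => (h1 i).add (h2 i)) h5 l mB x i)
  have hlow := lower hM gu' hu0 (a := cv φ B) hC hlm (mul_nonneg hl hm) (by
    rw [cv_lint h mU hU0]
    simp only [hU, ENNReal.ofReal_mul hl]
    rw [lintegral_const_mul' _ _ ENNReal.ofReal_ne_top, us_lint ν h, hνm])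
  have hadd : ∀ x, cv φ B x = cv φ B1 x + cv φ B2 x := fun x => by
    rw [← cv_add h mB1 mB2]
    congr 1
    funext y
    simp only [hB, hB1, hB2, ← WithLp.toLp_add]
    congr 1
    funext i
    simp only [smul_add, Pi.add_apply]
  have hup := upper (a1 := cv φ B1) (a2 := cv φ B2) (cv_meas h mB1) hu0 (T := cthickening (2 * s) K) isClosed_cthickening.measurableSet
    (fun x hx => cv_zero h hs (fun y hy => by simp only [hU, us_zero ν h hνK hy, mul_zero]) hx) hC
  simp only [← hadd] at hup
  refine (hlow.trans hflow).trans (hup.trans ?_)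
  gcongr
  · exact (young_one h mB1.1).trans (B1_bd h1 hl h3)
  · exact (young_two h mB2.1).trans (B2_bd h2 hl h4)

lemma key (ν : Measure (V d)) [IsFiniteMeasure ν] {K : Set (V d)} (hK : IsCompact K) (hνK : ν Kᶜ = 0) (hvol : volume K = 0)
    (h : ∀ f : V d → ℝ, (∃ C : NNReal, LipschitzWith C f) → ∀ᵐ x ∂ν, DifferentiableAt ℝ f x) : ν univ = 0 := by
  by_contra hne
  set m := (ν univ).toReal with hm
  have hνm : ν univ = ENNReal.ofReal m := (ENNReal.ofReal_toReal (measure_ne_top ν _)).symm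
  have hm0 : 0 < m := ENNReal.toReal_pos hne (measure_ne_top ν _)
  have hC : 0 ≤ CC d := by positivity
  obtain ⟨R, hKR⟩ := hK.isBounded.subset_ball (0 : V d)
  set κ := m / (8 * (d + 1) * (CC d + 4)) with hκ
  have hκ0 : 0 < κ := by positivity
  have hdual := fun i : Fin d => dual ν hK hνK hKR h (e := ev i) (by simp) hκ0
  choose ρ0 hρ0 hd using hdual
  -- choose rho
  obtain ⟨ρ, hρpos, hρm, hρ⟩ : ∃ ρ > 0, κ * m ≤ ρ ^ 2 ∧ ∀ i, ρ0 i ≤ ρ := by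
    have hs : 0 ≤ ∑ i, ρ0 i := Finset.sum_nonneg fun i _ => (hρ0 i).le
    refine ⟨√(κ * m) + ∑ i, ρ0 i, by positivity, ?_, fun i => ?_⟩
    · calc κ * m = √(κ * m) ^ 2 := (Real.sq_sqrt (by positivity)).symm
        _ ≤ _ := by gcongr; linarith
    · have := Finset.single_le_sum (fun i _ => (hρ0 i).le) (Finset.mem_univ i)
      have := Real.sqrt_nonneg (κ * m)
      linarith
  set l := κ / ρ ^ 2 with hl
  have hl0 : 0 < l := by positivity
  have hlm : l * m ≤ 1 := by
    rw [hl, div_mul_eq_mul_div, div_le_one (by positivity)]; exact hρm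
  have hlρ : l ^ 2 * ρ ^ 2 = l * κ := by rw [hl]; field_simp
  have hmain : ∀ s > 0, ENNReal.ofReal (l * m / 2) ≤ volume (cthickening (2 * s) K) +
      ENNReal.ofReal (CC d + 4) * (d * ENNReal.ofReal (l * κ) + d * ENNReal.ofReal (l * κ)) := by
    intro s hs
    obtain ⟨φ, hφ⟩ := exists_moll (d := d) hs
    have hd' := fun i : Fin d => hd i ρ (hρ i) s φ hφ
    choose b1 b2 q1 q2 q3 q4 q5 using hd'
    have := final_ineq hφ hs.le ν hK hνK hm0.le hνm hl0.le hlm q1 q2 q3 q4 q5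
    rwa [hlρ] at this
  have hlim : Tendsto (fun s : ℝ => volume (cthickening (2 * s) K) +
      ENNReal.ofReal (CC d + 4) * (d * ENNReal.ofReal (l * κ) + d * ENNReal.ofReal (l * κ))) (𝓝[>] 0)
      (𝓝 (0 + ENNReal.ofReal (CC d + 4) * (d * ENNReal.ofReal (l * κ) + d * ENNReal.ofReal (l * κ)))) := by
    refine Tendsto.add_const _ ?_
    have h1 := tendsto_measure_cthickening_of_isCompact (μ := (volume : Measure (V d))) hK
    rw [hvol] at h1
    refine h1.comp ?_
    have : Tendsto (fun s : ℝ => 2 * s) (𝓝 0) (𝓝 (2 * 0)) := tendsto_id.const_mul 2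
    rw [mul_zero] at this
    exact this.mono_left nhdsWithin_le_nhds
  have hfin := ge_of_tendsto hlim (by filter_upwards [self_mem_nhdsWithin] with s hs using hmain s hs)
  have e : ENNReal.ofReal (CC d + 4) * (d * ENNReal.ofReal (l * κ) + d * ENNReal.ofReal (l * κ))
      = ENNReal.ofReal ((CC d + 4) * (d * (l * κ) + d * (l * κ))) := by
    have e0 : ENNReal.ofReal ((d:ℝ) * (l * κ)) = d * ENNReal.ofReal (l * κ) := by
      rw [ENNReal.ofReal_mul (Nat.cast_nonneg d), ENNReal.ofReal_natCast]
    rw [ENNReal.ofReal_mul (p := CC d + 4) (q := d * (l * κ) + d * (l * κ)) (by linarith),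
      ENNReal.ofReal_add (p := (d:ℝ) * (l * κ)) (q := (d:ℝ) * (l * κ)) (by positivity) (by positivity), e0]
  rw [zero_add, e, ENNReal.ofReal_le_ofReal_iff (by positivity)] at hfin
  have e2 : 8 * ((d + 1) * (CC d + 4) * κ) = m := by rw [hκ]; field_simp
  have e3 : (CC d + 4) * (d * (l * κ) + d * (l * κ)) ≤ l * (m / 4) := by
    have : (CC d + 4) * (d * (l * κ) + d * (l * κ)) = l * (2 * (d * (CC d + 4) * κ)) := by ring
    rw [this]
    refine mul_le_mul_of_nonneg_left ?_ hl0.le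
    have : 0 ≤ (CC d + 4) * κ := by positivity
    linarith
  have : 0 < l * m := by positivity
  linarith

theorem main {d : ℕ} (μ : Measure (V d)) [μ.Regular]
    (h : ∀ f : V d → ℝ, (∃ K : NNReal, LipschitzWith K f) → ∀ᵐ x ∂μ, DifferentiableAt ℝ f x) :
    μ ≪ volume := by
  refine Measure.AbsolutelyContinuous.mk fun A hA hA0 => ?_
  by_contra hne
  obtain ⟨K, hKA, hK, hpos⟩ := hA.exists_lt_isCompact (μ := μ) (pos_iff_ne_zero.2 hne)
  have : IsFiniteMeasure (μ.restrict K) := ⟨by rw [Measure.restrict_apply_univ]; exact hK.measure_lt_top⟩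
  have := key (μ.restrict K) hK (by rw [Measure.restrict_apply hK.measurableSet.compl]; simp) (measure_mono_null hKA hA0)
    (fun f hf => ae_restrict_of_ae (h f hf))
  rw [Measure.restrict_apply_univ] at this
  exact hpos.ne' this

end
end CR

/-- weak converse of Rademacher, De Philippis–Rindler. If `μ` is a positive
Radon measure on `ℝ^d` such that every Lipschitz function `f : ℝ^d → ℝ` is differentiable
`μ`-almost everywhere, then `μ` is absolutely continuous with respect to the `d`-dimensional
Lebesgue measure. -/
theorem stmt5 {d : ℕ} (μ : Measure (EuclideanSpace ℝ (Fin d))) [μ.Regular]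
    (h : ∀ f : EuclideanSpace ℝ (Fin d) → ℝ, (∃ K : NNReal, LipschitzWith K f) →
      ∀ᵐ x ∂μ, DifferentiableAt ℝ f x) :
    μ ≪ volume := by
  exact CR.main μ h
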